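/- arXiv:2310.03459 — 3 statements merged into one kernel-verified Lean document; each statement's English description precedes it below -/
import Mathlib

section
/- Let d ≥ 2. For every function f : ℚ_S^d → ℝ that is bounded, compactly supported, and semicontinuous (i.e., either everywhere upper semicontinuous or everywhere lower semicontinuous), and for every admissible measure μ on G_d/Γ_d, the S-primitive Siegel transform f̂ defined on G_d/Γ_d by f̂(gΓ_d) = ∑_{v ∈ P(ℤ_S^d)} f(g·v) is μ-integrable and satisfies ∫_{G_d/Γ_d} f̂ dμ = (1/ζ_S(d)) ∫_{ℚ_S^d} f(x) dvol_S(x). -/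
open MeasureTheory Matrix

noncomputable section

noncomputable instance Padic.instMeasurableSpace' {p : ℕ} [Fact p.Prime] :
    MeasurableSpace ℚ_[p] := borel _

instance Padic.instBorelSpace' {p : ℕ} [Fact p.Prime] : BorelSpace ℚ_[p] := ⟨rfl⟩

instance Matrix.SpecialLinearGroup.instTopologicalSpace'
    {n : Type*} [DecidableEq n] [Fintype n] {R : Type*} [CommRing R] [TopologicalSpace R] :
    TopologicalSpace (SpecialLinearGroup n R) :=
  show TopologicalSpace {A : Matrix n n R // A.det = 1} from inferInstance

noncomputable instance Matrix.SpecialLinearGroup.instMeasurableSpace'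
    {n : Type*} [DecidableEq n] [Fintype n] {R : Type*} [CommRing R] [TopologicalSpace R] :
    MeasurableSpace (SpecialLinearGroup n R) := borel _

/-- A finite set of distinct primes `p 0, …, p (s-1)`. -/
structure PrimeTup where
  s : ℕ
  p : Fin s → ℕ
  hp : ∀ i, (p i).Prime
  inj : Function.Injective p

namespace PrimeTup

instance (S : PrimeTup) (i : Fin S.s) : Fact (S.p i).Prime := ⟨S.hp i⟩

/-- The `p i`-adic field. -/
abbrev Qp (S : PrimeTup) (i : Fin S.s) : Type := ℚ_[S.p i]

/-- The space `ℚ_S^d = ℝ^d × ∏ᵢ ℚ_{pᵢ}^d`. -/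
abbrev QS (S : PrimeTup) (d : ℕ) : Type :=
  (Fin d → ℝ) × ((i : Fin S.s) → Fin d → S.Qp i)

/-- The ring `ℤ_S = ℤ[1/p₁, …, 1/p_s] ⊆ ℚ`. -/
def Zs (S : PrimeTup) : Subring ℚ :=
  Subring.closure (Set.range fun i : Fin S.s => ((S.p i : ℚ))⁻¹)

/-- The group `G_d = SL_d(ℝ) × ∏ᵢ SL_d(ℚ_{pᵢ})`. -/
abbrev G (S : PrimeTup) (d : ℕ) : Type :=
  SpecialLinearGroup (Fin d) ℝ × ((i : Fin S.s) → SpecialLinearGroup (Fin d) (S.Qp i))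

/-- Diagonal embedding of `SL_d(ℤ_S)` into `G_d`. -/
def toG (S : PrimeTup) (d : ℕ) : SpecialLinearGroup (Fin d) S.Zs →* S.G d :=
  MonoidHom.prod
    (SpecialLinearGroup.map ((Rat.castHom ℝ).comp S.Zs.subtype))
    (Pi.monoidHom fun i => SpecialLinearGroup.map ((Rat.castHom (S.Qp i)).comp S.Zs.subtype))

/-- The lattice `Γ_d`, the diagonally embedded copy of `SL_d(ℤ_S)` in `G_d`. -/
def Gamma (S : PrimeTup) (d : ℕ) : Subgroup (S.G d) := (S.toG d).range

/-- The componentwise linear action of `G_d` on `ℚ_S^d`. -/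
def act (S : PrimeTup) {d : ℕ} (g : S.G d) (x : S.QS d) : S.QS d :=
  ((g.1 : Matrix (Fin d) (Fin d) ℝ).mulVec x.1,
   fun i => ((g.2 i : Matrix (Fin d) (Fin d) (S.Qp i))).mulVec (x.2 i))

/-- Diagonal embedding of rational vectors into `ℚ_S^d`. -/
def diag (S : PrimeTup) {d : ℕ} (v : Fin d → ℚ) : S.QS d :=
  (fun j => (v j : ℝ), fun i j => (v j : S.Qp i))

/-- The first standard basis vector of `ℤ_S^d`. -/
def e1 (S : PrimeTup) (d : ℕ) : Fin d → S.Zs := fun j => if j.1 = 0 then 1 else 0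

/-- The set of `S`-primitive vectors `P(ℤ_S^d) = SL_d(ℤ_S)·e₁` inside `(ℤ_S)^d`. -/
def primZs (S : PrimeTup) (d : ℕ) : Set (Fin d → S.Zs) :=
  {w | ∃ γ : SpecialLinearGroup (Fin d) S.Zs,
    w = (γ : Matrix (Fin d) (Fin d) S.Zs).mulVec (S.e1 d)}

/-- The set of `S`-primitive vectors regarded inside `ℚ_S^d` via the diagonal embedding. -/
def prim (S : PrimeTup) (d : ℕ) : Set (S.QS d) :=
  (fun w : Fin d → S.Zs => S.diag fun j => ((w j : ℚ))) '' S.primZs d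

/-- Multiplication of a vector of `ℚ_S^d` by a (diagonally embedded) rational scalar. -/
def ratSMul (S : PrimeTup) {d : ℕ} (q : ℚ) (x : S.QS d) : S.QS d :=
  (fun j => (q : ℝ) * x.1 j, fun i j => (q : S.Qp i) * x.2 i j)

/-- `ℕ_S`: positive integers coprime to all the primes of `S`. -/
def NS (S : PrimeTup) : Set ℕ := {m | 0 < m ∧ ∀ i, ¬ (S.p i ∣ m)}

/-- The `S`-arithmetic zeta value `ζ_S(d)`. -/
def zetaS (S : PrimeTup) (d : ℕ) : ℝ := ∑' m : S.NS, (1 : ℝ) / ((m : ℕ) : ℝ) ^ d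

/-- The "unit box" `[0,1]^d × ∏ᵢ ℤ_{pᵢ}^d` used to normalize the volume on `ℚ_S^d`. -/
def unitBox (S : PrimeTup) (d : ℕ) : Set (S.QS d) :=
  {x | (∀ j, x.1 j ∈ Set.Icc (0:ℝ) 1) ∧ ∀ i j, ‖x.2 i j‖ ≤ 1}

/-- `v` is the measure `vol_S` on `ℚ_S^d`: the (unique) translation-invariant regular Borel
measure giving the unit box `[0,1]^d × ∏ᵢ ℤ_{pᵢ}^d` measure one; equivalently, the product of
Lebesgue measure on `ℝ^d` and the normalized Haar measures on the `ℚ_{pᵢ}^d`. -/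
def IsVolS (S : PrimeTup) (d : ℕ) (v : Measure (S.QS d)) : Prop :=
  v.IsAddHaarMeasure ∧ v.Regular ∧ v (S.unitBox d) = 1

/-- `μ` is an admissible measure on `G_d/Γ_d`: a regular Borel probability measure invariant
under the left `G_d`-action. -/
def Admissible (S : PrimeTup) (d : ℕ) (μ : Measure (S.G d ⧸ S.Gamma d)) : Prop :=
  IsProbabilityMeasure μ ∧ μ.Regular ∧ SMulInvariantMeasure (S.G d) (S.G d ⧸ S.Gamma d) μ

end PrimeTup

end

section Averaging

open Filter Topology
open scoped ENNReal

/-- If averages of `φ` over finite families of measure preserving maps converge pointwise to a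
constant `c`, then `c` is the integral of `φ` (with no integrability assumption on `φ`). -/
theorem lintegral_eq_of_tendsto_average {Y : Type*} [MeasurableSpace Y] (μ : Measure Y)
    [IsProbabilityMeasure μ] {φ : Y → ℝ≥0∞} (hφ : Measurable φ) (c : ℝ≥0∞)
    (J : ℕ → Type) [∀ n, Fintype (J n)] [∀ n, Nonempty (J n)] (τ : ∀ n, J n → Y → Y)
    (hτ : ∀ n j, MeasurePreserving (τ n j) μ μ)
    (hlim : ∀ y, Tendsto (fun n => (Fintype.card (J n) : ℝ≥0∞)⁻¹ * ∑ j, φ (τ n j y)) atTop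
      (𝓝 c)) :
    ∫⁻ y, φ y ∂μ = c := by
  have hcard0 : ∀ n, (Fintype.card (J n) : ℝ≥0∞) ≠ 0 := fun n => by
    simp [Fintype.card_ne_zero]
  have hcardt : ∀ n, (Fintype.card (J n) : ℝ≥0∞) ≠ ∞ := fun n => by simp
  have havg : ∀ (ψ : Y → ℝ≥0∞), Measurable ψ → ∀ n,
      ∫⁻ y, (Fintype.card (J n) : ℝ≥0∞)⁻¹ * ∑ j, ψ (τ n j y) ∂μ = ∫⁻ y, ψ y ∂μ := by
    intro ψ hψ n
    have hm : ∀ j, Measurable fun y => ψ (τ n j y) := fun j => hψ.comp (hτ n j).measurable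
    rw [lintegral_const_mul _ (Finset.measurable_sum _ fun j _ => hm j),
      lintegral_finsetSum _ fun j _ => hm j]
    simp_rw [(hτ n _).lintegral_comp hψ]
    rw [Finset.sum_const, nsmul_eq_mul, ← mul_assoc, Finset.card_univ,
      ENNReal.inv_mul_cancel (hcard0 n) (hcardt n), one_mul]
  have hmeas : ∀ (ψ : Y → ℝ≥0∞), Measurable ψ → ∀ n,
      Measurable fun y => (Fintype.card (J n) : ℝ≥0∞)⁻¹ * ∑ j, ψ (τ n j y) := fun ψ hψ n =>
    (Finset.measurable_sum _ fun j _ => hψ.comp (hτ n j).measurable).const_mul _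
  apply le_antisymm
  · have htrunc : ∀ M : ℕ, ∫⁻ y, min (φ y) M ∂μ ≤ c := by
      intro M
      have h1 : ∀ n, ∫⁻ y, min (φ y) M ∂μ ≤
          ∫⁻ y, min ((Fintype.card (J n) : ℝ≥0∞)⁻¹ * ∑ j, φ (τ n j y)) M ∂μ := by
        intro n
        rw [← havg _ (hφ.min measurable_const) n]
        refine lintegral_mono fun y => le_min ?_ ?_
        · gcongr; exact min_le_left _ _
        · calc (Fintype.card (J n) : ℝ≥0∞)⁻¹ * ∑ j, min (φ (τ n j y)) M
              ≤ (Fintype.card (J n) : ℝ≥0∞)⁻¹ * ∑ _j : J n, (M : ℝ≥0∞) := by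
                gcongr; exact min_le_right _ _
            _ = M := by
                rw [Finset.sum_const, nsmul_eq_mul, ← mul_assoc, Finset.card_univ,
                  ENNReal.inv_mul_cancel (hcard0 n) (hcardt n), one_mul]
      have h2 : Tendsto (fun n => ∫⁻ y, min ((Fintype.card (J n) : ℝ≥0∞)⁻¹ *
          ∑ j, φ (τ n j y)) M ∂μ) atTop (𝓝 (∫⁻ _, min c M ∂μ)) := by
        refine tendsto_lintegral_of_dominated_convergence (fun _ => (M : ℝ≥0∞))
          (fun n => (hmeas φ hφ n).min measurable_const)
          (fun n => Eventually.of_forall fun y => min_le_right _ _) (by simp)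
          (Eventually.of_forall fun y => (hlim y).min tendsto_const_nhds)
      have h3 := ge_of_tendsto' h2 h1
      refine h3.trans ?_
      simp
    have hsup : ∫⁻ y, φ y ∂μ = ⨆ M : ℕ, ∫⁻ y, min (φ y) M ∂μ := by
      rw [← lintegral_iSup (fun M => hφ.min measurable_const)
        (fun a b hab y => min_le_min le_rfl (by exact_mod_cast hab))]
      congr 1 with y
      apply le_antisymm
      · rcases eq_or_ne (φ y) ∞ with h | h
        · rw [h]
          simp [ENNReal.iSup_natCast]
        · obtain ⟨M, hM⟩ := ENNReal.exists_nat_gt h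
          exact le_iSup_of_le M (le_min le_rfl hM.le)
      · exact iSup_le fun M => min_le_left _ _
    rw [hsup]
    exact iSup_le htrunc
  · calc c = ∫⁻ _, c ∂μ := by simp
      _ = ∫⁻ y, liminf (fun n => (Fintype.card (J n) : ℝ≥0∞)⁻¹ * ∑ j, φ (τ n j y)) atTop ∂μ := by
          congr 1 with y
          exact (hlim y).liminf_eq.symm
      _ ≤ liminf (fun n => ∫⁻ y, (Fintype.card (J n) : ℝ≥0∞)⁻¹ * ∑ j, φ (τ n j y) ∂μ) atTop :=
          lintegral_liminf_le fun n => hmeas φ hφ n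
      _ = ∫⁻ y, φ y ∂μ := by simp_rw [havg φ hφ]; simp

end Averaging

namespace PrimeTup

section Arithmetic

variable (S : PrimeTup)

/-- The multiplicative monoid generated by the primes of `S`. -/
def smooth : Submonoid ℕ := Submonoid.closure (Set.range S.p)

variable {S}

theorem p_mem_smooth (i : Fin S.s) : S.p i ∈ S.smooth := Submonoid.subset_closure ⟨i, rfl⟩

theorem smooth_pos {n : ℕ} (hn : n ∈ S.smooth) : 0 < n := by
  induction hn using Submonoid.closure_induction with
  | mem x hx => obtain ⟨i, rfl⟩ := hx; exact (S.hp i).pos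
  | one => exact one_pos
  | mul x y _ _ hx hy => exact Nat.mul_pos hx hy

theorem smooth_inv_mem {n : ℕ} (hn : n ∈ S.smooth) : ((n : ℚ))⁻¹ ∈ S.Zs := by
  induction hn using Submonoid.closure_induction with
  | mem x hx => obtain ⟨i, rfl⟩ := hx; exact Subring.subset_closure ⟨i, rfl⟩
  | one => simp
  | mul x y _ _ hx hy =>
    rw [Nat.cast_mul, mul_inv]
    exact S.Zs.mul_mem hx hy

theorem exists_eq_of_prime_dvd_smooth {n l : ℕ} (hl : l.Prime) (hn : n ∈ S.smooth)
    (h : l ∣ n) : ∃ i, l = S.p i := by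
  induction hn using Submonoid.closure_induction with
  | mem x hx => obtain ⟨i, rfl⟩ := hx; exact ⟨i, (Nat.prime_dvd_prime_iff_eq hl (S.hp i)).1 h⟩
  | one => exact absurd (Nat.dvd_one.1 h) hl.one_lt.ne'
  | mul x y _ _ hx hy => exact (hl.dvd_mul.1 h).elim hx hy

theorem coprime_smooth_NS {n m : ℕ} (hn : n ∈ S.smooth) (hm : m ∈ S.NS) : n.Coprime m := by
  refine Nat.Coprime.symm (Nat.Coprime.symm (Nat.coprime_of_dvd fun l hl hln hlm => ?_))
  obtain ⟨i, rfl⟩ := exists_eq_of_prime_dvd_smooth hl hn hln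
  exact hm.2 i hlm

theorem exists_smooth_mul_eq_int {q : ℚ} (hq : q ∈ S.Zs) :
    ∃ n ∈ S.smooth, ∃ z : ℤ, (n : ℚ) * q = z := by
  induction hq using Subring.closure_induction with
  | mem x hx =>
    obtain ⟨i, rfl⟩ := hx
    refine ⟨S.p i, p_mem_smooth i, 1, ?_⟩
    have : (S.p i : ℚ) ≠ 0 := by exact_mod_cast (S.hp i).ne_zero
    field_simp
    simp
  | zero => exact ⟨1, S.smooth.one_mem, 0, by simp⟩
  | one => exact ⟨1, S.smooth.one_mem, 1, by simp⟩
  | add x y _ _ hx hy =>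
    obtain ⟨n, hn, z, hz⟩ := hx
    obtain ⟨n', hn', z', hz'⟩ := hy
    refine ⟨n * n', S.smooth.mul_mem hn hn', n' * z + n * z', ?_⟩
    push_cast
    rw [← hz, ← hz']
    ring
  | neg x _ hx =>
    obtain ⟨n, hn, z, hz⟩ := hx
    exact ⟨n, hn, -z, by push_cast; rw [← hz]; ring⟩
  | mul x y _ _ hx hy =>
    obtain ⟨n, hn, z, hz⟩ := hx
    obtain ⟨n', hn', z', hz'⟩ := hy
    refine ⟨n * n', S.smooth.mul_mem hn hn', z * z', ?_⟩
    push_cast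
    rw [← hz, ← hz']
    ring

theorem norm_natCast_NS {m : ℕ} (hm : m ∈ S.NS) (i : Fin S.s) : ‖(m : S.Qp i)‖ = 1 := by
  rw [Padic.norm_natCast_eq_one_iff]
  exact (Nat.Prime.coprime_iff_not_dvd (S.hp i)).2 (hm.2 i)

theorem exists_int_of_norm_le_one {q : ℚ} (hq : q ∈ S.Zs) (h : ∀ i, ‖(q : S.Qp i)‖ ≤ 1) :
    ∃ z : ℤ, q = z := by
  obtain ⟨n, hn, z, hz⟩ := exists_smooth_mul_eq_int hq
  have hden : q.den ∣ n := by
    have h1 : q * n = z := by rw [mul_comm]; exact hz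
    have : (q.den : ℤ) ∣ n := by
      have h2 : (q.num : ℚ) * n = z * q.den := by
        rw [← h1]
        conv_rhs => rw [mul_right_comm, Rat.mul_den_eq_num]
      have h3 : q.num * n = z * q.den := by exact_mod_cast h2
      have h4 : IsCoprime (q.den : ℤ) q.num := by
        rw [Int.isCoprime_iff_gcd_eq_one, Int.gcd_comm]
        exact q.reduced
      exact h4.dvd_of_dvd_mul_left ⟨z, by rw [h3]; ring⟩
    exact_mod_cast this
  have hd1 : q.den = 1 := by
    by_contra hne
    obtain ⟨l, hl, hld⟩ := Nat.exists_prime_and_dvd hne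
    obtain ⟨i, rfl⟩ := exists_eq_of_prime_dvd_smooth hl hn (hld.trans hden)
    have hnum : ¬ ((S.p i : ℤ) ∣ q.num) := by
      intro hdvd
      have : S.p i ∣ Nat.gcd q.num.natAbs q.den :=
        Nat.dvd_gcd (Int.natCast_dvd.1 hdvd) hld
      rw [q.reduced] at this
      exact (S.hp i).one_lt.ne' (Nat.dvd_one.1 this)
    have h1 : ‖(q : S.Qp i)‖ * ‖(q.den : S.Qp i)‖ = ‖(q.num : S.Qp i)‖ := by
      rw [← norm_mul]
      congr 1
      exact_mod_cast congrArg (fun r : ℚ => (r : S.Qp i)) (Rat.mul_den_eq_num q)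
    have h2 : ‖(q.den : S.Qp i)‖ < 1 := by
      exact Padic.norm_natCast_lt_one_iff.2 hld
    have h3 : ‖(q.num : S.Qp i)‖ = 1 := by
      refine le_antisymm (Padic.norm_int_le_one _) (not_lt.1 fun hlt => hnum ?_)
      exact Padic.norm_intCast_lt_one_iff.1 hlt
    have h4 := h i
    nlinarith [norm_nonneg (q : S.Qp i), norm_nonneg (q.den : S.Qp i)]
  exact ⟨q.num, (Rat.coe_int_num_of_den_eq_one hd1).symm⟩

theorem exists_Zs_approx (x : ∀ i, S.Qp i) : ∃ q ∈ S.Zs, ∀ i, ‖x i - (q : S.Qp i)‖ ≤ 1 := by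
  have key : ∀ i, ∃ r ∈ S.Zs, ‖x i - (r : S.Qp i)‖ ≤ 1 ∧ ∀ j ≠ i, ‖(r : S.Qp j)‖ ≤ 1 := by
    intro i
    have hp1 : (1 : ℝ) < S.p i := by exact_mod_cast (S.hp i).one_lt
    obtain ⟨n, hn⟩ := pow_unbounded_of_one_lt ‖x i‖ hp1
    have hp0 : (S.p i : S.Qp i) ≠ 0 := by exact_mod_cast (S.hp i).ne_zero
    have hy : ‖x i * (S.p i : S.Qp i) ^ n‖ ≤ 1 := by
      rw [norm_mul, norm_pow, Padic.norm_p, inv_pow]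
      rw [← div_eq_mul_inv, div_le_one (by positivity)]
      exact hn.le
    set y : ℤ_[S.p i] := ⟨_, hy⟩ with hydef
    have ha := (PadicInt.norm_le_pow_iff_mem_span_pow _ n).2 (PadicInt.appr_spec n y)
    refine ⟨(y.appr n : ℚ) * ((S.p i ^ n : ℕ) : ℚ)⁻¹, S.Zs.mul_mem (natCast_mem _ _)
      (smooth_inv_mem (S.smooth.pow_mem (p_mem_smooth i) n)), ?_, fun j hj => ?_⟩
    · have h1 : x i - (((y.appr n : ℚ) * ((S.p i ^ n : ℕ) : ℚ)⁻¹ : ℚ) : S.Qp i) =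
          ((y - (y.appr n : ℤ_[S.p i]) : ℤ_[S.p i]) : S.Qp i) * ((S.p i : S.Qp i) ^ n)⁻¹ := by
        push_cast
        rw [hydef]
        field_simp
      rw [h1, norm_mul, norm_inv, norm_pow, Padic.norm_p, inv_pow, inv_inv]
      rw [PadicInt.norm_def] at ha
      refine (mul_le_mul_of_nonneg_right ha (by positivity)).trans_eq ?_
      rw [_root_.zpow_neg, zpow_natCast, inv_mul_cancel₀ (by positivity)]
    · have h1 : ‖((S.p i : ℕ) : S.Qp j)‖ = 1 := by
        rw [Padic.norm_natCast_eq_one_iff]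
        exact (Nat.coprime_primes (S.hp j) (S.hp i)).2 fun h => hj (S.inj h)
      push_cast
      rw [norm_mul, norm_inv, norm_pow, h1, one_pow, inv_one, mul_one]
      exact_mod_cast Padic.norm_int_le_one _
  choose r hr hr1 hr2 using key
  refine ⟨∑ i, r i, S.Zs.sum_mem fun i _ => hr i, fun i => ?_⟩
  have : x i - ((∑ j, r j : ℚ) : S.Qp i) =
      (x i - (r i : S.Qp i)) - ∑ j ∈ Finset.univ.erase i, (r j : S.Qp i) := by
    push_cast
    rw [← Finset.add_sum_erase _ _ (Finset.mem_univ i)]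
    ring
  rw [this]
  rw [sub_eq_add_neg]
  refine (IsUltrametricDist.norm_add_le_max _ _).trans (max_le (hr1 i) ?_)
  rw [norm_neg]
  refine IsUltrametricDist.norm_sum_le_of_forall_le_of_nonneg zero_le_one fun j hj => ?_
  exact hr2 j i (Finset.ne_of_mem_erase hj).symm

end Arithmetic

end PrimeTup

section VectorReduction

variable {d : ℕ}

theorem transvection_mulVec_eq_update {n R : Type*} [Fintype n] [DecidableEq n] [CommRing R]
    {i j : n} (c : R) (z : n → R) :
    Matrix.transvection i j c *ᵥ z = Function.update z i (z i + c * z j) := by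
  ext k
  rw [Matrix.transvection, Matrix.add_mulVec, Matrix.one_mulVec, Matrix.single_mulVec_eq]
  rcases eq_or_ne k i with rfl | hk
  · simp
  · simp [hk]

theorem exists_smul_SL_mulVec_of_update {n : Type*} [Fintype n] [DecidableEq n]
    {i j : n} (hij : i ≠ j) (c : ℤ) (z w : n → ℤ)
    (h : ∃ γ : SpecialLinearGroup n ℤ, ∃ g : ℤ,
      Function.update z i (z i + c * z j) = g • ((γ : Matrix n n ℤ) *ᵥ w)) :
    ∃ γ : SpecialLinearGroup n ℤ, ∃ g : ℤ, z = g • ((γ : Matrix n n ℤ) *ᵥ w) := by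
  obtain ⟨γ, g, hg⟩ := h
  refine ⟨SpecialLinearGroup.transvection hij (-c) * γ, g, ?_⟩
  rw [Matrix.SpecialLinearGroup.coe_mul, ← Matrix.mulVec_mulVec, ← Matrix.mulVec_smul, ← hg,
    ← transvection_mulVec_eq_update, Matrix.mulVec_mulVec]
  have : ((SpecialLinearGroup.transvection hij (-c) : SpecialLinearGroup n ℤ) : Matrix n n ℤ) =
    Matrix.transvection i j (-c) := rfl
  rw [this, Matrix.transvection_mul_transvection_same _ _ hij]
  simp

/-- Every integer vector is an integer multiple of a vector in the `SL_n(ℤ)`-orbit of a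
coordinate vector. -/
theorem exists_eq_smul_SL_mulVec {n : Type*} [Fintype n] [DecidableEq n] (i₀ : n) (z : n → ℤ) :
    ∃ γ : SpecialLinearGroup n ℤ, ∃ g : ℤ,
      z = g • ((γ : Matrix n n ℤ) *ᵥ Pi.single i₀ 1) := by
  induction hN : ∑ i, (z i).natAbs using Nat.strong_induction_on generalizing z with
  | _ N ih =>
  by_cases hz : ∃ i j, i ≠ j ∧ z i ≠ 0 ∧ z j ≠ 0
  · obtain ⟨i, j, hij, hi, hj⟩ := hz
    wlog hle : (z j).natAbs ≤ (z i).natAbs generalizing i j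
    · exact this j i hij.symm hj hi (not_le.1 hle).le
    have hred : ∃ c : ℤ, (z i + c * z j).natAbs < (z i).natAbs := by
      rcases lt_or_gt_of_ne hi with h1 | h1 <;> rcases lt_or_gt_of_ne hj with h2 | h2
      · exact ⟨-1, by lia⟩
      · exact ⟨1, by lia⟩
      · exact ⟨1, by lia⟩
      · exact ⟨-1, by lia⟩
    obtain ⟨c, hc⟩ := hred
    refine exists_smul_SL_mulVec_of_update hij c z _ (ih _ ?_ _ rfl)
    rw [← hN, ← Finset.add_sum_erase _ _ (Finset.mem_univ i),
      ← Finset.add_sum_erase _ (fun k => (z k).natAbs) (Finset.mem_univ i)]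
    refine add_lt_add_of_lt_of_le (by simpa using hc) (Finset.sum_le_sum fun k hk => ?_)
    rw [Function.update_of_ne (Finset.ne_of_mem_erase hk)]
  · push Not at hz
    by_cases h0 : ∃ i, i ≠ i₀ ∧ z i ≠ 0
    · obtain ⟨i, hi, hzi⟩ := h0
      have hzero : ∀ j, j ≠ i → z j = 0 := fun j hj => hz i j hj.symm hzi
      refine exists_smul_SL_mulVec_of_update hi.symm 1 z _ ?_
      refine exists_smul_SL_mulVec_of_update hi (-1) _ _ ?_
      refine ⟨1, z i, ?_⟩
      ext k
      rcases eq_or_ne k i with rfl | hk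
      · simp [hi, hzero i₀ hi.symm]
      · rcases eq_or_ne k i₀ with rfl | hk0
        · simp [hi, hi.symm, hzero k hi.symm]
        · simp [hk, hk0, hzero k hk]
    · push Not at h0
      refine ⟨1, z i₀, ?_⟩
      ext k
      rcases eq_or_ne k i₀ with rfl | hk
      · simp
      · simp [hk, h0 k hk]

end VectorReduction

namespace PrimeTup

variable {S : PrimeTup} {d : ℕ}

theorem exists_smooth_mul_NS {n : ℕ} (hn : n ≠ 0) : ∃ a ∈ S.smooth, ∃ m ∈ S.NS, n = a * m := by
  induction n using Nat.strong_induction_on with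
  | _ n ih =>
  by_cases h : n ∈ S.NS
  · exact ⟨1, S.smooth.one_mem, n, h, (one_mul n).symm⟩
  · have : ∃ i, S.p i ∣ n := by
      by_contra! hc
      exact h ⟨Nat.pos_of_ne_zero hn, hc⟩
    obtain ⟨i, k, rfl⟩ := this
    have hk : k ≠ 0 := right_ne_zero_of_mul hn
    obtain ⟨a, ha, m, hm, rfl⟩ := ih k
      (lt_mul_of_one_lt_left (Nat.pos_of_ne_zero hk) (S.hp i).one_lt) hk
    exact ⟨S.p i * a, S.smooth.mul_mem (p_mem_smooth i) ha, m, hm, (mul_assoc _ _ _).symm⟩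

theorem exists_unit_mul_NS_of_int {z : ℤ} (hz : z ≠ 0) :
    ∃ u ∈ S.Zs, u ≠ 0 ∧ u⁻¹ ∈ S.Zs ∧ ∃ m ∈ S.NS, (z : ℚ) = u * m := by
  obtain ⟨a, ha, m, hm, h⟩ := exists_smooth_mul_NS (S := S) (Int.natAbs_ne_zero.2 hz)
  have ha0 : (a : ℚ) ≠ 0 := by exact_mod_cast (smooth_pos ha).ne'
  rcases Int.natAbs_eq z with h' | h'
  · refine ⟨a, natCast_mem _ _, ha0, smooth_inv_mem ha, m, hm, ?_⟩
    rw [h', h]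
    push_cast
    ring
  · refine ⟨-a, S.Zs.neg_mem (natCast_mem _ _), neg_ne_zero.2 ha0, ?_, m, hm, ?_⟩
    · rw [inv_neg]
      exact S.Zs.neg_mem (smooth_inv_mem ha)
    · rw [h', h]
      push_cast
      ring

theorem exists_smooth_smul_eq_int {ι : Type*} [Fintype ι] (v : ι → S.Zs) :
    ∃ n ∈ S.smooth, ∃ z : ι → ℤ, ∀ i, (n : ℚ) * v i = z i := by
  classical
  choose n hn z hz using fun i => exists_smooth_mul_eq_int (v i).2
  refine ⟨∏ i, n i, S.smooth.prod_mem fun i _ => hn i,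
    fun i => (∏ j ∈ Finset.univ.erase i, n j : ℕ) * z i, fun i => ?_⟩
  push_cast
  rw [← Finset.mul_prod_erase _ _ (Finset.mem_univ i), ← hz i]
  ring

theorem e1_eq_single (hd : 0 < d) : S.e1 d = Pi.single (⟨0, hd⟩ : Fin d) 1 := by
  ext j
  simp only [e1, Pi.single_apply, Fin.ext_iff]

theorem unit_smul_e1_mem_primZs (hd : 2 ≤ d) {u : ℚ} (hu : u ∈ S.Zs) (hu' : u⁻¹ ∈ S.Zs)
    (hu0 : u ≠ 0) : ∃ γ : SpecialLinearGroup (Fin d) S.Zs,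
      (γ : Matrix (Fin d) (Fin d) S.Zs) *ᵥ S.e1 d = (⟨u, hu⟩ : S.Zs) • S.e1 d := by
  let i0 : Fin d := ⟨0, by lia⟩
  let i1 : Fin d := ⟨1, by lia⟩
  have h01 : i0 ≠ i1 := by simp [i0, i1]
  let D : Fin d → S.Zs := Function.update (Function.update 1 i1 ⟨u⁻¹, hu'⟩) i0 ⟨u, hu⟩
  refine ⟨⟨Matrix.diagonal D, ?_⟩, ?_⟩
  · rw [Matrix.det_diagonal, ← Finset.mul_prod_erase _ _ (Finset.mem_univ i0),
      ← Finset.mul_prod_erase _ _ (Finset.mem_erase.2 ⟨h01.symm, Finset.mem_univ i1⟩),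
      Finset.prod_eq_one, mul_one]
    · simp only [D, Function.update_self, Function.update_of_ne h01.symm]
      exact Subtype.ext (mul_inv_cancel₀ hu0)
    · intro k hk
      simp only [Finset.mem_erase] at hk
      simp [D, hk.1, hk.2.1]
  · rw [e1_eq_single (by lia)]
    ext k
    change ((Matrix.diagonal D *ᵥ _) k : ℚ) = _
    rw [Matrix.mulVec_diagonal]
    rcases eq_or_ne k i0 with rfl | hk
    · simp [D, i0]
    · simp [hk, i0] at hk ⊢

/-- Every nonzero vector of `ℤ_S^d` is a positive integer prime to `S` times a primitive vector. -/
theorem exists_NS_smul_primZs (hd : 2 ≤ d) (v : Fin d → S.Zs) (hv : v ≠ 0) :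
    ∃ m ∈ S.NS, ∃ w ∈ S.primZs d, v = (m : S.Zs) • w := by
  obtain ⟨n, hn, z, hz⟩ := exists_smooth_smul_eq_int v
  obtain ⟨γ, g, hg⟩ := exists_eq_smul_SL_mulVec (⟨0, by lia⟩ : Fin d) z
  have hn0 : (n : ℚ) ≠ 0 := by exact_mod_cast (smooth_pos hn).ne'
  have hg0 : g ≠ 0 := by
    rintro rfl
    refine hv (funext fun i => Subtype.ext ?_)
    have := hz i
    rw [hg] at this
    simpa [hn0] using this
  obtain ⟨u, hu, hu0, hu', m, hm, hum⟩ := exists_unit_mul_NS_of_int (S := S) hg0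
  have hnu : u * (n : ℚ)⁻¹ ∈ S.Zs := S.Zs.mul_mem hu (smooth_inv_mem hn)
  have hnu' : (u * (n : ℚ)⁻¹)⁻¹ ∈ S.Zs := by
    rw [mul_inv, inv_inv]
    exact S.Zs.mul_mem hu' (natCast_mem _ _)
  obtain ⟨δ, hδ⟩ := unit_smul_e1_mem_primZs hd hnu hnu' (mul_ne_zero hu0 (inv_ne_zero hn0))
  let γ' : SpecialLinearGroup (Fin d) S.Zs := SpecialLinearGroup.map (Int.castRingHom S.Zs) γ
  have hγ' : (γ' : Matrix (Fin d) (Fin d) S.Zs) = (γ : Matrix (Fin d) (Fin d) ℤ).map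
    (Int.castRingHom S.Zs) := rfl
  refine ⟨m, hm, _, ⟨γ' * δ, rfl⟩, ?_⟩
  rw [Matrix.SpecialLinearGroup.coe_mul, ← Matrix.mulVec_mulVec, hδ, Matrix.mulVec_smul,
    e1_eq_single (by lia), hγ']
  ext i
  have h1 := hz i
  rw [hg] at h1
  have h2 : (v i : ℚ) = (n : ℚ)⁻¹ * (u * m) * ((γ : Matrix (Fin d) (Fin d) ℤ) i ⟨0, by lia⟩ : ℤ) := by
    rw [← hum, ← mul_right_inj' hn0, h1]
    simp
    field_simp
  rw [h2]
  simp
  ring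

theorem eq_of_NS_smul_primZs {m m' : ℕ} (hm : m ∈ S.NS) (hm' : m' ∈ S.NS) {w w' : Fin d → S.Zs}
    (hd : 0 < d)
    (hw : w ∈ S.primZs d) (hw' : w' ∈ S.primZs d) (h : (m : S.Zs) • w = (m' : S.Zs) • w') :
    m = m' := by
  have key : ∀ {m m' : ℕ} {w w' : Fin d → S.Zs}, m' ∈ S.NS → w ∈ S.primZs d →
      (m : S.Zs) • w = (m' : S.Zs) • w' → m' ∣ m := by
    intro m m' w w' hm' ⟨γ, hγ⟩ h
    have h1 := congrArg ((γ⁻¹ : SpecialLinearGroup (Fin d) S.Zs) : Matrix (Fin d) (Fin d) S.Zs).mulVec h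
    rw [Matrix.mulVec_smul, Matrix.mulVec_smul, hγ, Matrix.mulVec_mulVec,
      ← Matrix.SpecialLinearGroup.coe_mul, inv_mul_cancel, Matrix.SpecialLinearGroup.coe_one,
      Matrix.one_mulVec] at h1
    have h2 := congrFun h1 ⟨0, hd⟩
    set a := (((γ⁻¹ : SpecialLinearGroup (Fin d) S.Zs) : Matrix (Fin d) (Fin d) S.Zs) *ᵥ w') ⟨0, hd⟩
      with ha
    have h3 : (m : ℚ) = m' * (a : ℚ) := by
      have := congrArg (Subtype.val) h2
      simpa [e1, ha] using this
    obtain ⟨n, hn, z, hz⟩ := exists_smooth_mul_eq_int a.2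
    have h4 : (n * m : ℤ) = m' * z := by
      have : (n * m : ℚ) = m' * z := by rw [← hz, h3]; ring
      exact_mod_cast this
    have h5 : m' ∣ n * m := by
      have : (m' : ℤ) ∣ ((n * m : ℕ) : ℤ) := ⟨z, by push_cast; exact h4⟩
      exact_mod_cast this
    exact (coprime_smooth_NS hn hm').symm.dvd_of_dvd_mul_left h5
  exact Nat.dvd_antisymm (key hm hw' h.symm) (key hm' hw h)

end PrimeTup

section GeneralLinear

variable {n K M : Type*} [Fintype n] [DecidableEq n] [Field K] [CommMonoid M]

/-- The invertible diagonal matrix with entry `a` at `i` and `1` elsewhere. -/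
def diagUnit (i : n) : Kˣ →* GL n K :=
  (Units.mapEquiv (MulEquiv.refl _)).toMonoidHom.comp
    ((Units.map (Matrix.diagonalRingHom n K).toMonoidHom).comp
      (MulEquiv.piUnits.symm.toMonoidHom.comp (MonoidHom.mulSingle (fun _ => Kˣ) i)))

theorem coe_diagUnit (i : n) (a : Kˣ) :
    (diagUnit i a : Matrix n n K) = Matrix.diagonal (fun j => if j = i then (a : K) else 1) := by
  change Matrix.diagonal _ = _
  congr 1
  ext j
  change ((Pi.mulSingle i a : n → Kˣ) j : K) = _
  rcases eq_or_ne j i with rfl | h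
  · simp
  · simp [h]

theorem MonoidHom.map_eq_of_conj {G : Type*} [Group G] (f : G →* M) {a b c : G}
    (h : c * a = b * c) : f a = f b := by
  have h1 : f c * f a = f b * f c := by rw [← map_mul, h, map_mul]
  have h2 : f (c⁻¹) * f c = 1 := by rw [← map_mul, inv_mul_cancel, map_one]
  calc f a = f c⁻¹ * (f c * f a) := by rw [← mul_assoc, h2, one_mul]
    _ = f b := by rw [h1, mul_left_comm, h2, mul_one]

/-- The invertible matrix of a transvection. -/
def transvectionUnit {i j : n} (hij : i ≠ j) (c : K) : GL n K :=
  Matrix.GeneralLinearGroup.mkOfDetNeZero (Matrix.transvection i j c)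
    (by rw [Matrix.det_transvection_of_ne i j hij]; exact one_ne_zero)

theorem map_transvectionUnit [CharZero K] (f : GL n K →* M) {i j : n} (hij : i ≠ j) (c : K) :
    f (transvectionUnit hij c) = 1 := by
  have h2 : (2 : K) ≠ 0 := two_ne_zero
  have hsq : transvectionUnit hij (2 * c) = transvectionUnit hij c * transvectionUnit hij c := by
    ext1
    change Matrix.transvection i j (2 * c) = Matrix.transvection i j c * Matrix.transvection i j c
    rw [Matrix.transvection_mul_transvection_same _ _ hij, two_mul]
  have hconj : diagUnit i (Units.mk0 2 h2) * transvectionUnit hij c =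
      transvectionUnit hij (2 * c) * diagUnit i (Units.mk0 2 h2) := by
    ext1
    rw [Units.val_mul, Units.val_mul, coe_diagUnit]
    change _ * Matrix.transvection i j c = Matrix.transvection i j (2 * c) * _
    ext a b
    rw [Matrix.diagonal_mul, Matrix.mul_diagonal, Matrix.transvection, Matrix.transvection]
    rcases eq_or_ne a i with rfl | ha
    · rcases eq_or_ne b a with rfl | hb
      · simp [hij.symm]
      · rcases eq_or_ne j b with rfl | hb'
        · simp [hb, hb.symm]
        · simp [hb, hb.symm, hb']
    · rcases eq_or_ne b a with rfl | hb
      · simp [ha, ha.symm]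
      · simp [ha, ha.symm, hb.symm]
  have h := MonoidHom.map_eq_of_conj f hconj
  rw [hsq, map_mul] at h
  have h3 : f (transvectionUnit hij c)⁻¹ * f (transvectionUnit hij c) = 1 := by
    rw [← map_mul, inv_mul_cancel, map_one]
  calc f (transvectionUnit hij c)
      = f (transvectionUnit hij c)⁻¹ * (f (transvectionUnit hij c) * f (transvectionUnit hij c)) := by
        rw [← mul_assoc, h3, one_mul]
    _ = 1 := by rw [← h, h3]

theorem map_diagUnit_eq (f : GL n K →* M) (i j : n) (a : Kˣ) :
    f (diagUnit i a) = f (diagUnit j a) := by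
  let σ : Equiv.Perm n := Equiv.swap i j
  have hσ : (σ.permMatrix K).det ≠ 0 := by
    rw [Matrix.det_permutation]
    rcases Int.units_eq_one_or (Equiv.Perm.sign σ) with h | h <;> simp [h]
  refine MonoidHom.map_eq_of_conj f (c := Matrix.GeneralLinearGroup.mkOfDetNeZero _ hσ) ?_
  ext1
  rw [Units.val_mul, Units.val_mul, coe_diagUnit, coe_diagUnit]
  change σ.permMatrix K * _ = _ * σ.permMatrix K
  ext k l
  rw [Matrix.mul_diagonal, Matrix.diagonal_mul, mul_comm]
  simp only [Equiv.Perm.permMatrix, PEquiv.toMatrix_apply, Equiv.toPEquiv_apply, Option.mem_some_iff]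
  by_cases hkl : σ k = l
  · have : l = i ↔ k = j := by
      rw [← hkl]
      simp only [σ]
      rw [Equiv.swap_apply_eq_iff, Equiv.swap_apply_left]
    simp [hkl, this]
  · simp [hkl]

/-- A homomorphism from `GL_n` over a field of characteristic zero to a commutative monoid is
trivial on matrices of determinant one. -/
theorem map_eq_one_of_det_eq_one [CharZero K] [Nonempty n] (f : GL n K →* M) (g : GL n K)
    (hg : (g : Matrix n n K).det = 1) : f g = 1 := by
  let i0 : n := Classical.arbitrary n
  have key : ∀ A : Matrix n n K, ∀ hA : A.det ≠ 0, ∀ g : GL n K, (g : Matrix n n K) = A →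
      f g = f (diagUnit i0 (Units.mk0 _ hA)) := by
    intro A hA
    refine Matrix.diagonal_transvection_induction_of_det_ne_zero
      (fun A => ∀ hA : A.det ≠ 0, ∀ g : GL n K, (g : Matrix n n K) = A →
      f g = f (diagUnit i0 (Units.mk0 _ hA))) A hA ?_ ?_ ?_ hA
    · intro D hD _ g hg
      have hD' : ∀ i, D i ≠ 0 := by
        rw [Matrix.det_diagonal] at hD
        exact fun i => Finset.prod_ne_zero_iff.1 hD i (Finset.mem_univ i)
      have hprod : ∀ s : Finset n, ∃ g' : GL n K,
          (g' : Matrix n n K) = Matrix.diagonal (fun j => if j ∈ s then D j else 1) ∧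
          f g' = f (diagUnit i0 (∏ i ∈ s, Units.mk0 (D i) (hD' i))) := by
        intro s
        induction s using Finset.induction_on with
        | empty => exact ⟨1, by simp, by simp⟩
        | insert a s ha ih =>
          obtain ⟨g', h1, h2⟩ := ih
          refine ⟨diagUnit a (Units.mk0 (D a) (hD' a)) * g', ?_, ?_⟩
          · rw [Units.val_mul, coe_diagUnit, h1, Matrix.diagonal_mul_diagonal]
            congr 1
            ext j
            rcases eq_or_ne j a with rfl | hj
            · simp [ha]
            · simp [hj]
          · rw [Finset.prod_insert ha, map_mul, map_mul, map_mul, h2, map_diagUnit_eq f a i0]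
      obtain ⟨g', h1, h2⟩ := hprod Finset.univ
      have : g = g' := by
        ext1
        rw [hg, h1]
        simp
      rw [this, h2]
      congr 2
      ext1
      simp
    · intro t ht g hg
      have : g = transvectionUnit t.hij t.c := by
        ext1
        rw [hg]
        rfl
      rw [this, map_transvectionUnit]
      have h1 : Units.mk0 _ ht = 1 := by
        ext1
        simp
      rw [h1, map_one, map_one]
    · intro A B hA hB ihA ihB hAB g hg
      have : g = Matrix.GeneralLinearGroup.mkOfDetNeZero A hA *
          Matrix.GeneralLinearGroup.mkOfDetNeZero B hB := by
        ext1
        rw [hg]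
        rfl
      rw [this, map_mul, ihA hA (Matrix.GeneralLinearGroup.mkOfDetNeZero A hA) rfl,
        ihB hB (Matrix.GeneralLinearGroup.mkOfDetNeZero B hB) rfl, ← map_mul, ← map_mul]
      congr 2
      ext1
      simp
  rw [key _ (by rw [hg]; exact one_ne_zero) g rfl]
  have h1 : ∀ h, Units.mk0 (g : Matrix n n K).det h = 1 := fun h => Units.ext hg
  rw [h1, map_one, map_one]

end GeneralLinear

instance Padic.instSecondCountableTopology' {p : ℕ} [Fact p.Prime] :
    SecondCountableTopology ℚ_[p] :=
  have : TopologicalSpace.SeparableSpace ℚ_[p] :=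
    TopologicalSpace.SeparableSpace.of_denseRange _ (Padic.denseRange_ratCast p)
  UniformSpace.secondCountable_of_separable _

namespace PrimeTup

variable {S : PrimeTup} {d : ℕ}

/-- The group `GL_d(ℝ) × ∏ᵢ GL_d(ℚ_{pᵢ})`. -/
abbrev GLS (S : PrimeTup) (d : ℕ) : Type :=
  GL (Fin d) ℝ × ((i : Fin S.s) → GL (Fin d) (S.Qp i))

/-- The action of `GLS` on `ℚ_S^d` by automorphisms. -/
noncomputable def actGL (g : S.GLS d) : S.QS d ≃ₜ+ S.QS d where
  toFun x := ((g.1 : Matrix (Fin d) (Fin d) ℝ).mulVec x.1,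
    fun i => ((g.2 i : Matrix (Fin d) (Fin d) (S.Qp i))).mulVec (x.2 i))
  invFun x := ((↑g.1⁻¹ : Matrix (Fin d) (Fin d) ℝ).mulVec x.1,
    fun i => ((↑(g.2 i)⁻¹ : Matrix (Fin d) (Fin d) (S.Qp i))).mulVec (x.2 i))
  left_inv x := by
    ext
    · simp only [Matrix.mulVec_mulVec, Units.inv_mul, Matrix.one_mulVec]
    · simp only [Matrix.mulVec_mulVec, Units.inv_mul, Matrix.one_mulVec]
  right_inv x := by
    ext
    · simp only [Matrix.mulVec_mulVec, Units.mul_inv, Matrix.one_mulVec]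
    · simp only [Matrix.mulVec_mulVec, Units.mul_inv, Matrix.one_mulVec]
  map_add' x y := by
    ext
    · simp [Matrix.mulVec_add]
    · simp [Matrix.mulVec_add]
  continuous_toFun := by
    refine Continuous.prodMk (Continuous.matrix_mulVec continuous_const continuous_fst)
      (continuous_pi fun i => Continuous.matrix_mulVec continuous_const ?_)
    exact (continuous_apply i).comp continuous_snd
  continuous_invFun := by
    refine Continuous.prodMk (Continuous.matrix_mulVec continuous_const continuous_fst)
      (continuous_pi fun i => Continuous.matrix_mulVec continuous_const ?_)
    exact (continuous_apply i).comp continuous_snd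

theorem actGL_mul (g h : S.GLS d) : actGL (g * h) = (actGL h).trans (actGL g) := by
  ext x
  · simp [actGL, Matrix.mulVec_mulVec]
  · simp [actGL, Matrix.mulVec_mulVec]

/-- The factor by which an element of `GLS` scales Haar measure. -/
noncomputable def modulus (S : PrimeTup) (d : ℕ) : S.GLS d →* NNReal where
  toFun g := addEquivAddHaarChar (actGL g)
  map_one' := by
    rw [← addEquivAddHaarChar_refl (G := S.QS d)]
    congr 1
    ext x
    · simp [actGL]
    · simp [actGL]
  map_mul' g h := by rw [actGL_mul, addEquivAddHaarChar_trans, mul_comm]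

/-- The embedding of `G_d` into `GLS`. -/
noncomputable def toGLS (g : S.G d) : S.GLS d := (g.1.toGL, fun i => (g.2 i).toGL)

theorem modulus_toGLS (hd : 0 < d) (g : S.G d) : modulus S d (toGLS g) = 1 := by
  have : Nonempty (Fin d) := ⟨⟨0, hd⟩⟩
  have h1 : modulus S d (g.1.toGL, 1) = 1 :=
    map_eq_one_of_det_eq_one ((modulus S d).comp (MonoidHom.inl _ _)) g.1.toGL g.1.2
  have h2 : modulus S d (1, fun i => (g.2 i).toGL) = 1 := by
    have : ∀ i, modulus S d (1, Pi.mulSingle i (g.2 i).toGL) = 1 := fun i =>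
      map_eq_one_of_det_eq_one ((modulus S d).comp ((MonoidHom.inr _ _).comp
        (MonoidHom.mulSingle (fun i => GL (Fin d) (S.Qp i)) i))) (g.2 i).toGL (g.2 i).2
    rw [← Finset.noncommProd_mulSingle (fun i => (g.2 i).toGL)]
    refine Finset.noncommProd_induction _ _ _ (fun x => modulus S d (1, x) = 1) ?_ ?_ ?_
    · intro a b ha hb
      rw [← one_mul (1 : GL (Fin d) ℝ), ← Prod.mk_mul_mk, map_mul, ha, hb, one_mul]
    · exact map_one _
    · exact fun i _ => this i
  have : toGLS g = (g.1.toGL, 1) * (1, fun i => (g.2 i).toGL) := by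
    rw [Prod.mk_mul_mk, mul_one, one_mul]
    rfl
  rw [this, map_mul, h1, h2, one_mul]

theorem IsVolS.smul_map_actGL {v : Measure (S.QS d)} (hv : S.IsVolS d v) (g : S.GLS d) :
    modulus S d g • v.map (actGL g) = v := by
  have := hv.1
  have := hv.2.1
  exact addEquivAddHaarChar_smul_map v (actGL g)

theorem IsVolS.measurePreserving_of_modulus {v : Measure (S.QS d)} (hv : S.IsVolS d v)
    {g : S.GLS d} (hg : modulus S d g = 1) : MeasurePreserving (actGL g) v v := by
  refine ⟨(actGL g).continuous.measurable, ?_⟩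
  have := hv.smul_map_actGL g
  rwa [hg, one_smul] at this

theorem act_eq_actGL (g : S.G d) (x : S.QS d) : S.act g x = actGL (toGLS g) x := rfl

theorem IsVolS.measurePreserving_act (hd : 0 < d) {v : Measure (S.QS d)} (hv : S.IsVolS d v)
    (g : S.G d) : MeasurePreserving (S.act g) v v :=
  hv.measurePreserving_of_modulus (modulus_toGLS hd g)

/-- The scalar matrices of a nonzero rational. -/
noncomputable def scalarGLS (S : PrimeTup) (d : ℕ) (q : ℚˣ) : S.GLS d :=
  (Units.map (algebraMap ℚ (Matrix (Fin d) (Fin d) ℝ)).toMonoidHom q,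
    fun i => Units.map (algebraMap ℚ (Matrix (Fin d) (Fin d) (S.Qp i))).toMonoidHom q)

theorem ratSMul_eq_actGL (q : ℚˣ) (x : S.QS d) :
    S.ratSMul (q : ℚ) x = actGL (scalarGLS S d q) x := by
  have key : ∀ (K : Type) [Field K] [CharZero K] (y : Fin d → K),
      (fun j => ((q : ℚ) : K) * y j) = algebraMap ℚ (Matrix (Fin d) (Fin d) K) q *ᵥ y := by
    intro K _ _ y
    ext j
    rw [Matrix.algebraMap_eq_diagonal, Matrix.mulVec_diagonal]
    simp
  exact Prod.ext (key _ _) (funext fun i => key _ _)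

/-- The `p`-adic part of `ℚ_S^d`. -/
abbrev QSf (S : PrimeTup) (d : ℕ) : Type := (i : Fin S.s) → Fin d → S.Qp i

theorem norm_QSf_le_one_iff {w : S.QSf d} : ‖w‖ ≤ 1 ↔ ∀ i j, ‖w i j‖ ≤ 1 := by
  simp only [pi_norm_le_iff_of_nonneg zero_le_one]

/-- The product of the unit balls in the `p`-adic part. -/
def padicBox (S : PrimeTup) (d : ℕ) : TopologicalSpace.PositiveCompacts (S.QSf d) where
  carrier := Metric.closedBall 0 1
  isCompact' := isCompact_closedBall 0 1
  interior_nonempty' := ⟨0, interior_mono Metric.ball_subset_closedBall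
    (by rw [Metric.isOpen_ball.interior_eq]; exact Metric.mem_ball_self one_pos)⟩

/-- The normalized Haar measure on the `p`-adic part. -/
noncomputable def padicVol (S : PrimeTup) (d : ℕ) : Measure (S.QSf d) :=
  Measure.addHaarMeasure (padicBox S d)

instance : (padicVol S d).IsAddHaarMeasure := by unfold padicVol; infer_instance

theorem padicVol_box : padicVol S d (Metric.closedBall 0 1) = 1 :=
  Measure.addHaarMeasure_self

theorem unitBox_eq : S.unitBox d = Set.Icc 0 1 ×ˢ Metric.closedBall 0 1 := by
  ext x
  rw [Set.mem_prod, mem_closedBall_zero_iff, norm_QSf_le_one_iff]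
  simp only [unitBox, Set.mem_ofPred_eq, Set.mem_Icc, Pi.le_def, Pi.zero_apply, Pi.one_apply,
    forall_and]

theorem IsVolS.eq_prod {v : Measure (S.QS d)} (hv : S.IsVolS d v) :
    v = (volume : Measure (Fin d → ℝ)).prod (padicVol S d) := by
  have := hv.1
  have : ((volume : Measure (Fin d → ℝ)).prod (padicVol S d)).IsAddHaarMeasure :=
    Measure.prod.instIsAddHaarMeasure _ _
  have h := Measure.isAddLeftInvariant_eq_smul v
    ((volume : Measure (Fin d → ℝ)).prod (padicVol S d))
  have h1 := congrArg (fun m => m (S.unitBox d)) h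
  simp only [hv.2.2, Measure.smul_apply] at h1
  rw [unitBox_eq, Measure.prod_prod, padicVol_box, Real.volume_Icc_pi] at h1
  simp only [Pi.one_apply, Pi.zero_apply, sub_zero, ENNReal.ofReal_one, Finset.prod_const_one,
    mul_one, ENNReal.smul_def, smul_eq_mul] at h1
  rw [h]
  have h2 : Measure.addHaarScalarFactor v
    ((volume : Measure (Fin d → ℝ)).prod (padicVol S d)) = 1 := by exact_mod_cast h1.symm
  rw [h2, one_smul]

/-- A fundamental domain for `ℤ_S^d` in `ℚ_S^d`. -/
def fundBox (S : PrimeTup) (d : ℕ) : Set (S.QS d) :=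
  (Set.univ.pi fun _ => Set.Ico (0 : ℝ) 1) ×ˢ Metric.closedBall 0 1

theorem measurableSet_fundBox : MeasurableSet (fundBox S d) :=
  (MeasurableSet.univ_pi fun _ => measurableSet_Ico).prod measurableSet_closedBall

theorem IsVolS.measure_fundBox {v : Measure (S.QS d)} (hv : S.IsVolS d v) : v (fundBox S d) = 1 := by
  rw [hv.eq_prod, fundBox, Measure.prod_prod, padicVol_box, Real.volume_pi_Ico]
  simp

/-- The diagonal embedding of `ℤ_S^d` as a homomorphism. -/
noncomputable def zdiag (S : PrimeTup) (d : ℕ) : (Fin d → S.Zs) →+ S.QS d where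
  toFun w := S.diag fun j => ((w j : ℚ))
  map_zero' := by ext <;> simp [diag]
  map_add' x y := by ext <;> simp [diag]

theorem zdiag_fst (w : Fin d → S.Zs) (j : Fin d) : (zdiag S d w).1 j = ((w j : ℚ) : ℝ) := rfl

theorem zdiag_snd (w : Fin d → S.Zs) (i : Fin S.s) (j : Fin d) :
    (zdiag S d w).2 i j = ((w j : ℚ) : S.Qp i) := rfl

theorem mem_fundBox {x : S.QS d} :
    x ∈ fundBox S d ↔ (∀ j, x.1 j ∈ Set.Ico (0 : ℝ) 1) ∧ ∀ i j, ‖x.2 i j‖ ≤ 1 := by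
  rw [fundBox, Set.mem_prod, mem_closedBall_zero_iff, norm_QSf_le_one_iff]
  simp

theorem existsUnique_sub_zdiag_mem_fundBox (x : S.QS d) :
    ∃! w : Fin d → S.Zs, x - zdiag S d w ∈ fundBox S d := by
  have hex : ∀ j, ∃ q : S.Zs, (x.1 j - ((q : ℚ) : ℝ) ∈ Set.Ico (0 : ℝ) 1) ∧
      ∀ i, ‖x.2 i j - ((q : ℚ) : S.Qp i)‖ ≤ 1 := by
    intro j
    obtain ⟨q, hq, h⟩ := exists_Zs_approx (S := S) fun i => x.2 i j
    let z : ℤ := ⌊x.1 j - (q : ℝ)⌋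
    refine ⟨⟨q + z, S.Zs.add_mem hq (intCast_mem _ _)⟩, ?_, fun i => ?_⟩
    · have h1 := Int.floor_le (x.1 j - (q : ℝ))
      have h2 := Int.lt_floor_add_one (x.1 j - (q : ℝ))
      push_cast
      constructor <;> simp only [z] <;> linarith
    · push_cast
      rw [← sub_sub, sub_eq_add_neg]
      refine (IsUltrametricDist.norm_add_le_max _ _).trans (max_le (h i) ?_)
      rw [norm_neg]
      exact Padic.norm_int_le_one z
  choose w hw1 hw2 using hex
  refine ⟨w, mem_fundBox.2 ⟨hw1, fun i j => hw2 j i⟩, fun w' hw' => ?_⟩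
  replace hw' := mem_fundBox.1 hw'
  ext j
  have hp : ∀ i, ‖(((w' j - w j : S.Zs) : ℚ) : S.Qp i)‖ ≤ 1 := by
    intro i
    have : (((w' j - w j : S.Zs) : ℚ) : S.Qp i) =
        (x.2 i j - ((w j : ℚ) : S.Qp i)) + -(x.2 i j - ((w' j : ℚ) : S.Qp i)) := by
      push_cast
      ring
    rw [this]
    refine (IsUltrametricDist.norm_add_le_max _ _).trans (max_le (hw2 j i) ?_)
    rw [norm_neg]
    exact hw'.2 i j
  obtain ⟨z, hz⟩ := exists_int_of_norm_le_one (w' j - w j).2 hp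
  have h1 := hw1 j
  have h2 := hw'.1 j
  simp only [Prod.fst_sub, Pi.sub_apply, zdiag_fst] at h2
  have h3 : ((w' j : ℚ) : ℝ) - ((w j : ℚ) : ℝ) = z := by
    have := congrArg (fun q : ℚ => (q : ℝ)) hz
    push_cast at this
    exact this
  have h4 : (z : ℝ) < 1 := by rw [← h3]; linarith [h1.2, h2.1]
  have h5 : (-1 : ℝ) < z := by rw [← h3]; linarith [h1.1, h2.2]
  have h6 : z = 0 := by
    have : z < 1 := by exact_mod_cast h4
    have : -1 < z := by exact_mod_cast h5
    lia
  rw [h6] at hz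
  push_cast at hz
  linarith

theorem isAddFundamentalDomain_of_existsUnique (v : Measure (S.QS d)) {D : Set (S.QS d)}
    (hD : MeasurableSet D)
    (h : ∀ x, ∃! w : Fin d → S.Zs, x - zdiag S d w ∈ D) :
    IsAddFundamentalDomain (zdiag S d).range D v := by
  refine IsAddFundamentalDomain.mk' hD.nullMeasurableSet fun x => ?_
  obtain ⟨w, hw, huniq⟩ := h x
  refine ⟨⟨zdiag S d (-w), -w, rfl⟩, ?_, ?_⟩
  · change zdiag S d (-w) + x ∈ D
    rw [map_neg, neg_add_eq_sub]
    exact hw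
  · rintro ⟨_, w', rfl⟩ hw'
    have h2 : zdiag S d w' + x ∈ D := hw'
    have : -w' = w := huniq (-w') (by change x - zdiag S d (-w') ∈ D; rwa [map_neg, sub_neg_eq_add, add_comm])
    rw [← this, neg_neg]

theorem IsVolS.measure_eq_one_of_existsUnique {v : Measure (S.QS d)} (hv : S.IsVolS d v)
    {D : Set (S.QS d)} (hD : MeasurableSet D)
    (h : ∀ x, ∃! w : Fin d → S.Zs, x - zdiag S d w ∈ D) : v D = 1 := by
  have := hv.1
  have : Countable (zdiag S d).range := (Set.countable_range (zdiag S d)).to_subtype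
  rw [(isAddFundamentalDomain_of_existsUnique v hD h).measure_eq
    (isAddFundamentalDomain_of_existsUnique v measurableSet_fundBox
      existsUnique_sub_zdiag_mem_fundBox), hv.measure_fundBox]

theorem ratSMul_zdiag {q : ℚ} (hq : q ∈ S.Zs) (w : Fin d → S.Zs) :
    S.ratSMul q (zdiag S d w) = zdiag S d ((⟨q, hq⟩ : S.Zs) • w) := by
  refine Prod.ext (funext fun j => ?_) (funext fun i => funext fun j => ?_)
  · simp [ratSMul, zdiag_fst]
  · simp [ratSMul, zdiag_snd]

theorem ratSMul_sub (q : ℚ) (x y : S.QS d) :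
    S.ratSMul q (x - y) = S.ratSMul q x - S.ratSMul q y := by
  refine Prod.ext (funext fun j => ?_) (funext fun i => funext fun j => ?_)
  · simp [ratSMul, mul_sub]
  · simp [ratSMul, mul_sub]

theorem measurable_ratSMul (q : ℚ) : Measurable (S.ratSMul q : S.QS d → S.QS d) := by
  unfold ratSMul
  fun_prop

theorem modulus_scalarGLS_of_unit {v : Measure (S.QS d)} (hv : S.IsVolS d v) {q : ℚˣ}
    (hq : (q : ℚ) ∈ S.Zs) (hq' : ((q⁻¹ : ℚˣ) : ℚ) ∈ S.Zs) :
    modulus S d (scalarGLS S d q) = 1 := by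
  have h := hv.smul_map_actGL (scalarGLS S d q)
  have hcoe : ⇑(actGL (scalarGLS S d q)) = S.ratSMul (q : ℚ) :=
    funext fun x => (ratSMul_eq_actGL q x).symm
  rw [hcoe] at h
  have h1 := congrArg (fun m => m (fundBox S d)) h
  simp only [Measure.smul_apply] at h1
  rw [Measure.map_apply (measurable_ratSMul _) measurableSet_fundBox, hv.measure_fundBox,
    hv.measure_eq_one_of_existsUnique (measurable_ratSMul _ measurableSet_fundBox)] at h1
  · rw [ENNReal.smul_def, smul_eq_mul, mul_one] at h1
    exact_mod_cast h1
  · intro x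
    obtain ⟨w, hw, huniq⟩ := existsUnique_sub_zdiag_mem_fundBox (S.ratSMul (q : ℚ) x)
    refine ⟨(⟨_, hq'⟩ : S.Zs) • w, ?_, fun w' hw' => ?_⟩
    · change S.ratSMul (q : ℚ) (x - zdiag S d _) ∈ fundBox S d
      rw [ratSMul_sub, ratSMul_zdiag hq, smul_smul]
      have : (⟨_, hq⟩ : S.Zs) * ⟨_, hq'⟩ = 1 := Subtype.ext (by simp)
      rw [this, one_smul]
      exact hw
    · have h3 : (⟨_, hq⟩ : S.Zs) • w' = w := by
        refine huniq _ ?_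
        change S.ratSMul (q : ℚ) (x - zdiag S d w') ∈ fundBox S d at hw'
        rwa [ratSMul_sub, ratSMul_zdiag hq] at hw'
      rw [← h3, smul_smul]
      have : (⟨_, hq'⟩ : S.Zs) * ⟨_, hq⟩ = 1 := Subtype.ext (by simp)
      rw [this, one_smul]

theorem IsVolS.measurePreserving_ratSMul {v : Measure (S.QS d)} (hv : S.IsVolS d v) {q : ℚ}
    (hq0 : q ≠ 0) (hq : q ∈ S.Zs) (hq' : q⁻¹ ∈ S.Zs) :
    MeasurePreserving (S.ratSMul q) v v := by
  have h := hv.measurePreserving_of_modulus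
    (modulus_scalarGLS_of_unit hv (q := Units.mk0 q hq0) hq (by simpa using hq'))
  rwa [show ⇑(actGL (scalarGLS S d (Units.mk0 q hq0))) = S.ratSMul q from
    funext fun x => (ratSMul_eq_actGL _ x).symm] at h

theorem IsVolS.preimage_ratSMul_NS {v : Measure (S.QS d)} (hv : S.IsVolS d v) {m : ℕ}
    (hm : m ∈ S.NS) {A : Set (S.QS d)} (hA : MeasurableSet A) :
    (m : ENNReal) ^ d * v (S.ratSMul (m : ℚ) ⁻¹' A) = v A := by
  have hm0 : (m : ℚ) ≠ 0 := by exact_mod_cast hm.1.ne'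
  have hm0' : (0 : ℝ) < m := by exact_mod_cast hm.1
  have h := hv.smul_map_actGL (scalarGLS S d (Units.mk0 (m : ℚ) hm0))
  rw [show ⇑(actGL (scalarGLS S d (Units.mk0 (m : ℚ) hm0))) = S.ratSMul (m : ℚ) from
    funext fun x => (ratSMul_eq_actGL _ x).symm] at h
  have key : ∀ B, MeasurableSet B → (modulus S d (scalarGLS S d (Units.mk0 (m : ℚ) hm0)) : ENNReal) *
      v (S.ratSMul (m : ℚ) ⁻¹' B) = v B := by
    intro B hB
    have h1 := congrArg (fun ν => ν B) h
    simp only [Measure.smul_apply] at h1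
    rwa [Measure.map_apply (measurable_ratSMul _) hB] at h1
  have hB : MeasurableSet ((Set.univ.pi fun _ => Set.Ico (0 : ℝ) m) ×ˢ Metric.closedBall 0 1 :
      Set (S.QS d)) :=
    (MeasurableSet.univ_pi fun _ => measurableSet_Ico).prod measurableSet_closedBall
  have h2 := key _ hB
  have h3 : S.ratSMul (m : ℚ) ⁻¹' ((Set.univ.pi fun _ => Set.Ico (0 : ℝ) m) ×ˢ
      Metric.closedBall 0 1 : Set (S.QS d)) = fundBox S d := by
    ext x
    rw [Set.mem_preimage, mem_fundBox, Set.mem_prod, mem_closedBall_zero_iff, norm_QSf_le_one_iff]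
    simp only [ratSMul, Set.mem_pi, Set.mem_univ, true_imp_iff, Set.mem_Ico, norm_mul,
      Rat.cast_natCast, norm_natCast_NS hm, one_mul]
    refine and_congr_left fun _ => forall_congr' fun j => ?_
    rw [mul_nonneg_iff_of_pos_left hm0', mul_lt_iff_lt_one_right hm0']
  rw [h3, hv.measure_fundBox, mul_one, hv.eq_prod, Measure.prod_prod, padicVol_box, mul_one,
    Real.volume_pi_Ico] at h2
  have h4 : (modulus S d (scalarGLS S d (Units.mk0 (m : ℚ) hm0)) : ENNReal) = (m : ENNReal) ^ d := by
    rw [h2]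
    simp
  rw [← h4]
  exact key A hA

section Measurability

variable {n : Type*} [DecidableEq n] [Fintype n] {R : Type*} [CommRing R] [TopologicalSpace R]

theorem measurable_SL_coe [MeasurableSpace R] [BorelSpace R] (i j : n) :
    Measurable fun g : SpecialLinearGroup n R => (g : Matrix n n R) i j := by
  have : BorelSpace (SpecialLinearGroup n R) := ⟨rfl⟩
  have h : Continuous fun g : SpecialLinearGroup n R => (g : Matrix n n R) :=
    continuous_subtype_val
  exact ((continuous_apply j).comp ((continuous_apply i).comp h)).measurable

theorem measurable_SL_mul_left [IsTopologicalRing R] (h : SpecialLinearGroup n R) :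
    Measurable fun g : SpecialLinearGroup n R => h * g := by
  have : BorelSpace (SpecialLinearGroup n R) := ⟨rfl⟩
  have h1 : Continuous fun g : SpecialLinearGroup n R => (g : Matrix n n R) :=
    continuous_subtype_val
  have h2 : Continuous fun g : SpecialLinearGroup n R => h * g :=
    Continuous.subtype_mk (continuous_const.matrix_mul h1) _
  exact h2.measurable

end Measurability

theorem measurable_act_left (x : S.QS d) : Measurable fun g : S.G d => S.act g x := by
  unfold act
  refine Measurable.prodMk (measurable_pi_lambda _ fun j => ?_)
    (measurable_pi_lambda _ fun i => measurable_pi_lambda _ fun j => ?_)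
  · simp only [Matrix.mulVec, dotProduct]
    exact Finset.measurable_sum _ fun k _ =>
      ((measurable_SL_coe j k).comp measurable_fst).mul_const _
  · simp only [Matrix.mulVec, dotProduct]
    exact Finset.measurable_sum _ fun k _ =>
      ((measurable_SL_coe j k).comp ((measurable_pi_apply i).comp measurable_snd)).mul_const _

theorem act_mul (g h : S.G d) (x : S.QS d) : S.act (g * h) x = S.act g (S.act h x) := by
  have h1 : toGLS (g * h) = toGLS g * toGLS h := by
    refine Prod.ext ?_ (funext fun i => ?_)
    · exact map_mul Matrix.SpecialLinearGroup.toGL g.1 h.1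
    · exact map_mul Matrix.SpecialLinearGroup.toGL (g.2 i) (h.2 i)
  rw [act_eq_actGL, h1, actGL_mul]
  rfl

theorem act_toG_zdiag (γ : SpecialLinearGroup (Fin d) S.Zs) (w : Fin d → S.Zs) :
    S.act (S.toG d γ) (zdiag S d w) =
      zdiag S d ((γ : Matrix (Fin d) (Fin d) S.Zs) *ᵥ w) := by
  refine Prod.ext (funext fun j => ?_) (funext fun i => funext fun j => ?_)
  · rw [zdiag_fst]
    simp only [act, toG, Matrix.mulVec, dotProduct]
    push_cast
    rfl
  · rw [zdiag_snd]
    simp only [act, toG, Matrix.mulVec, dotProduct]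
    push_cast
    rfl

/-- A set of vectors of `ℤ_S^d` stable under `SL_d(ℤ_S)`. -/
def IsSLStable (I : Set (Fin d → S.Zs)) : Prop :=
  ∀ (γ : SpecialLinearGroup (Fin d) S.Zs), ∀ w ∈ I,
    (γ : Matrix (Fin d) (Fin d) S.Zs) *ᵥ w ∈ I

/-- The counting measure of `g I` in `ℚ_S^d`. -/
noncomputable def orbitCount (I : Set (Fin d → S.Zs)) (g : S.G d) : Measure (S.QS d) :=
  Measure.sum fun w : I => Measure.dirac (S.act g (zdiag S d w))

theorem lintegral_orbitCount (I : Set (Fin d → S.Zs)) (g : S.G d) {φ : S.QS d → ENNReal}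
    (hφ : Measurable φ) :
    ∫⁻ x, φ x ∂(orbitCount I g) = ∑' w : I, φ (S.act g (zdiag S d w)) := by
  rw [orbitCount, lintegral_sum_measure]
  simp only [lintegral_dirac' _ hφ]

theorem orbitCount_mul_toG {I : Set (Fin d → S.Zs)} (hI : IsSLStable I) (g : S.G d)
    (γ : SpecialLinearGroup (Fin d) S.Zs) : orbitCount I (g * S.toG d γ) = orbitCount I g := by
  have hinv : ∀ (γ : SpecialLinearGroup (Fin d) S.Zs) (w : Fin d → S.Zs),
      ((γ⁻¹ : SpecialLinearGroup (Fin d) S.Zs) : Matrix (Fin d) (Fin d) S.Zs) *ᵥ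
        ((γ : Matrix (Fin d) (Fin d) S.Zs) *ᵥ w) = w := by
    intro γ w
    rw [Matrix.mulVec_mulVec, ← Matrix.SpecialLinearGroup.coe_mul, inv_mul_cancel,
      Matrix.SpecialLinearGroup.coe_one, Matrix.one_mulVec]
  let e : I ≃ I :=
    { toFun := fun w => ⟨_, hI γ w w.2⟩
      invFun := fun w => ⟨_, hI γ⁻¹ w w.2⟩
      left_inv := fun w => Subtype.ext (hinv γ w)
      right_inv := fun w => Subtype.ext (by simpa using hinv γ⁻¹ w) }
  ext A hA
  rw [orbitCount, orbitCount, Measure.sum_apply _ hA, Measure.sum_apply _ hA]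
  refine (tsum_congr fun w => ?_).trans
    (e.tsum_eq fun w => Measure.dirac (S.act g (zdiag S d w)) A)
  rw [act_mul, act_toG_zdiag]
  rfl

/-- The counting measure of the lattice points of `gΓ` in `I`. -/
noncomputable def latticeCount (I : Set (Fin d → S.Zs)) (hI : IsSLStable I) :
    S.G d ⧸ S.Gamma d → Measure (S.QS d) :=
  Quotient.lift (orbitCount I) (by
    intro a b hab
    obtain ⟨γ, hγ⟩ := QuotientGroup.leftRel_apply.1 hab
    rw [← mul_inv_cancel_left a b, ← hγ, orbitCount_mul_toG hI])

theorem latticeCount_mk {I : Set (Fin d → S.Zs)} (hI : IsSLStable I) (g : S.G d) :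
    latticeCount I hI (QuotientGroup.mk g) = orbitCount I g := rfl

theorem measurable_latticeCount {I : Set (Fin d → S.Zs)} (hI : IsSLStable I) :
    Measurable (latticeCount I hI) := by
  refine Measure.measurable_of_measurable_coe _ fun A hA => ?_
  refine measurable_from_quotient.2 ?_
  change Measurable fun g => orbitCount I g A
  simp only [orbitCount, Measure.sum_apply _ hA, Measure.dirac_apply' _ hA]
  refine Measurable.tsum fun w => ?_
  exact (measurable_one.indicator hA).comp (measurable_act_left _)

theorem measurable_smul_quotient (h : S.G d) :
    Measurable fun y : S.G d ⧸ S.Gamma d => h • y := by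
  refine measurable_from_quotient.2 ?_
  change Measurable fun g : S.G d => (QuotientGroup.mk (h * g) : S.G d ⧸ S.Gamma d)
  have h1 : Measurable fun g : S.G d => h * g := by
    refine Measurable.prodMk ((measurable_SL_mul_left h.1).comp measurable_fst) ?_
    exact measurable_pi_lambda _ fun i =>
      (measurable_SL_mul_left (h.2 i)).comp ((measurable_pi_apply i).comp measurable_snd)
  exact (measurable_quotient_mk'').comp h1

theorem Admissible.measurePreserving_smul {μ : Measure (S.G d ⧸ S.Gamma d)}
    (hμ : S.Admissible d μ) (h : S.G d) :
    MeasurePreserving (fun y : S.G d ⧸ S.Gamma d => h • y) μ μ := by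
  refine ⟨measurable_smul_quotient h, ?_⟩
  ext A hA
  rw [Measure.map_apply (measurable_smul_quotient h) hA]
  exact hμ.2.2.measure_preimage_smul h hA

theorem norm_prod_p_le_half (i : Fin S.s) : ‖((∏ j, S.p j : ℕ) : S.Qp i)‖ ≤ 1 / 2 := by
  rw [← Finset.mul_prod_erase _ _ (Finset.mem_univ i), Nat.cast_mul, norm_mul, Padic.norm_p]
  have h1 : ‖((∏ j ∈ Finset.univ.erase i, S.p j : ℕ) : S.Qp i)‖ ≤ 1 := by
    exact_mod_cast Padic.norm_int_le_one (p := S.p i) ((∏ j ∈ Finset.univ.erase i, S.p j : ℕ) : ℤ)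
  have h2 : ((S.p i : ℝ))⁻¹ ≤ 1 / 2 := by
    rw [one_div]
    exact inv_anti₀ (by norm_num) (by exact_mod_cast (S.hp i).two_le)
  calc _ ≤ ((S.p i : ℝ))⁻¹ * 1 := by gcongr
    _ ≤ _ := by linarith

theorem prod_p_mem_smooth : ∏ j, S.p j ∈ S.smooth :=
  Submonoid.prod_mem _ fun j _ => p_mem_smooth j

theorem act_sub (g : S.G d) (x y : S.QS d) : S.act g (x - y) = S.act g x - S.act g y := by
  rw [act_eq_actGL, map_sub]
  rfl

theorem act_zero (g : S.G d) : S.act g 0 = 0 := by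
  rw [act_eq_actGL, map_zero]

theorem act_one (x : S.QS d) : S.act 1 x = x := by
  refine Prod.ext ?_ (funext fun i => ?_) <;> simp [act]

theorem continuous_act (g : S.G d) : Continuous (S.act g) := (actGL (toGLS g)).continuous

theorem act_ratSMul_snd (g : S.G d) (q : ℚ) (x : S.QS d) (i : Fin S.s) (j : Fin d) :
    (S.act g (S.ratSMul q x)).2 i j = (q : S.Qp i) * (S.act g x).2 i j := by
  simp only [act, ratSMul, mulVec, dotProduct, Finset.mul_sum]
  exact Finset.sum_congr rfl fun k _ => by ring

theorem act_ratSMul_fst (g : S.G d) (q : ℚ) (x : S.QS d) :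
    (S.act g (S.ratSMul q x)).1 = (q : ℝ) • (S.act g x).1 := by
  ext j
  simp only [act, ratSMul, mulVec, dotProduct, Pi.smul_apply, smul_eq_mul, Finset.mul_sum]
  exact Finset.sum_congr rfl fun k _ => by ring

theorem ratSMul_ratSMul {a b : ℚ} (h : a * b = 1) (x : S.QS d) :
    S.ratSMul a (S.ratSMul b x) = x := by
  refine Prod.ext (funext fun j => ?_) (funext fun i => funext fun j => ?_)
  · simp only [ratSMul]
    rw [← mul_assoc, ← Rat.cast_mul, h, Rat.cast_one, one_mul]
  · simp only [ratSMul]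
    rw [← mul_assoc, ← Rat.cast_mul, h, Rat.cast_one, one_mul]

/-- Every lattice `g ℤ_S^d` has a fundamental domain which is bounded in the real direction and
arbitrarily small in the `p`-adic directions. -/
theorem exists_thin_fundamentalDomain (hd : 0 < d) {v : Measure (S.QS d)} (hv : S.IsVolS d v)
    (g : S.G d) {ε : ℝ} (hε : 0 < ε) :
    ∃ (D : Set (S.QS d)) (ρ : ℝ), MeasurableSet D ∧ v D = 1 ∧
      (∀ x, ∃! w : Fin d → S.Zs, x - S.act g (zdiag S d w) ∈ D) ∧
      ∀ u ∈ D, ‖u.1‖ ≤ ρ ∧ ‖u.2‖ ≤ ε := by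
  obtain ⟨K, hK⟩ : ∃ K, ∀ x ∈ fundBox S d, ‖S.act g x‖ ≤ K := by
    have hc : IsCompact (S.act g '' ((Set.univ.pi fun _ => Set.Icc (0 : ℝ) 1) ×ˢ
        Metric.closedBall (0 : S.QSf d) 1)) :=
      ((isCompact_univ_pi fun _ => isCompact_Icc).prod (isCompact_closedBall 0 1)).image
        (continuous_act g)
    obtain ⟨K, hK⟩ := hc.isBounded.exists_norm_le
    refine ⟨K, fun x hx => hK _ ⟨x, ⟨?_, hx.2⟩, rfl⟩⟩
    exact fun j hj => Set.Ico_subset_Icc_self (hx.1 j hj)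
  obtain ⟨k, hk⟩ : ∃ k : ℕ, (1 / 2 : ℝ) ^ k * (|K| + 1) < ε := by
    obtain ⟨k, hk⟩ := exists_pow_lt_of_lt_one (div_pos hε (by positivity : 0 < |K| + 1))
      (by norm_num : (1 / 2 : ℝ) < 1)
    exact ⟨k, (lt_div_iff₀ (by positivity)).1 hk⟩
  set n : ℕ := (∏ j, S.p j) ^ k with hn
  have hns : n ∈ S.smooth := pow_mem prod_p_mem_smooth k
  have hn0 : (n : ℚ) ≠ 0 := by exact_mod_cast (smooth_pos hns).ne'
  have hnZ : (n : ℚ) ∈ S.Zs := natCast_mem _ n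
  have hnZ' : ((n : ℚ))⁻¹ ∈ S.Zs := smooth_inv_mem hns
  let L : S.QS d → S.QS d := fun x => S.ratSMul ((n : ℚ))⁻¹ (S.act g⁻¹ x)
  have hL : MeasurePreserving L v v :=
    (hv.measurePreserving_ratSMul (inv_ne_zero hn0) hnZ' (by rwa [inv_inv])).comp
      (hv.measurePreserving_act hd g⁻¹)
  have hLL : ∀ x, S.act g (S.ratSMul n (L x)) = x := fun x => by
    rw [ratSMul_ratSMul (mul_inv_cancel₀ hn0), ← act_mul, mul_inv_cancel, act_one]
  refine ⟨L ⁻¹' fundBox S d, n * |K|, hL.measurable measurableSet_fundBox, ?_, fun x => ?_,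
    fun u hu => ?_⟩
  · rw [hL.measure_preimage measurableSet_fundBox.nullMeasurableSet, hv.measure_fundBox]
  · have key : ∀ w, L (x - S.act g (zdiag S d w)) =
        L x - zdiag S d ((⟨_, hnZ'⟩ : S.Zs) • w) := fun w => by
      simp only [L]
      rw [act_sub, ← act_mul, inv_mul_cancel, act_one, ratSMul_sub, ratSMul_zdiag hnZ']
    simp only [Set.mem_preimage, key]
    obtain ⟨w, hw, hu⟩ := existsUnique_sub_zdiag_mem_fundBox (L x)
    have h1 : (⟨_, hnZ'⟩ : S.Zs) * ⟨_, hnZ⟩ = 1 := Subtype.ext (inv_mul_cancel₀ hn0)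
    refine ⟨(⟨_, hnZ⟩ : S.Zs) • w, ?_, fun w' hw' => ?_⟩
    · simp only [smul_smul, h1, one_smul]
      exact hw
    · rw [← hu _ hw', smul_smul, mul_comm, h1, one_smul]
  · have hb := hK _ hu
    have hb' := (norm_fst_le (S.act g (L u))).trans (hb.trans (le_abs_self K))
    have hb'' := (norm_snd_le (S.act g (L u))).trans (hb.trans (le_abs_self K))
    rw [← hLL u]
    constructor
    · rw [act_ratSMul_fst, norm_smul]
      have : ‖((n : ℚ) : ℝ)‖ = n := by simp
      rw [this]
      gcongr
    · refine (pi_norm_le_iff_of_nonneg hε.le).2 fun i => (pi_norm_le_iff_of_nonneg hε.le).2 fun j => ?_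
      rw [act_ratSMul_snd, norm_mul]
      have h1 : ‖(S.act g (L u)).2 i j‖ ≤ |K| :=
        ((norm_le_pi_norm _ j).trans (norm_le_pi_norm _ i)).trans hb''
      have h2 : ‖((n : ℚ) : S.Qp i)‖ ≤ (1 / 2) ^ k := by
        rw [hn, Rat.cast_natCast, Nat.cast_pow, norm_pow]
        exact pow_le_pow_left₀ (norm_nonneg _) (norm_prod_p_le_half i) k
      calc _ ≤ (1 / 2 : ℝ) ^ k * |K| := by gcongr
        _ ≤ (1 / 2 : ℝ) ^ k * (|K| + 1) := by gcongr; linarith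
        _ ≤ ε := hk.le

/-- Summation over the lattice `g ℤ_S^d` as integration against the rounding map of a thin
fundamental domain. -/
theorem exists_rounding (hd : 0 < d) {v : Measure (S.QS d)} (hv : S.IsVolS d v)
    (g : S.G d) {ε : ℝ} (hε : 0 < ε) :
    ∃ (σ : S.QS d → S.QS d) (ρ : ℝ), Measurable σ ∧
      (∀ y, ‖(y - σ y).1‖ ≤ ρ ∧ ‖(y - σ y).2‖ ≤ ε) ∧
      ∀ H : S.QS d → ENNReal, Measurable H →
        ∫⁻ y, H (σ y) ∂v = ∑' w, H (S.act g (zdiag S d w)) := by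
  have := hv.1
  obtain ⟨D, ρ, hD, hvD, huniq, hbd⟩ := exists_thin_fundamentalDomain hd hv g hε
  choose w hw hu using huniq
  have key : ∀ (H : S.QS d → ENNReal) (y : S.QS d), H (S.act g (zdiag S d (w y))) =
      ∑' u, D.indicator 1 (y - S.act g (zdiag S d u)) * H (S.act g (zdiag S d u)) := by
    intro H y
    rw [tsum_eq_single (w y)]
    · rw [Set.indicator_of_mem (hw y), Pi.one_apply, one_mul]
    · intro u hne
      rw [Set.indicator_of_notMem (fun h => hne (hu y u h)), zero_mul]
  have hmeas : ∀ u, Measurable fun y => D.indicator (1 : S.QS d → ENNReal) (y - S.act g (zdiag S d u)) :=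
    fun u => (measurable_one.indicator hD).comp (measurable_id.sub_const _)
  have hm : ∀ H : S.QS d → ENNReal, Measurable H →
      Measurable fun y => H (S.act g (zdiag S d (w y))) := by
    intro H _
    simp only [key H]
    exact Measurable.tsum fun u => (hmeas u).mul_const _
  refine ⟨fun y => S.act g (zdiag S d (w y)), ρ, ?_, fun y => hbd _ (hw y), fun H hH => ?_⟩
  · intro A hA
    have h1 := hm _ (measurable_one.indicator hA) (measurableSet_singleton 1)
    convert h1 using 1
    ext y
    by_cases h : S.act g (zdiag S d (w y)) ∈ A <;> simp [h]
  · simp only [key H]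
    rw [lintegral_tsum fun u => ((hmeas u).mul_const _).aemeasurable]
    refine tsum_congr fun u => ?_
    rw [lintegral_mul_const _ (hmeas u),
      lintegral_sub_right_eq_self (fun y => D.indicator (1 : S.QS d → ENNReal) y),
      lintegral_indicator_one hD, hvD, one_mul]

end PrimeTup

section MeanValue

open Filter Topology

namespace PrimeTup

variable {S : PrimeTup} {d : ℕ}

/-- A set of the `p`-adic part that is invariant under small translations. -/
def IsSmallInvariant (C : Set (S.QSf d)) : Prop :=
  ∃ ε : ℝ, 0 < ε ∧ ∀ w ∈ C, ∀ u : S.QSf d, ‖u‖ ≤ ε → w + u ∈ C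

theorem IsSmallInvariant.isOpen {C : Set (S.QSf d)} (hC : IsSmallInvariant C) : IsOpen C := by
  obtain ⟨ε, hε, h⟩ := hC
  refine Metric.isOpen_iff.2 fun w hw => ⟨ε, hε, fun x hx => ?_⟩
  have := h w hw (x - w) (by rw [← dist_eq_norm]; exact (Metric.mem_ball.1 hx).le)
  rwa [add_sub_cancel] at this

theorem IsVolS.lintegral_eq_scale {v : Measure (S.QS d)} (hv : S.IsVolS d v) {T : ℝ} (hT : 0 < T)
    {Φ : S.QS d → ENNReal} (hΦ : Measurable Φ) :
    (ENNReal.ofReal T ^ d)⁻¹ * ∫⁻ y, Φ y ∂v =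
      ∫⁻ y, Φ (T • y.1, y.2) ∂((volume : Measure (Fin d → ℝ)).prod (padicVol S d)) := by
  have hm : Measurable fun y : S.QS d => ((T • y.1, y.2) : S.QS d) := by fun_prop
  have h1 : ((volume : Measure (Fin d → ℝ)).prod (padicVol S d)).map
      (fun y => ((T • y.1, y.2) : S.QS d)) = (ENNReal.ofReal T ^ d)⁻¹ • v := by
    have h := Measure.map_prod_map (volume : Measure (Fin d → ℝ)) (padicVol S d)
      (measurable_const_smul T) measurable_id
    rw [Measure.map_id, Measure.map_addHaar_smul _ hT.ne', Measure.prod_smul_left] at h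
    rw [hv.eq_prod]
    rw [abs_of_pos (by positivity), Module.finrank_pi, Fintype.card_fin,
      ENNReal.ofReal_inv_of_pos (by positivity), ENNReal.ofReal_pow hT.le] at h
    exact h.symm
  rw [← lintegral_map hΦ hm, h1, lintegral_smul_measure, smul_eq_mul]

theorem tendsto_lattice_average (hd : 0 < d) {v : Measure (S.QS d)} (hv : S.IsVolS d v)
    (g : S.G d) {C : Set (S.QSf d)} (hC : IsSmallInvariant C) (hCfin : padicVol S d C ≠ ⊤)
    {T : ℕ → ℝ} (hTpos : ∀ n, 0 < T n) (hT : Tendsto T atTop atTop)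
    {P : ℕ → (Fin d → ℝ) → ENNReal} {Q : (Fin d → ℝ) → ENNReal}
    (hP : ∀ n, Measurable (P n)) (hQ : Measurable Q) {K : ℝ} {M : ENNReal} (hM : M ≠ ⊤)
    (hbound : ∀ n z, P n z ≤ (Metric.closedBall 0 K).indicator (fun _ => M) z)
    (hlim : ∀ᵐ z, ∀ u : ℕ → Fin d → ℝ, Tendsto u atTop (𝓝 z) →
      Tendsto (fun n => P n (u n)) atTop (𝓝 (Q z))) :
    Tendsto (fun n => (ENNReal.ofReal (T n) ^ d)⁻¹ * ∑' w : Fin d → S.Zs,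
        P n ((T n)⁻¹ • (S.act g (zdiag S d w)).1) *
          C.indicator 1 (S.act g (zdiag S d w)).2) atTop
      (𝓝 ((∫⁻ z, Q z) * padicVol S d C)) := by
  have hCm : MeasurableSet C := hC.isOpen.measurableSet
  obtain ⟨ε, hε, hCε⟩ := hC
  obtain ⟨σ, ρ, hσ, hσd, hsum⟩ := exists_rounding hd hv g hε
  have hσC : ∀ y, (σ y).2 ∈ C ↔ y.2 ∈ C := by
    intro y
    have h := (hσd y).2
    rw [Prod.snd_sub] at h
    constructor
    · intro h1
      have := hCε _ h1 _ h
      rwa [add_sub_cancel] at this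
    · intro h1
      have := hCε _ h1 (-(y.2 - (σ y).2)) (by rwa [norm_neg])
      rwa [neg_sub, add_sub_cancel] at this
  have hind : ∀ y, C.indicator (1 : S.QSf d → ENNReal) (σ y).2 = C.indicator 1 y.2 := by
    intro y
    by_cases h : y.2 ∈ C
    · rw [Set.indicator_of_mem h, Set.indicator_of_mem ((hσC y).2 h)]; rfl
    · rw [Set.indicator_of_notMem h, Set.indicator_of_notMem (mt (hσC y).1 h)]
  have hHm : ∀ n, Measurable fun y : S.QS d =>
      P n ((T n)⁻¹ • y.1) * C.indicator (1 : S.QSf d → ENNReal) y.2 := fun n =>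
    ((hP n).comp (by fun_prop)).mul ((measurable_one.indicator hCm).comp measurable_snd)
  have hrew : ∀ n, (ENNReal.ofReal (T n) ^ d)⁻¹ * ∑' w : Fin d → S.Zs,
        P n ((T n)⁻¹ • (S.act g (zdiag S d w)).1) *
          C.indicator 1 (S.act g (zdiag S d w)).2 =
      ∫⁻ y, P n ((T n)⁻¹ • (σ (T n • y.1, y.2)).1) * C.indicator (1 : S.QSf d → ENNReal) y.2
        ∂((volume : Measure (Fin d → ℝ)).prod (padicVol S d)) := by
    intro n
    rw [← hsum _ (hHm n)]
    refine (hv.lintegral_eq_scale (hTpos n) ((hHm n).comp hσ)).trans ?_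
    simp only [Function.comp_apply, hind]
  have hdist : ∀ n (y : S.QS d), ‖(T n)⁻¹ • (σ (T n • y.1, y.2)).1 - y.1‖ ≤ (T n)⁻¹ * ρ := by
    intro n y
    have h := (hσd (T n • y.1, y.2)).1
    have h2 : (T n)⁻¹ • (σ (T n • y.1, y.2)).1 - y.1 =
        -((T n)⁻¹ • ((T n • y.1, y.2) - σ (T n • y.1, y.2)).1) := by
      rw [Prod.fst_sub, smul_sub, smul_smul, inv_mul_cancel₀ (hTpos n).ne', one_smul, neg_sub]
    rw [h2, norm_neg, norm_smul, Real.norm_of_nonneg (inv_nonneg.2 (hTpos n).le)]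
    exact mul_le_mul_of_nonneg_left h (inv_nonneg.2 (hTpos n).le)
  have hT0 : Tendsto (fun n => (T n)⁻¹ * ρ) atTop (𝓝 0) := by
    simpa using (tendsto_inv_atTop_zero.comp hT).mul_const ρ
  simp only [hrew]
  rw [← lintegral_indicator_one hCm,
    ← lintegral_prod_mul hQ.aemeasurable (measurable_one.indicator hCm).aemeasurable]
  refine tendsto_lintegral_filter_of_dominated_convergence
    (fun y => (Metric.closedBall 0 (K + 1)).indicator (fun _ => M) y.1 *
      C.indicator (1 : S.QSf d → ENNReal) y.2) ?_ ?_ ?_ ?_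
  · refine Eventually.of_forall fun n => ?_
    refine Measurable.mul ?_ ((measurable_one.indicator hCm).comp measurable_snd)
    have h1 : Measurable fun y : S.QS d => ((T n • y.1, y.2) : S.QS d) := by fun_prop
    exact (hP n).comp ((measurable_fst.comp (hσ.comp h1)).const_smul (T n)⁻¹)
  · filter_upwards [hT0.eventually_le_const one_pos] with n hn
    refine Eventually.of_forall fun y => mul_le_mul_left ((hbound _ _).trans ?_) _
    by_cases h : y.1 ∈ Metric.closedBall 0 (K + 1)
    · rw [Set.indicator_of_mem h]
      exact Set.indicator_le_self _ _ _
    · rw [Set.indicator_of_notMem h, Set.indicator_of_notMem]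
      intro h1
      rw [mem_closedBall_zero_iff] at h h1
      have h2 := norm_sub_norm_le y.1 ((T n)⁻¹ • (σ (T n • y.1, y.2)).1)
      rw [norm_sub_rev] at h2
      linarith [hdist n y]
  · rw [lintegral_prod_mul (measurable_const.indicator measurableSet_closedBall).aemeasurable
      (measurable_one.indicator hCm).aemeasurable, lintegral_indicator_one hCm,
      lintegral_indicator_const measurableSet_closedBall]
    exact ENNReal.mul_ne_top (ENNReal.mul_ne_top hM measure_closedBall_lt_top.ne) hCfin
  · filter_upwards [Measure.quasiMeasurePreserving_fst.ae hlim] with y hy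
    refine ENNReal.Tendsto.mul_const (hy _ ?_) (Or.inr ?_)
    · rw [tendsto_iff_norm_sub_tendsto_zero]
      exact squeeze_zero (fun _ => norm_nonneg _) (fun n => hdist n y) hT0
    · by_cases h : y.2 ∈ C <;> simp [h]

end PrimeTup

theorem card_filter_range_le {A B : ℝ} (h : A ≤ B) (M : ℕ) :
    (((Finset.range M).filter fun j : ℕ => A < j ∧ (j : ℝ) < B).card : ℝ) ≤ B - A + 1 := by
  have h1 : ((Finset.range M).filter fun j : ℕ => A < j ∧ (j : ℝ) < B).card ≤
      (Finset.Ioo ⌊A⌋ ⌈B⌉).card := by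
    refine Finset.card_le_card_of_injOn (fun j : ℕ => (j : ℤ)) (fun j hj => ?_)
      fun a _ b _ hab => by simpa using hab
    have h2 := (Finset.mem_filter.1 hj).2
    refine Finset.mem_coe.2 (Finset.mem_Ioo.2 ⟨?_, ?_⟩)
    · exact Int.floor_lt.2 (by simpa using h2.1)
    · exact Int.lt_ceil.2 (by simpa using h2.2)
  rw [Int.card_Ioo] at h1
  have h2 : (((⌈B⌉ - ⌊A⌋ - 1).toNat : ℤ) : ℝ) ≤ B - A + 1 := by
    rw [Int.toNat_eq_max]
    push_cast
    refine max_le ?_ (by linarith)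
    linarith [Int.ceil_lt_add_one B, Int.lt_floor_add_one A]
  exact (Nat.cast_le.2 h1).trans (by exact_mod_cast h2)

theorem le_card_filter_range {A B : ℝ} (hA : 0 ≤ A) {M : ℕ} (hB : B ≤ M) :
    B - A - 1 ≤ (((Finset.range M).filter fun j : ℕ => A < j ∧ (j : ℝ) < B).card : ℝ) := by
  have h1 : (Finset.Ico (⌊A⌋₊ + 1) ⌈B⌉₊).card ≤
      ((Finset.range M).filter fun j : ℕ => A < j ∧ (j : ℝ) < B).card := by
    refine Finset.card_le_card fun j hj => ?_
    rw [Finset.mem_Ico] at hj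
    have hlt := Nat.lt_ceil.1 hj.2
    refine Finset.mem_filter.2 ⟨Finset.mem_range.2 ?_, (Nat.floor_lt hA).1 hj.1, hlt⟩
    exact_mod_cast hlt.trans_le hB
  rw [Nat.card_Ico] at h1
  have h2 : (⌈B⌉₊ : ℝ) ≤ ((Finset.range M).filter fun j : ℕ => A < j ∧ (j : ℝ) < B).card +
      (⌊A⌋₊ + 1) := by exact_mod_cast Nat.sub_le_iff_le_add.1 h1
  linarith [Nat.le_ceil B, Nat.floor_le hA]

/-- The normalized number of `j < R²` with `α < R x + (j / R) y < β`. -/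
noncomputable def hitFrequency (R : ℕ) (α β x y : ℝ) : ENNReal :=
  (R : ENNReal)⁻¹ * ∑ j : Fin (R ^ 2), (Set.Ioo α β).indicator 1 (R * x + (j / R : ℝ) * y)

theorem measurable_hitFrequency (R : ℕ) (α β : ℝ) {X : Type*} [MeasurableSpace X] {x y : X → ℝ}
    (hx : Measurable x) (hy : Measurable y) :
    Measurable fun t => hitFrequency R α β (x t) (y t) := by
  unfold hitFrequency
  refine Measurable.const_mul (Finset.measurable_sum _ fun j _ => ?_) _
  exact (measurable_one.indicator measurableSet_Ioo).comp
    ((hx.const_mul _).add (hy.const_mul _))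

theorem hitFrequency_eq {R : ℕ} (hR : 0 < R) {α β x y : ℝ} (hy : 0 < y) :
    hitFrequency R α β x y = ENNReal.ofReal ((((Finset.range (R ^ 2)).filter fun j : ℕ =>
      R * (α - R * x) / y < j ∧ (j : ℝ) < R * (β - R * x) / y).card : ℝ) / R) := by
  have hR' : (0 : ℝ) < R := by exact_mod_cast hR
  rw [hitFrequency, Finset.card_filter, Finset.sum_range, ENNReal.ofReal_div_of_pos hR',
    ENNReal.ofReal_natCast, ENNReal.ofReal_natCast, div_eq_mul_inv, mul_comm, Nat.cast_sum]
  congr 1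
  refine Finset.sum_congr rfl fun j _ => ?_
  rw [Set.indicator_apply, Nat.cast_ite, Nat.cast_one, Nat.cast_zero, Pi.one_apply]
  refine if_congr ?_ rfl rfl
  rw [Set.mem_Ioo, div_lt_iff₀ hy, lt_div_iff₀ hy]
  have e : (R : ℝ) * x + (j / R : ℝ) * y = (R * (R * x) + j * y) / R := by field_simp
  rw [e, lt_div_iff₀ hR', div_lt_iff₀ hR']
  constructor <;> rintro ⟨h1, h2⟩ <;> constructor <;> linarith

theorem hitFrequency_le {R : ℕ} (hR : 0 < R) {α β x y c : ℝ} (hαβ : α ≤ β) (hc : 0 < c)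
    (hy : c < y) : hitFrequency R α β x y ≤ ENNReal.ofReal ((β - α) / c + 1) := by
  have hR' : (1 : ℝ) ≤ R := by exact_mod_cast hR
  have hy0 := hc.trans hy
  rw [hitFrequency_eq hR hy0]
  refine ENNReal.ofReal_le_ofReal ?_
  have hle : R * (α - R * x) / y ≤ R * (β - R * x) / y := by gcongr
  refine (div_le_div_of_nonneg_right (card_filter_range_le hle _) (by positivity)).trans ?_
  have e : (R * (β - R * x) / y - R * (α - R * x) / y + 1) / R = (β - α) / y + 1 / R := by
    field_simp
    ring
  rw [e]
  have h1 : (β - α) / y ≤ (β - α) / c :=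
    div_le_div_of_nonneg_left (by linarith) hc hy.le
  have h2 : (1 : ℝ) / R ≤ 1 := by rw [div_le_one (by positivity)]; exact hR'
  linarith

theorem abs_le_of_hitFrequency_ne_zero {R : ℕ} {α β x y : ℝ} (hy : 0 < y)
    (h : hitFrequency R α β x y ≠ 0) : |x| ≤ max |α| |β| + y := by
  obtain ⟨j, -, hj⟩ := Finset.exists_ne_zero_of_sum_ne_zero (right_ne_zero_of_mul h)
  have hmem := Set.mem_of_indicator_ne_zero hj
  have hjR : (j : ℝ) < (R : ℝ) ^ 2 := by exact_mod_cast j.2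
  have hR : 0 < R := by
    rcases Nat.eq_zero_or_pos R with rfl | h0
    · have := j.2
      simp at this
    · exact h0
  have hR1 : (1 : ℝ) ≤ R := by exact_mod_cast hR
  set c := R * x + (j / R : ℝ) * y with hc
  have hcabs : |c| ≤ max |α| |β| := abs_le_max_abs_abs hmem.1.le hmem.2.le
  have hx : x = c / R - j / R ^ 2 * y := by
    rw [hc]
    field_simp
    ring
  have h1 : |c / R| ≤ max |α| |β| := by
    rw [abs_div, Nat.abs_cast]
    exact (div_le_self (abs_nonneg _) hR1).trans hcabs
  have h2 : |(j : ℝ) / R ^ 2 * y| ≤ y := by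
    rw [abs_of_nonneg (by positivity)]
    exact mul_le_of_le_one_left hy.le ((div_le_one (by positivity)).2 hjR.le)
  rw [hx]
  exact (abs_sub _ _).trans (add_le_add h1 h2)

theorem tendsto_hitFrequency {R : ℕ → ℕ} (hR : Tendsto R atTop atTop) {α β : ℝ} (hαβ : α ≤ β)
    {x y : ℝ} {u w : ℕ → ℝ} (hu : Tendsto u atTop (𝓝 x)) (hw : Tendsto w atTop (𝓝 y))
    (hy : 0 < y) (hx0 : x ≠ 0) (hxy : x ≠ -y) :
    Tendsto (fun n => hitFrequency (R n) α β (u n) (w n)) atTop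
      (𝓝 ((Set.Ioo (-y) 0).indicator (fun _ => ENNReal.ofReal ((β - α) / y)) x)) := by
  have hRr : Tendsto (fun n => (R n : ℝ)) atTop atTop := tendsto_natCast_atTop_atTop.comp hR
  have hRi : Tendsto (fun n => ((R n : ℝ))⁻¹) atTop (𝓝 0) := tendsto_inv_atTop_zero.comp hRr
  have hRpos : ∀ᶠ n in atTop, 0 < R n := hR.eventually_gt_atTop 0
  have hwpos : ∀ᶠ n in atTop, 0 < w n := hw.eventually_const_lt hy
  have hratio : ∀ γ : ℝ, Tendsto (fun n => (γ * ((R n : ℝ))⁻¹ - u n) / w n) atTop (𝓝 (-x / y)) := by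
    intro γ
    have := ((hRi.const_mul γ).sub hu).div hw hy.ne'
    rw [mul_zero, zero_sub] at this
    exact this
  have hform : ∀ᶠ n in atTop, ∀ γ : ℝ, (R n : ℝ) * (γ - R n * u n) / w n =
      (R n : ℝ) ^ 2 * ((γ * ((R n : ℝ))⁻¹ - u n) / w n) := by
    filter_upwards [hRpos, hwpos] with n h1 h2 γ
    have : (0 : ℝ) < R n := by exact_mod_cast h1
    field_simp
  have hzero : ∀ (n : ℕ), 0 < R n → 0 < w n →
      (∀ γ, (R n : ℝ) * (γ - R n * u n) / w n =
        (R n : ℝ) ^ 2 * ((γ * ((R n : ℝ))⁻¹ - u n) / w n)) →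
      ((β * ((R n : ℝ))⁻¹ - u n) / w n < 0 ∨ 1 < (α * ((R n : ℝ))⁻¹ - u n) / w n) →
      0 = hitFrequency (R n) α β (u n) (w n) := by
    intro n h1 h2 hf h
    have h1' : (0 : ℝ) < R n := by exact_mod_cast h1
    rw [hitFrequency_eq h1 h2, Finset.filter_false_of_mem, Finset.card_empty, Nat.cast_zero,
      zero_div, ENNReal.ofReal_zero]
    rintro j hj ⟨h3, h4⟩
    rw [hf] at h3 h4
    have hj' : (j : ℝ) < (R n : ℝ) ^ 2 := by exact_mod_cast Finset.mem_range.1 hj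
    rcases h with h | h
    · have : (R n : ℝ) ^ 2 * ((β * ((R n : ℝ))⁻¹ - u n) / w n) < 0 :=
        mul_neg_of_pos_of_neg (by positivity) h
      linarith [(Nat.cast_nonneg j : (0 : ℝ) ≤ j)]
    · have : (R n : ℝ) ^ 2 * 1 < (R n : ℝ) ^ 2 * ((α * ((R n : ℝ))⁻¹ - u n) / w n) := by gcongr
      linarith
  by_cases hmem : x ∈ Set.Ioo (-y) 0
  · rw [Set.indicator_of_mem hmem]
    have hl0 : 0 < -x / y := div_pos (by linarith [hmem.2]) hy
    have hl1 : -x / y < 1 := (div_lt_one hy).2 (by linarith [hmem.1])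
    have hlo : Tendsto (fun n => (β - α) / w n - ((R n : ℝ))⁻¹) atTop (𝓝 ((β - α) / y)) := by
      simpa using ((tendsto_const_nhds (x := β - α)).div hw hy.ne').sub hRi
    have hhi : Tendsto (fun n => (β - α) / w n + ((R n : ℝ))⁻¹) atTop (𝓝 ((β - α) / y)) := by
      simpa using ((tendsto_const_nhds (x := β - α)).div hw hy.ne').add hRi
    refine tendsto_of_tendsto_of_tendsto_of_le_of_le' (ENNReal.tendsto_ofReal hlo)
      (ENNReal.tendsto_ofReal hhi) ?_ ?_
    · filter_upwards [hRpos, hwpos, hform, (hratio α).eventually_const_lt hl0,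
        (hratio β).eventually_lt_const hl1] with n h1 h2 hf h3 h4
      have h1' : (0 : ℝ) < R n := by exact_mod_cast h1
      rw [hitFrequency_eq h1 h2]
      refine ENNReal.ofReal_le_ofReal ((le_div_iff₀ h1').2 (le_trans (le_of_eq ?_)
        (le_card_filter_range ?_ ?_)))
      · field_simp
        ring
      · rw [hf]; positivity
      · rw [hf]
        push_cast
        exact mul_le_of_le_one_right (by positivity) h4.le
    · filter_upwards [hRpos, hwpos] with n h1 h2
      have h1' : (0 : ℝ) < R n := by exact_mod_cast h1
      rw [hitFrequency_eq h1 h2]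
      refine ENNReal.ofReal_le_ofReal ((div_le_iff₀ h1').2
        ((card_filter_range_le ?_ _).trans (le_of_eq ?_)))
      · gcongr
      · field_simp
        ring
  · rw [Set.indicator_of_notMem hmem]
    refine tendsto_const_nhds.congr' ?_
    rcases lt_or_gt_of_ne hx0 with hneg | hpos
    · have hx1 : x < -y := lt_of_le_of_ne (not_lt.1 fun h => hmem ⟨h, hneg⟩) hxy
      have : 1 < -x / y := (one_lt_div hy).2 (by linarith)
      filter_upwards [hRpos, hwpos, hform, (hratio α).eventually_const_lt this] with n h1 h2 hf h3
      exact hzero n h1 h2 hf (Or.inr h3)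
    · have : -x / y < 0 := div_neg_of_neg_of_pos (by linarith) hy
      filter_upwards [hRpos, hwpos, hform, (hratio β).eventually_lt_const this] with n h1 h2 hf h3
      exact hzero n h1 h2 hf (Or.inl h3)

section Profile

variable {d : ℕ} (k : Fin d) (α β : Fin d → ℝ)

/-- The average of the indicator of a box over shears, in rescaled coordinates. -/
noncomputable def shearProfile (R : ℕ) (z : Fin d → ℝ) : ENNReal :=
  ∏ i, if i = k then (Set.Ioo (α i) (β i)).indicator 1 (z i)
    else hitFrequency R (α i) (β i) (z i) (z k)

/-- The limit of `shearProfile`. -/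
noncomputable def limitProfile (z : Fin d → ℝ) : ENNReal :=
  ∏ i, if i = k then (Set.Ioo (α i) (β i)).indicator 1 (z i)
    else (Set.Ioo (-(z k)) 0).indicator (fun _ => ENNReal.ofReal ((β i - α i) / z k)) (z i)

variable {k α β}

theorem measurable_shearProfile (R : ℕ) : Measurable (shearProfile k α β R) := by
  unfold shearProfile
  refine Finset.measurable_prod _ fun i _ => ?_
  by_cases hi : i = k
  · simp only [hi, if_true]
    exact (measurable_one.indicator measurableSet_Ioo).comp (measurable_pi_apply k)
  · simp only [hi, if_false]
    exact measurable_hitFrequency _ _ _ (measurable_pi_apply i) (measurable_pi_apply k)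

theorem measurable_limitProfile : Measurable (limitProfile k α β) := by
  unfold limitProfile
  refine Finset.measurable_prod _ fun i _ => ?_
  by_cases hi : i = k
  · simp only [hi, if_true]
    exact (measurable_one.indicator measurableSet_Ioo).comp (measurable_pi_apply k)
  · simp only [hi, if_false, Set.indicator_apply]
    refine Measurable.ite ?_ (by fun_prop) measurable_const
    exact (measurableSet_lt (measurable_pi_apply k).neg (measurable_pi_apply i)).inter
      (measurableSet_lt (measurable_pi_apply i) measurable_const)

theorem mem_of_shearProfile_ne_zero {R : ℕ} {z : Fin d → ℝ} (h : shearProfile k α β R z ≠ 0) :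
    z k ∈ Set.Ioo (α k) (β k) ∧ ∀ i ≠ k, hitFrequency R (α i) (β i) (z i) (z k) ≠ 0 := by
  have h' := Finset.prod_ne_zero_iff.1 h
  refine ⟨?_, fun i hi => ?_⟩
  · have := h' k (Finset.mem_univ k)
    rw [if_pos rfl] at this
    exact Set.mem_of_indicator_ne_zero this
  · have := h' i (Finset.mem_univ i)
    rwa [if_neg hi] at this

theorem shearProfile_le (hk : 0 < α k) (hαβ : ∀ i, α i ≤ β i) :
    ∃ (K : ℝ) (M : ENNReal), M ≠ ⊤ ∧ ∀ R : ℕ, 0 < R → ∀ z,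
      shearProfile k α β R z ≤ (Metric.closedBall 0 K).indicator (fun _ => M) z := by
  refine ⟨∑ i, (|α i| + |β i|) + β k, ∏ i, ENNReal.ofReal ((β i - α i) / α k + 1),
    ENNReal.prod_ne_top fun i _ => ENNReal.ofReal_ne_top, fun R hR z => ?_⟩
  by_cases h0 : shearProfile k α β R z = 0
  · rw [h0]; exact zero_le
  obtain ⟨hzk, hz⟩ := mem_of_shearProfile_ne_zero h0
  have hzk0 : 0 < z k := hk.trans hzk.1
  have hβk : 0 < β k := hk.trans_le (hαβ k)
  rw [Set.indicator_of_mem]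
  · refine Finset.prod_le_prod' fun i _ => ?_
    split_ifs with hi
    · refine (Set.indicator_le_self' (fun _ _ => zero_le) _).trans ?_
      rw [Pi.one_apply, ENNReal.one_le_ofReal]
      have := div_nonneg (sub_nonneg.2 (hαβ i)) hk.le
      linarith
    · exact hitFrequency_le hR (hαβ i) hk hzk.1
  · rw [mem_closedBall_zero_iff]
    have hsum : ∀ i, |α i| + |β i| ≤ ∑ i, (|α i| + |β i|) := fun i =>
      Finset.single_le_sum (f := fun i => |α i| + |β i|) (fun i _ => by positivity)
        (Finset.mem_univ i)
    refine (pi_norm_le_iff_of_nonneg ?_).2 fun i => ?_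
    · have := (by positivity : 0 ≤ |α k| + |β k|).trans (hsum k)
      linarith
    by_cases hi : i = k
    · subst hi
      rw [Real.norm_of_nonneg hzk0.le]
      have := (by positivity : 0 ≤ |α i| + |β i|).trans (hsum i)
      linarith [hzk.2]
    · have h1 := abs_le_of_hitFrequency_ne_zero hzk0 (hz i hi)
      have h2 : max |α i| |β i| ≤ |α i| + |β i| :=
        max_le (le_add_of_nonneg_right (abs_nonneg _)) (le_add_of_nonneg_left (abs_nonneg _))
      rw [Real.norm_eq_abs]
      linarith [hsum i, hzk.2]

theorem ae_tendsto_shearProfile (hk : 0 < α k) (hαβ : ∀ i, α i ≤ β i) {R : ℕ → ℕ}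
    (hR : Tendsto R atTop atTop) :
    ∀ᵐ z : Fin d → ℝ, ∀ u : ℕ → Fin d → ℝ, Tendsto u atTop (𝓝 z) →
      Tendsto (fun n => shearProfile k α β (R n) (u n)) atTop (𝓝 (limitProfile k α β z)) := by
  have hneg : ∀ i, i ≠ k → ∀ᵐ z : Fin d → ℝ, z i ≠ -z k := by
    intro i hi
    let s : Submodule ℝ (Fin d → ℝ) :=
      LinearMap.ker (LinearMap.proj (R := ℝ) (φ := fun _ : Fin d => ℝ) i + LinearMap.proj k)
    have hs : s ≠ ⊤ := by
      intro h
      have : (Pi.single k 1 : Fin d → ℝ) ∈ s := h ▸ Submodule.mem_top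
      simp [s, hi] at this
    have h0 := Measure.addHaar_submodule (volume : Measure (Fin d → ℝ)) s hs
    refine measure_mono_null (fun z hz => ?_) h0
    have hz' : z i = -z k := by simpa using hz
    simp [s, hz']
  have hcoord : ∀ i (a : ℝ), ∀ᵐ z : Fin d → ℝ, z i ≠ a := fun i a =>
    Measure.ae_eval_ne (μ := fun _ : Fin d => (volume : Measure ℝ)) i a
  have hneg' : ∀ᵐ z : Fin d → ℝ, ∀ i, i ≠ k → z i ≠ -z k := by
    rw [ae_all_iff]
    intro i
    by_cases hi : i = k
    · exact Eventually.of_forall fun z h => absurd hi h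
    · filter_upwards [hneg i hi] with z hz _ using hz
  filter_upwards [hneg', ae_all_iff.2 fun i => hcoord i 0, hcoord k (α k), hcoord k (β k)]
    with z h1 h2 h3 h4 u hu
  have hui : ∀ i, Tendsto (fun n => u n i) atTop (𝓝 (z i)) := fun i => (tendsto_pi_nhds.1 hu) i
  by_cases hmem : z k ∈ Set.Ioo (α k) (β k)
  · refine ENNReal.tendsto_finsetProd_of_ne_top _ (fun i _ => ?_) fun i _ => ?_
    · by_cases hi : i = k
      · subst hi
        simp only [if_true]
        rw [Set.indicator_of_mem hmem]
        refine tendsto_const_nhds.congr' ?_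
        have hev := (hui i).eventually (isOpen_Ioo.mem_nhds hmem)
        filter_upwards [hev] with n hn
        rw [Set.indicator_of_mem (s := Set.Ioo (α i) (β i)) hn]
        rfl
      · simp only [hi, if_false]
        exact tendsto_hitFrequency hR (hαβ i) (hui i) (hui k) (hk.trans hmem.1) (h2 i) (h1 i hi)
    · split_ifs
      · by_cases h : z i ∈ Set.Ioo (α i) (β i) <;> simp [h]
      · by_cases h : z i ∈ Set.Ioo (-(z k)) 0 <;> simp only [Set.indicator_apply, h, if_true, if_false]
        · exact ENNReal.ofReal_ne_top
        · exact ENNReal.zero_ne_top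
  · have h0 : limitProfile k α β z = 0 :=
      Finset.prod_eq_zero (Finset.mem_univ k) (by rw [if_pos rfl, Set.indicator_of_notMem hmem])
    rw [h0]
    refine tendsto_const_nhds.congr' ?_
    have hev : ∀ᶠ n in atTop, u n k ∉ Set.Ioo (α k) (β k) := by
      rcases lt_or_gt_of_ne h3 with h | h
      · filter_upwards [(hui k).eventually_lt_const h] with n hn hn'
        exact lt_asymm hn hn'.1
      · have h5 : β k < z k := lt_of_le_of_ne (not_lt.1 fun h' => hmem ⟨h, h'⟩) h4.symm
        filter_upwards [(hui k).eventually_const_lt h5] with n hn hn'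
        exact lt_asymm hn hn'.2
    filter_upwards [hev] with n hn
    by_contra hne
    exact hn (mem_of_shearProfile_ne_zero (Ne.symm hne)).1

theorem lintegral_limitProfile (hk : 0 < α k) (hαβ : ∀ i, α i ≤ β i) :
    ∫⁻ z, limitProfile k α β z = ∏ i, ENNReal.ofReal (β i - α i) := by
  obtain ⟨m, rfl⟩ : ∃ m, d = m + 1 := ⟨d - 1, by have := k.pos; omega⟩
  have hmp := (volume_preserving_piFinSuccAbove (fun _ : Fin (m + 1) => ℝ) k).symm
  rw [← hmp.lintegral_comp measurable_limitProfile, Measure.volume_eq_prod]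
  refine (lintegral_prod _ (measurable_limitProfile.comp hmp.measurable).aemeasurable).trans ?_
  have hval : ∀ (x : ℝ) (y : Fin m → ℝ),
      limitProfile k α β ((MeasurableEquiv.piFinSuccAbove (fun _ : Fin (m + 1) => ℝ) k).symm (x, y)) =
      (Set.Ioo (α k) (β k)).indicator 1 x * ((∏ j, ENNReal.ofReal ((β (k.succAbove j) -
        α (k.succAbove j)) / x)) * (Set.univ.pi fun _ => Set.Ioo (-x) 0).indicator 1 y) := by
    intro x y
    rw [limitProfile, Fin.prod_univ_succAbove _ k, if_pos rfl]
    simp only [MeasurableEquiv.piFinSuccAbove_symm_apply, Fin.insertNthEquiv_apply,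
      Fin.insertNth_apply_same, Fin.insertNth_apply_succAbove, Fin.succAbove_ne, if_false]
    congr 1
    by_cases h : y ∈ Set.univ.pi fun _ : Fin m => Set.Ioo (-x) 0
    · rw [Set.indicator_of_mem h, Pi.one_apply, mul_one]
      exact Finset.prod_congr rfl fun j _ => Set.indicator_of_mem (h j trivial) _
    · rw [Set.indicator_of_notMem h, mul_zero]
      simp only [Set.mem_pi, not_forall] at h
      obtain ⟨j, -, hj⟩ := h
      exact Finset.prod_eq_zero (Finset.mem_univ j) (Set.indicator_of_notMem hj _)
  have hinner : ∀ x : ℝ, ∫⁻ y, limitProfile k α β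
      ((MeasurableEquiv.piFinSuccAbove (fun _ : Fin (m + 1) => ℝ) k).symm (x, y)) =
      (Set.Ioo (α k) (β k)).indicator (fun _ => ∏ j, ENNReal.ofReal (β (k.succAbove j) -
        α (k.succAbove j))) x := by
    intro x
    have hbox : MeasurableSet (Set.univ.pi fun _ : Fin m => Set.Ioo (-x) 0) :=
      MeasurableSet.univ_pi fun _ => measurableSet_Ioo
    simp only [hval]
    rw [lintegral_const_mul _ ((measurable_one.indicator hbox).const_mul _),
      lintegral_const_mul _ (measurable_one.indicator hbox), lintegral_indicator_one hbox,
      Real.volume_pi_Ioo]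
    by_cases h : x ∈ Set.Ioo (α k) (β k)
    · have hx : 0 < x := hk.trans h.1
      rw [Set.indicator_of_mem h, Set.indicator_of_mem h, Pi.one_apply, one_mul,
        ← Finset.prod_mul_distrib]
      refine Finset.prod_congr rfl fun j _ => ?_
      rw [← ENNReal.ofReal_mul (div_nonneg (sub_nonneg.2 (hαβ _)) hx.le)]
      congr 1
      field_simp
      ring
    · rw [Set.indicator_of_notMem h, Set.indicator_of_notMem h, zero_mul]
  refine (lintegral_congr hinner).trans ?_
  rw [lintegral_indicator_const measurableSet_Ioo, Real.volume_Ioo,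
    Fin.prod_univ_succAbove _ k, mul_comm]

end Profile

namespace PrimeTup

variable {S : PrimeTup} {d : ℕ}

/-- The element of `SL_d(ℝ)` shearing along the `k`-th coordinate by `c`, then contracting the
`k`-th coordinate and expanding the others by `t`. -/
noncomputable def shear (k : Fin d) (t : ℝ) (ht : t ≠ 0) (c : Fin d → ℝ) (hc : c k = 1) :
    SpecialLinearGroup (Fin d) ℝ :=
  ⟨Matrix.diagonal (fun i => if i = k then (t ^ (d - 1))⁻¹ else t) *
    (1 : Matrix (Fin d) (Fin d) ℝ).updateCol k c, by
    rw [Matrix.det_mul, Matrix.det_diagonal, ← Matrix.cramer_apply, Matrix.cramer_one,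
      Module.End.one_apply, hc, mul_one, ← Finset.mul_prod_erase _ _ (Finset.mem_univ k), if_pos rfl,
      Finset.prod_congr rfl fun i hi => if_neg (Finset.ne_of_mem_erase hi), Finset.prod_const,
      Finset.card_erase_of_mem (Finset.mem_univ k), Finset.card_univ, Fintype.card_fin]
    exact inv_mul_cancel₀ (pow_ne_zero _ ht)⟩

theorem shear_mulVec (k : Fin d) (t : ℝ) (ht : t ≠ 0) (c : Fin d → ℝ) (hc : c k = 1)
    (x : Fin d → ℝ) (i : Fin d) :
    ((shear k t ht c hc : Matrix (Fin d) (Fin d) ℝ) *ᵥ x) i =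
      if i = k then (t ^ (d - 1))⁻¹ * x k else t * (x i + c i * x k) := by
  have h : ((1 : Matrix (Fin d) (Fin d) ℝ).updateCol k c *ᵥ x) i =
      x i + (c i - if i = k then 1 else 0) * x k := by
    have : ∀ l, (1 : Matrix (Fin d) (Fin d) ℝ).updateCol k c i l * x l =
        (if i = l then x l else 0) + (if l = k then (c i - if i = k then 1 else 0) * x k else 0) := by
      intro l
      rw [Matrix.updateCol_apply, Matrix.one_apply]
      by_cases h1 : l = k
      · subst h1
        simp only [if_true]
        split_ifs <;> ring
      · simp only [h1, if_false]
        split_ifs <;> ring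
    simp only [mulVec, dotProduct, this, Finset.sum_add_distrib, Finset.sum_ite_eq,
      Finset.sum_ite_eq', Finset.mem_univ, if_true]
  change ((Matrix.diagonal _ * (1 : Matrix (Fin d) (Fin d) ℝ).updateCol k c) *ᵥ x) i = _
  rw [← Matrix.mulVec_mulVec, Matrix.mulVec_diagonal, h]
  by_cases hi : i = k
  · subst hi
    simp [hc]
  · simp [hi]

/-- The shears used for averaging. -/
noncomputable def shearG (S : PrimeTup) (k : Fin d) (t : ℕ) (ht : 0 < t)
    (j : Fin d → Fin ((t ^ d) ^ 2)) : S.G d :=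
  (shear k t (by exact_mod_cast ht.ne')
    (fun i => if i = k then 1 else (j i : ℝ) / ((t : ℝ) ^ d) ^ 2) (if_pos rfl), 1)

theorem act_shearG (k : Fin d) (t : ℕ) (ht : 0 < t) (j : Fin d → Fin ((t ^ d) ^ 2))
    (x : S.QS d) :
    S.act (shearG S k t ht j) x = (fun i => if i = k then ((t : ℝ) ^ (d - 1))⁻¹ * x.1 k else
      t * (x.1 i + (j i : ℝ) / ((t : ℝ) ^ d) ^ 2 * x.1 k), x.2) := by
  refine Prod.ext (funext fun i => ?_) (funext fun i => ?_)
  · refine (shear_mulVec k _ (Nat.cast_ne_zero.2 ht.ne') _ (if_pos rfl) x.1 i).trans ?_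
    by_cases h : i = k <;> simp [h]
  · simp [act, shearG]

theorem average_shear_indicator (k : Fin d) (α β : Fin d → ℝ) {t : ℕ} (ht : 0 < t)
    (x : Fin d → ℝ) :
    ((((t ^ d) ^ 2) ^ d : ℕ) : ENNReal)⁻¹ * ∑ j : Fin d → Fin ((t ^ d) ^ 2),
      (Set.univ.pi fun i => Set.Ioo (α i) (β i)).indicator (1 : (Fin d → ℝ) → ENNReal)
        (fun i => if i = k then ((t : ℝ) ^ (d - 1))⁻¹ * x k else
          t * (x i + (j i : ℝ) / ((t : ℝ) ^ d) ^ 2 * x k)) =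
    (((t ^ (d - 1)) ^ d : ℕ) : ENNReal)⁻¹ *
      shearProfile k α β (t ^ d) (((t : ℝ) ^ (d - 1))⁻¹ • x) := by
  have ht' : (t : ℝ) ≠ 0 := by exact_mod_cast ht.ne'
  have hd : d - 1 + 1 = d := by have := k.pos; omega
  have hind : ∀ y : Fin d → ℝ, (Set.univ.pi fun i => Set.Ioo (α i) (β i)).indicator
      (1 : (Fin d → ℝ) → ENNReal) y = ∏ i, (Set.Ioo (α i) (β i)).indicator 1 (y i) := by
    intro y
    by_cases h : y ∈ Set.univ.pi fun i => Set.Ioo (α i) (β i)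
    · rw [Set.indicator_of_mem h]
      exact (Finset.prod_eq_one fun i _ => Set.indicator_of_mem (h i trivial) _).symm
    · rw [Set.indicator_of_notMem h]
      simp only [Set.mem_pi, not_forall] at h
      obtain ⟨i, -, hi⟩ := h
      exact (Finset.prod_eq_zero (Finset.mem_univ i) (Set.indicator_of_notMem hi _)).symm
  simp only [hind]
  have hprod := Finset.prod_univ_sum (R := ENNReal)
    (fun _ : Fin d => (Finset.univ : Finset (Fin ((t ^ d) ^ 2))))
    (fun i a => (Set.Ioo (α i) (β i)).indicator (1 : ℝ → ENNReal)
      (if i = k then ((t : ℝ) ^ (d - 1))⁻¹ * x k else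
          t * (x i + (a : ℝ) / ((t : ℝ) ^ d) ^ 2 * x k)))
  rw [Fintype.piFinset_univ] at hprod
  rw [← hprod]
  have hfac : ∀ i, ∑ a : Fin ((t ^ d) ^ 2), (Set.Ioo (α i) (β i)).indicator (1 : ℝ → ENNReal)
      (if i = k then ((t : ℝ) ^ (d - 1))⁻¹ * x k else
          t * (x i + (a : ℝ) / ((t : ℝ) ^ d) ^ 2 * x k)) =
      ((if i = k then (t ^ d) ^ 2 else t ^ d : ℕ) : ENNReal) *
        (if i = k then (Set.Ioo (α i) (β i)).indicator 1 ((((t : ℝ) ^ (d - 1))⁻¹ • x) i)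
          else hitFrequency (t ^ d) (α i) (β i) ((((t : ℝ) ^ (d - 1))⁻¹ • x) i)
            ((((t : ℝ) ^ (d - 1))⁻¹ • x) k)) := by
    intro i
    by_cases hi : i = k
    · subst hi
      simp only [if_true, Finset.sum_const, Finset.card_univ, Fintype.card_fin, nsmul_eq_mul,
        Pi.smul_apply, smul_eq_mul]
    · simp only [hi, if_false, hitFrequency, Pi.smul_apply, smul_eq_mul]
      rw [← mul_assoc, ENNReal.mul_inv_cancel (by exact_mod_cast (pow_pos ht d).ne')
        (ENNReal.natCast_ne_top _), one_mul]
      refine Finset.sum_congr rfl fun a _ => ?_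
      congr 1
      have e : (t : ℝ) ^ d = t ^ (d - 1) * t := by rw [← pow_succ, hd]
      push_cast
      rw [e]
      field_simp
  rw [Finset.prod_congr rfl fun i _ => hfac i, Finset.prod_mul_distrib, ← Nat.cast_prod]
  have hnat : (t ^ (d - 1)) ^ d * ∏ i, (if i = k then (t ^ d) ^ 2 else t ^ d) =
      ((t ^ d) ^ 2) ^ d := by
    rw [← Finset.mul_prod_erase _ _ (Finset.mem_univ k), if_pos rfl,
      Finset.prod_congr rfl fun i hi => if_neg (Finset.ne_of_mem_erase hi), Finset.prod_const,
      Finset.card_erase_of_mem (Finset.mem_univ k), Finset.card_univ, Fintype.card_fin]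
    obtain ⟨e, rfl⟩ : ∃ e, d = e + 1 := ⟨d - 1, hd.symm⟩
    simp only [Nat.add_sub_cancel]
    ring
  rw [← mul_assoc]
  congr 1
  rw [← hnat]
  have h1 : (((t ^ (d - 1)) ^ d : ℕ) : ENNReal) ≠ 0 := by
    exact_mod_cast (pow_pos (pow_pos ht _) _).ne'
  have h2 : ((∏ i, (if i = k then (t ^ d) ^ 2 else t ^ d) : ℕ) : ENNReal) ≠ 0 := by
    have : 0 < ∏ i, (if i = k then (t ^ d) ^ 2 else t ^ d) :=
      Finset.prod_pos fun i _ => by split_ifs <;> positivity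
    exact_mod_cast this.ne'
  rw [Nat.cast_mul, ENNReal.mul_inv (Or.inl h1) (Or.inr h2), mul_assoc,
    ENNReal.inv_mul_cancel h2 (ENNReal.natCast_ne_top _), mul_one]

theorem zdiag_injective : Function.Injective (zdiag S d) := by
  intro a b h
  funext j
  have := congrFun (congrArg Prod.fst h) j
  rw [zdiag_fst, zdiag_fst] at this
  exact Subtype.ext (by exact_mod_cast this)

theorem isSLStable_ne_zero : IsSLStable {w : Fin d → S.Zs | w ≠ 0} := by
  intro γ w hw h
  refine hw ?_
  have := congrArg (fun u => ((γ⁻¹ : SpecialLinearGroup (Fin d) S.Zs) :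
    Matrix (Fin d) (Fin d) S.Zs) *ᵥ u) h
  simpa only [Matrix.mulVec_mulVec, ← Matrix.SpecialLinearGroup.coe_mul, inv_mul_cancel,
    Matrix.SpecialLinearGroup.coe_one, Matrix.one_mulVec, Matrix.mulVec_zero] using this

theorem isSLStable_primZs : IsSLStable (S.primZs d) := by
  rintro γ w ⟨γ', rfl⟩
  exact ⟨γ * γ', by rw [Matrix.mulVec_mulVec, ← Matrix.SpecialLinearGroup.coe_mul]⟩

/-- The average over the space of lattices of the counting measures of the points in `I`. -/
noncomputable def meanCount (μ : Measure (S.G d ⧸ S.Gamma d)) (I : Set (Fin d → S.Zs))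
    (hI : IsSLStable I) : Measure (S.QS d) := μ.bind (latticeCount I hI)

theorem meanCount_apply (μ : Measure (S.G d ⧸ S.Gamma d)) {I : Set (Fin d → S.Zs)}
    (hI : IsSLStable I) {A : Set (S.QS d)} (hA : MeasurableSet A) :
    meanCount μ I hI A = ∫⁻ y, latticeCount I hI y A ∂μ :=
  Measure.bind_apply hA (measurable_latticeCount hI).aemeasurable

theorem orbitCount_apply (I : Set (Fin d → S.Zs)) (g : S.G d) {A : Set (S.QS d)}
    (hA : MeasurableSet A) :
    orbitCount I g A = ∑' w : I, A.indicator 1 (S.act g (zdiag S d w)) := by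
  rw [← lintegral_indicator_one hA, lintegral_orbitCount I g (measurable_one.indicator hA)]

theorem meanCount_box (hd : 2 ≤ d) {v : Measure (S.QS d)} (hv : S.IsVolS d v)
    {μ : Measure (S.G d ⧸ S.Gamma d)} (hμ : S.Admissible d μ) {k : Fin d} {α β : Fin d → ℝ}
    (hk : 0 < α k) (hαβ : ∀ i, α i ≤ β i) {C : Set (S.QSf d)} (hC : IsSmallInvariant C)
    (hCfin : padicVol S d C ≠ ⊤) :
    meanCount μ {w | w ≠ 0} isSLStable_ne_zero
      ((Set.univ.pi fun i => Set.Ioo (α i) (β i)) ×ˢ C) =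
      v ((Set.univ.pi fun i => Set.Ioo (α i) (β i)) ×ˢ C) := by
  have := hμ.1
  have hCm : MeasurableSet C := hC.isOpen.measurableSet
  have hBm : MeasurableSet (Set.univ.pi fun i => Set.Ioo (α i) (β i)) :=
    MeasurableSet.univ_pi fun _ => measurableSet_Ioo
  have hA := hBm.prod hCm
  have hd0 : 0 < d := k.pos
  rw [meanCount_apply _ _ hA]
  have hvol : v ((Set.univ.pi fun i => Set.Ioo (α i) (β i)) ×ˢ C) =
      (∫⁻ z, limitProfile k α β z) * padicVol S d C := by
    rw [hv.eq_prod, Measure.prod_prod, Real.volume_pi_Ioo, lintegral_limitProfile hk hαβ]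
  rw [hvol]
  refine lintegral_eq_of_tendsto_average μ
    ((Measure.measurable_coe hA).comp (measurable_latticeCount _)) _
    (fun n => Fin d → Fin (((n + 1) ^ d) ^ 2))
    (fun n j y => shearG S k (n + 1) n.succ_pos j • y)
    (fun n j => hμ.measurePreserving_smul _) fun y => ?_
  obtain ⟨g, rfl⟩ := QuotientGroup.mk_surjective y
  obtain ⟨K, M, hM, hbound⟩ := shearProfile_le hk hαβ
  have hRtop : Tendsto (fun n : ℕ => (n + 1) ^ d) atTop atTop :=
    (tendsto_pow_atTop hd0.ne').comp (tendsto_add_atTop_nat 1)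
  have hTtop : Tendsto (fun n : ℕ => ((n + 1 : ℕ) : ℝ) ^ (d - 1)) atTop atTop :=
    (tendsto_pow_atTop (by omega)).comp
      (tendsto_natCast_atTop_atTop.comp (tendsto_add_atTop_nat 1))
  have hE := tendsto_lattice_average hd0 hv g hC hCfin
    (T := fun n : ℕ => ((n + 1 : ℕ) : ℝ) ^ (d - 1)) (fun n => by positivity) hTtop
    (P := fun n => shearProfile k α β ((n + 1) ^ d)) (fun n => measurable_shearProfile _)
    measurable_limitProfile hM (fun n z => hbound _ (by positivity) z)
    (ae_tendsto_shearProfile hk hαβ hRtop)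
  refine hE.congr fun n => ?_
  have hzero : shearProfile k α β ((n + 1) ^ d) 0 = 0 := by
    by_contra h
    exact lt_asymm hk (mem_of_shearProfile_ne_zero h).1.1
  have hcount : ∀ j, ((fun y => latticeCount {w | w ≠ 0} isSLStable_ne_zero y
        ((Set.univ.pi fun i => Set.Ioo (α i) (β i)) ×ˢ C))
        (shearG S k (n + 1) n.succ_pos j • (QuotientGroup.mk g : S.G d ⧸ S.Gamma d))) =
      ∑' w : {w : Fin d → S.Zs | w ≠ 0}, ((Set.univ.pi fun i => Set.Ioo (α i) (β i)) ×ˢ C).indicator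
        1 (S.act (shearG S k (n + 1) n.succ_pos j) (S.act g (zdiag S d w))) := by
    intro j
    change orbitCount _ (shearG S k (n + 1) n.succ_pos j * g) _ = _
    rw [orbitCount_apply _ _ hA]
    simp only [act_mul]
  simp only [Function.comp_def]
  rw [Finset.sum_congr rfl fun j _ => hcount j, ← tsum_fintype (L := .unconditional _),
    ENNReal.tsum_comm, ← ENNReal.tsum_mul_left, ← ENNReal.tsum_mul_left]
  refine Eq.trans ?_ (tsum_subtype {w : Fin d → S.Zs | w ≠ 0} (fun w =>
    (↑(Fintype.card (Fin d → Fin (((n + 1) ^ d) ^ 2))) : ENNReal)⁻¹ *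
      ∑' j, ((Set.univ.pi fun i => Set.Ioo (α i) (β i)) ×ˢ C).indicator (1 : S.QS d → ENNReal)
        (S.act (shearG S k (n + 1) n.succ_pos j) (S.act g (zdiag S d w))))).symm
  refine tsum_congr fun w => ?_
  by_cases hw : w = 0
  · rw [Set.indicator_of_notMem (show w ∉ {w : Fin d → S.Zs | w ≠ 0} from not_not.2 hw), hw, map_zero, act_zero, Prod.fst_zero,
      smul_zero, hzero, zero_mul, mul_zero]
  rw [Set.indicator_of_mem (show w ∈ {w : Fin d → S.Zs | w ≠ 0} from hw), tsum_fintype]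
  simp only [act_shearG]
  have hsplit : ∀ (a : Fin d → ℝ) (b : S.QSf d),
      ((Set.univ.pi fun i => Set.Ioo (α i) (β i)) ×ˢ C).indicator (1 : S.QS d → ENNReal) (a, b) =
      (Set.univ.pi fun i => Set.Ioo (α i) (β i)).indicator 1 a * C.indicator 1 b := by
    intro a b
    exact Set.indicator_prod_one
  simp only [hsplit]
  rw [← Finset.sum_mul, ← mul_assoc, ← mul_assoc]
  congr 1
  have hav := average_shear_indicator k α β n.succ_pos (S.act g (zdiag S d w)).1
  rw [Fintype.card_fun, Fintype.card_fin, Fintype.card_fin]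
  refine Eq.trans ?_ hav.symm
  congr 2
  rw [← ENNReal.ofReal_pow (by positivity), ← Nat.cast_pow, ← Nat.cast_pow, ENNReal.ofReal_natCast]

theorem isSmallInvariant_closedBall (a : S.QSf d) {r : ℝ} (hr : 0 < r) :
    IsSmallInvariant (Metric.closedBall a r) := by
  refine ⟨r, hr, fun w hw u hu => ?_⟩
  rw [mem_closedBall_iff_norm] at hw ⊢
  rw [add_sub_right_comm]
  rw [pi_norm_le_iff_of_nonneg hr.le] at *
  intro i
  have h1 := hw i
  have h2 := hu i
  rw [pi_norm_le_iff_of_nonneg hr.le] at *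
  exact fun j => (Padic.nonarchimedean _ _).trans (max_le (h1 j) (h2 j))

theorem IsSmallInvariant.inter {C D : Set (S.QSf d)} (hC : IsSmallInvariant C)
    (hD : IsSmallInvariant D) : IsSmallInvariant (C ∩ D) := by
  obtain ⟨ε, hε, h⟩ := hC
  obtain ⟨δ, hδ, h'⟩ := hD
  exact ⟨min ε δ, lt_min hε hδ, fun w hw u hu =>
    ⟨h w hw.1 u (hu.trans (min_le_left _ _)), h' w hw.2 u (hu.trans (min_le_right _ _))⟩⟩

/-- The sets of finite volume that are invariant under small translations. -/
def finiteSmallInvariant (S : PrimeTup) (d : ℕ) : Set (Set (S.QSf d)) :=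
  {C | IsSmallInvariant C ∧ padicVol S d C ≠ ⊤}

theorem closedBall_mem_finiteSmallInvariant (a : S.QSf d) {r : ℝ} (hr : 0 < r) :
    Metric.closedBall a r ∈ finiteSmallInvariant S d :=
  ⟨isSmallInvariant_closedBall a hr, (isCompact_closedBall a r).measure_lt_top.ne⟩

theorem isPiSystem_finiteSmallInvariant : IsPiSystem (finiteSmallInvariant S d) :=
  fun _ hC _ hD _ => ⟨hC.1.inter hD.1, measure_ne_top_of_subset Set.inter_subset_left hC.2⟩

theorem generateFrom_finiteSmallInvariant :
    MeasurableSpace.generateFrom (finiteSmallInvariant S d) = MeasurableSpace.pi := by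
  have hB : TopologicalSpace.IsTopologicalBasis (finiteSmallInvariant S d) := by
    refine TopologicalSpace.isTopologicalBasis_of_isOpen_of_nhds (fun C hC => hC.1.isOpen)
      fun a U ha hU => ?_
    obtain ⟨r, hr, h⟩ := Metric.nhds_basis_closedBall.mem_iff.1 (hU.mem_nhds ha)
    exact ⟨_, closedBall_mem_finiteSmallInvariant a hr, Metric.mem_closedBall_self hr.le, h⟩
  rw [← hB.borel_eq_generateFrom]
  exact (BorelSpace.measurable_eq (α := S.QSf d)).symm

/-- The products of an open box in `ℝ^d` with a set of finite volume invariant under small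
translations. -/
def boxes (S : PrimeTup) (d : ℕ) : Set (Set (S.QS d)) :=
  Set.image2 (· ×ˢ ·) (Set.univ.pi '' Set.univ.pi fun _ : Fin d => {s | ∃ a b : ℝ, s = Set.Ioo a b})
    (finiteSmallInvariant S d)

theorem isCountablySpanning_Ioo : IsCountablySpanning {s | ∃ a b : ℝ, s = Set.Ioo a b} :=
  ⟨fun n => Set.Ioo (-n : ℝ) n, fun n => ⟨_, _, rfl⟩, Set.eq_univ_of_forall fun x => by
    obtain ⟨n, hn⟩ := exists_nat_gt |x|
    exact Set.mem_iUnion.2 ⟨n, abs_lt.1 hn⟩⟩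

theorem isCountablySpanning_finiteSmallInvariant :
    IsCountablySpanning (finiteSmallInvariant S d) :=
  ⟨fun n : ℕ => Metric.closedBall 0 (n + 1 : ℝ),
    fun n => closedBall_mem_finiteSmallInvariant 0 (by positivity),
    Set.eq_univ_of_forall fun x => by
      obtain ⟨n, hn⟩ := exists_nat_gt ‖x‖
      exact Set.mem_iUnion.2 ⟨n, mem_closedBall_zero_iff.2 (by linarith)⟩⟩

theorem generateFrom_Ioo :
    MeasurableSpace.generateFrom {s | ∃ a b : ℝ, s = Set.Ioo a b} = borel ℝ := by
  refine le_antisymm (MeasurableSpace.generateFrom_le ?_) ?_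
  · rintro _ ⟨a, b, rfl⟩
    exact measurableSet_Ioo
  · rw [Real.isTopologicalBasis_Ioo_rat.borel_eq_generateFrom]
    refine MeasurableSpace.generateFrom_mono ?_
    simp only [Set.iUnion_subset_iff, Set.singleton_subset_iff]
    exact fun a b _ => ⟨a, b, rfl⟩

theorem isPiSystem_Ioo : IsPiSystem {s | ∃ a b : ℝ, s = Set.Ioo a b} := by
  rintro _ ⟨a, b, rfl⟩ _ ⟨a', b', rfl⟩ _
  exact ⟨_, _, Set.Ioo_inter_Ioo⟩

theorem generateFrom_boxes :
    MeasurableSpace.generateFrom (boxes S d) = (inferInstance : MeasurableSpace (S.QS d)) := by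
  refine generateFrom_eq_prod ?_ generateFrom_finiteSmallInvariant
    (IsCountablySpanning.pi fun _ => isCountablySpanning_Ioo) isCountablySpanning_finiteSmallInvariant
  exact generateFrom_eq_pi (h := fun _ => inferInstance)
    (fun _ => generateFrom_Ioo.trans BorelSpace.measurable_eq.symm) fun _ => isCountablySpanning_Ioo

theorem isPiSystem_boxes : IsPiSystem (boxes S d) :=
  (IsPiSystem.pi fun _ => isPiSystem_Ioo).prod isPiSystem_finiteSmallInvariant

theorem isCountablySpanning_boxes : IsCountablySpanning (boxes S d) :=
  (IsCountablySpanning.pi fun _ => isCountablySpanning_Ioo).prod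
    isCountablySpanning_finiteSmallInvariant

theorem meanCount_box_inter (hd : 2 ≤ d) {v : Measure (S.QS d)} (hv : S.IsVolS d v)
    {μ : Measure (S.G d ⧸ S.Gamma d)} (hμ : S.Admissible d μ) (k : Fin d) {c : ℝ}
    (hc : 0 < c) {A : Set (S.QS d)} (hA : A ∈ boxes S d) :
    meanCount μ {w | w ≠ 0} isSLStable_ne_zero (A ∩ {x | c < x.1 k}) =
      v (A ∩ {x | c < x.1 k}) ∧ v A ≠ ⊤ := by
  obtain ⟨B, ⟨s, hs, rfl⟩, C, ⟨hC, hCfin⟩, rfl⟩ := hA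
  choose a b hab using fun i => hs i (Set.mem_univ i)
  obtain rfl : s = fun i => Set.Ioo (a i) (b i) := funext hab
  constructor
  · set α : Fin d → ℝ := fun i => if i = k then max (a i) c else a i with hα
    have h : ((Set.univ.pi fun i => Set.Ioo (a i) (b i)) ×ˢ C) ∩ {x : S.QS d | c < x.1 k} =
        (Set.univ.pi fun i => Set.Ioo (α i) (max (α i) (b i))) ×ˢ C := by
      ext x
      simp only [Set.mem_inter_iff, Set.mem_prod, Set.mem_univ_pi, Set.mem_Ioo,
        Set.mem_ofPred_eq, lt_max_iff, hα]
      constructor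
      · rintro ⟨⟨h1, h2⟩, h3⟩
        refine ⟨fun i => ⟨?_, Or.inr (h1 i).2⟩, h2⟩
        split_ifs with hi
        · subst hi
          exact max_lt (h1 i).1 h3
        · exact (h1 i).1
      · rintro ⟨h1, h2⟩
        refine ⟨⟨fun i => ?_, h2⟩, ?_⟩
        · obtain ⟨h3, h4⟩ := h1 i
          refine ⟨?_, h4.resolve_left h3.not_gt⟩
          split_ifs at h3 with hi
          · exact (le_max_left _ _).trans_lt h3
          · exact h3
        · have := (h1 k).1
          rw [if_pos rfl] at this
          exact (le_max_right _ _).trans_lt this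
    rw [h]
    refine meanCount_box hd hv hμ (k := k) ?_ (fun i => le_max_left _ _) hC hCfin
    simp only [hα, if_true]
    exact hc.trans_le (le_max_right _ _)
  · rw [hv.eq_prod, Measure.prod_prod, Real.volume_pi_Ioo]
    exact ENNReal.mul_ne_top (ENNReal.prod_ne_top fun i _ => ENNReal.ofReal_ne_top) hCfin

theorem meanCount_restrict_pos (hd : 2 ≤ d) {v : Measure (S.QS d)} (hv : S.IsVolS d v)
    {μ : Measure (S.G d ⧸ S.Gamma d)} (hμ : S.Admissible d μ) (k : Fin d) {c : ℝ}
    (hc : 0 < c) :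
    (meanCount μ {w | w ≠ 0} isSLStable_ne_zero).restrict {x | c < x.1 k} =
      v.restrict {x | c < x.1 k} := by
  have hm : ∀ A ∈ boxes S d, MeasurableSet A := fun A hA =>
    generateFrom_boxes.le A (MeasurableSpace.measurableSet_generateFrom hA)
  obtain ⟨B, hB, hU⟩ := isCountablySpanning_boxes (S := S) (d := d)
  refine Measure.ext_of_generateFrom_of_iUnion (boxes S d) B generateFrom_boxes.symm
    isPiSystem_boxes hU hB (fun n => ?_) fun A hA => ?_
  · rw [Measure.restrict_apply (hm _ (hB n)), (meanCount_box_inter hd hv hμ k hc (hB n)).1]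
    exact measure_ne_top_of_subset Set.inter_subset_left
      (meanCount_box_inter hd hv hμ k hc (hB n)).2
  · rw [Measure.restrict_apply (hm _ hA), Measure.restrict_apply (hm _ hA),
      (meanCount_box_inter hd hv hμ k hc hA).1]

theorem act_neg (g : S.G d) (x : S.QS d) : S.act g (-x) = -S.act g x := by
  rw [← zero_sub, act_sub, act_zero, zero_sub]

theorem meanCount_preimage_neg (μ : Measure (S.G d ⧸ S.Gamma d)) {A : Set (S.QS d)}
    (hA : MeasurableSet A) :
    meanCount μ {w | w ≠ 0} isSLStable_ne_zero (Neg.neg ⁻¹' A) =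
      meanCount μ {w | w ≠ 0} isSLStable_ne_zero A := by
  rw [meanCount_apply _ _ hA, meanCount_apply _ _ (measurable_neg hA)]
  refine lintegral_congr fun y => ?_
  obtain ⟨g, rfl⟩ := QuotientGroup.mk_surjective y
  rw [latticeCount_mk, orbitCount_apply _ _ hA, orbitCount_apply _ _ (measurable_neg hA)]
  let e : {w : Fin d → S.Zs | w ≠ 0} ≃ {w : Fin d → S.Zs | w ≠ 0} :=
    (Equiv.neg (Fin d → S.Zs)).subtypeEquiv fun w => neg_ne_zero.symm
  rw [← e.tsum_eq]
  refine tsum_congr fun w => ?_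
  change A.indicator (1 : S.QS d → ENNReal) (-S.act g (zdiag S d (-w.1))) = _
  rw [map_neg, act_neg, neg_neg]

theorem fst_act_zdiag_ne_zero (g : S.G d) {w : Fin d → S.Zs} (hw : w ≠ 0) :
    (S.act g (zdiag S d w)).1 ≠ 0 := by
  intro h
  refine hw ?_
  have h' := congrArg (fun u => ((g.1⁻¹ : SpecialLinearGroup (Fin d) ℝ) :
    Matrix (Fin d) (Fin d) ℝ) *ᵥ u) h
  simp only [act, Matrix.mulVec_mulVec, ← Matrix.SpecialLinearGroup.coe_mul, inv_mul_cancel,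
    Matrix.SpecialLinearGroup.coe_one, Matrix.one_mulVec, Matrix.mulVec_zero] at h'
  funext j
  have := congrFun h' j
  rw [zdiag_fst, Pi.zero_apply, Rat.cast_eq_zero] at this
  exact Subtype.ext this

/-- The mean value formula for the nonzero vectors of `ℤ_S^d`. -/
theorem meanCount_ne_zero (hd : 2 ≤ d) {v : Measure (S.QS d)} (hv : S.IsVolS d v)
    {μ : Measure (S.G d ⧸ S.Gamma d)} (hμ : S.Admissible d μ) :
    meanCount μ {w | w ≠ 0} isSLStable_ne_zero = v := by
  have : v.IsAddHaarMeasure := hv.1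
  have : v.Regular := hv.2.1
  have hfst : ∀ k : Fin d, Measurable fun x : S.QS d => x.1 k := fun k =>
    (measurable_pi_apply k).comp measurable_fst
  set ν := meanCount μ {w | w ≠ 0} isSLStable_ne_zero with hν
  have hpos := fun k n => meanCount_restrict_pos hd hv hμ k (Nat.one_div_pos_of_nat (n := n))
  have hneg : ∀ (k : Fin d) (n : ℕ), ν.restrict {x | x.1 k < -(1 / ((n : ℝ) + 1))} =
      v.restrict {x | x.1 k < -(1 / ((n : ℝ) + 1))} := by
    intro k n
    have hUm : MeasurableSet {x : S.QS d | x.1 k < -(1 / ((n : ℝ) + 1))} :=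
      measurableSet_lt (hfst k) measurable_const
    refine Measure.ext fun A hA => ?_
    rw [Measure.restrict_apply hA, Measure.restrict_apply hA,
      ← meanCount_preimage_neg μ (hA.inter hUm), ← Measure.measure_preimage_neg v]
    have hU : (Neg.neg ⁻¹' {x : S.QS d | x.1 k < -(1 / ((n : ℝ) + 1))}) =
        {x | 1 / ((n : ℝ) + 1) < x.1 k} := by
      ext x
      simp only [Set.mem_preimage, Set.mem_ofPred_eq, Prod.fst_neg, Pi.neg_apply, neg_lt_neg_iff]
    rw [Set.preimage_inter, hU, ← Measure.restrict_apply (measurable_neg hA),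
      ← Measure.restrict_apply (measurable_neg hA)]
    exact congrArg (fun ρ : Measure (S.QS d) => ρ (Neg.neg ⁻¹' A)) (hpos k n)
  have hcover : {x : S.QS d | x.1 ≠ 0} = ⋃ kn : Fin d × ℕ,
      ({x : S.QS d | 1 / ((kn.2 : ℝ) + 1) < x.1 kn.1} ∪
        {x | x.1 kn.1 < -(1 / ((kn.2 : ℝ) + 1))}) := by
    ext x
    simp only [Set.mem_ofPred_eq, Set.mem_iUnion, Set.mem_union]
    constructor
    · intro hx
      obtain ⟨k, hk⟩ := Function.ne_iff.1 hx
      obtain ⟨n, hn⟩ := exists_nat_one_div_lt (abs_pos.2 hk)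
      refine ⟨(k, n), ?_⟩
      rcases lt_abs.1 hn with h | h
      · exact Or.inl h
      · exact Or.inr (lt_neg.1 h)
    · rintro ⟨⟨k, n⟩, h⟩ h0
      have hn : (0 : ℝ) < 1 / ((n : ℝ) + 1) := Nat.one_div_pos_of_nat
      rw [h0] at h
      rcases h with h | h
      · exact lt_asymm hn h
      · exact lt_asymm (neg_neg_of_pos hn) h
  have hres : ν.restrict {x : S.QS d | x.1 ≠ 0} = v.restrict {x | x.1 ≠ 0} := by
    rw [hcover, Measure.restrict_iUnion_congr]
    exact fun kn => Measure.restrict_union_congr.2 ⟨hpos kn.1 kn.2, hneg kn.1 kn.2⟩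
  have hzm : MeasurableSet {x : S.QS d | x.1 = 0} :=
    measurable_fst (measurableSet_singleton (0 : Fin d → ℝ))
  have hcompl : {x : S.QS d | x.1 ≠ 0} = {x | x.1 = 0}ᶜ := rfl
  have hν0 : ν {x : S.QS d | x.1 = 0} = 0 := by
    rw [hν, meanCount_apply _ _ hzm]
    refine lintegral_eq_zero_of_ae_eq_zero (ae_of_all _ fun y => ?_)
    obtain ⟨g, rfl⟩ := QuotientGroup.mk_surjective y
    change orbitCount _ g _ = 0
    rw [orbitCount_apply _ _ hzm, ENNReal.tsum_eq_zero]
    exact fun w => Set.indicator_of_notMem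
      (show S.act g (zdiag S d w) ∉ {x : S.QS d | x.1 = 0} from fst_act_zdiag_ne_zero g w.2) _
  have hv0 : v {x : S.QS d | x.1 = 0} = 0 := by
    have : Nonempty (Fin d) := ⟨⟨0, by omega⟩⟩
    have h : {x : S.QS d | x.1 = 0} = ({0} : Set (Fin d → ℝ)) ×ˢ Set.univ := by
      ext x
      simp
    rw [h, hv.eq_prod, Measure.prod_prod, measure_singleton, zero_mul]
  rw [← Measure.restrict_add_restrict_compl (μ := ν) hzm,
    ← Measure.restrict_add_restrict_compl (μ := v) hzm, Measure.restrict_eq_zero.2 hν0,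
    Measure.restrict_eq_zero.2 hv0, ← hcompl, hres]

end PrimeTup

theorem eq_zero_of_tsum_mul_eq_zero {c : ℕ+ → ℝ}
    (hc : Summable fun p : ℕ+ × ℕ+ => c (p.1 * p.2)) (h : ∀ k, ∑' m, c (k * m) = 0) :
    c 1 = 0 := by
  set F : ℕ+ × ℕ+ → ℝ := fun p => (ArithmeticFunction.moebius (p.1 : ℕ) : ℝ) * c (p.1 * p.2)
    with hF
  have hFs : Summable F := by
    refine Summable.of_norm_bounded hc.norm fun p => ?_
    rw [hF, norm_mul]
    refine mul_le_of_le_one_left (norm_nonneg _) ?_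
    rw [Real.norm_eq_abs, ← Int.cast_abs]
    exact_mod_cast ArithmeticFunction.abs_moebius_le_one
  have h1 : ∑' p, F p = 0 := by
    rw [hFs.tsum_prod]
    simp only [hF, tsum_mul_left, h, mul_zero, tsum_zero]
  have h2 : ∑' p, F p = c 1 := by
    have hs : Summable fun x => F (sigmaAntidiagonalEquivProd x) :=
      sigmaAntidiagonalEquivProd.summable_iff.2 hFs
    have hinner : ∀ n : ℕ+, ∑' x : Nat.divisorsAntidiagonal n,
        F (sigmaAntidiagonalEquivProd ⟨n, x⟩) =
        ((1 : ArithmeticFunction ℤ) (n : ℕ) : ℝ) * c n := by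
      intro n
      have hterm : ∀ x : Nat.divisorsAntidiagonal n, F (sigmaAntidiagonalEquivProd ⟨n, x⟩) =
          (ArithmeticFunction.moebius x.1.1 : ℝ) * c n := by
        intro x
        have hx : (sigmaAntidiagonalEquivProd ⟨n, x⟩).1 * (sigmaAntidiagonalEquivProd ⟨n, x⟩).2 =
            n := congrArg Sigma.fst (sigmaAntidiagonalEquivProd.symm_apply_apply ⟨n, x⟩)
        simp only [hF, hx]
        rfl
      rw [tsum_congr hterm, tsum_mul_right, Finset.tsum_subtype (Nat.divisorsAntidiagonal n)
        fun x => (ArithmeticFunction.moebius x.1 : ℝ),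
        ← ArithmeticFunction.moebius_mul_coe_zeta, ArithmeticFunction.mul_apply, Int.cast_sum]
      congr 1
      refine Finset.sum_congr rfl fun x hx => ?_
      rw [ArithmeticFunction.natCoe_apply, ArithmeticFunction.zeta_apply_ne
        (Nat.ne_zero_of_mem_divisorsAntidiagonal hx).2, Nat.cast_one, mul_one]
    rw [← sigmaAntidiagonalEquivProd.tsum_eq F, hs.tsum_sigma, tsum_congr hinner,
      tsum_eq_single 1 fun n hn => ?_]
    · simp
    · rw [ArithmeticFunction.one_apply_ne (fun h => hn (PNat.coe_eq_one_iff.1 h)), Int.cast_zero,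
        zero_mul]
  rw [← h2, h1]

theorem mul_tsum_eq_of_tsum_mul {h z : ℕ+ → ENNReal} (hz : ∀ k m, z (k * m) = z k * z m)
    (hz1 : z 1 = 1) (hsum : ∑' n, z n ≠ ⊤) {V : ENNReal} (hV : V ≠ ⊤)
    (hh : ∀ k, ∑' m, h (k * m) = V * z k) : h 1 * ∑' n, z n = V := by
  set Z := ∑' n, z n with hZ
  have hzt : ∀ n, z n ≠ ⊤ := ENNReal.ne_top_of_tsum_ne_top hsum
  have hht : ∀ k m, h (k * m) ≠ ⊤ := fun k =>
    ENNReal.ne_top_of_tsum_ne_top (by rw [hh k]; exact ENNReal.mul_ne_top hV (hzt k))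
  have hh1 : h 1 ≠ ⊤ := by simpa using hht 1 1
  have hs1 : Summable fun p : ℕ+ × ℕ+ => (h (p.1 * p.2)).toReal := by
    refine ENNReal.summable_toReal ?_
    rw [ENNReal.tsum_prod (f := fun k m => h (k * m))]
    simp only [hh, ENNReal.tsum_mul_left]
    exact ENNReal.mul_ne_top hV hsum
  have hs2 : Summable fun p : ℕ+ × ℕ+ => (z (p.1 * p.2)).toReal := by
    refine ENNReal.summable_toReal ?_
    rw [ENNReal.tsum_prod (f := fun k m => z (k * m))]
    simp only [hz, ENNReal.tsum_mul_left, ENNReal.tsum_mul_right]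
    exact ENNReal.mul_ne_top hsum hsum
  have key := eq_zero_of_tsum_mul_eq_zero
    (c := fun n => (h n).toReal * Z.toReal - V.toReal * (z n).toReal)
    ((hs1.mul_right _).sub (hs2.mul_left _)) fun k => by
      rw [((hs1.prod_factor k).mul_right _).tsum_sub ((hs2.prod_factor k).mul_left _),
        tsum_mul_right, tsum_mul_left, ← ENNReal.tsum_toReal_eq (hht k),
        ← ENNReal.tsum_toReal_eq (fun m => hzt _), hh]
      simp only [hz, ENNReal.tsum_mul_left, ENNReal.toReal_mul]
      ring
  simp only [hz1, ENNReal.toReal_one, mul_one] at key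
  rw [← ENNReal.toReal_mul, sub_eq_zero] at key
  exact (ENNReal.toReal_eq_toReal_iff' (ENNReal.mul_ne_top hh1 hsum) hV).1 key

namespace PrimeTup

variable {S : PrimeTup} {d : ℕ}

theorem mul_mem_NS {k m : ℕ} : k * m ∈ S.NS ↔ k ∈ S.NS ∧ m ∈ S.NS := by
  simp only [NS, Set.mem_ofPred_eq, (S.hp _).dvd_mul, not_or]
  constructor
  · rintro ⟨h, h'⟩
    exact ⟨⟨Nat.pos_of_mul_pos_right h, fun i => (h' i).1⟩, Nat.pos_of_mul_pos_left h,
      fun i => (h' i).2⟩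
  · rintro ⟨⟨h1, h2⟩, h3, h4⟩
    exact ⟨Nat.mul_pos h1 h3, fun i => ⟨h2 i, h4 i⟩⟩

theorem one_mem_NS : 1 ∈ S.NS := ⟨one_pos, fun i => (S.hp i).one_lt.ne' ∘ Nat.dvd_one.1⟩

open Classical in
theorem tsum_NS (f : ℕ → ENNReal) :
    ∑' m : S.NS, f m = ∑' n : ℕ+, if (n : ℕ) ∈ S.NS then f n else 0 := by
  rw [tsum_subtype S.NS f]
  refine (PNat.coe_injective.tsum_eq (f := S.NS.indicator f) fun m hm => ?_).symm.trans ?_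
  · exact ⟨⟨m, (Set.mem_of_indicator_ne_zero hm).1⟩, rfl⟩
  · exact tsum_congr fun n => Set.indicator_apply _ _ _

theorem ne_zero_of_mem_primZs (hd : 0 < d) {w : Fin d → S.Zs} (hw : w ∈ S.primZs d) : w ≠ 0 := by
  obtain ⟨γ, rfl⟩ := hw
  refine isSLStable_ne_zero γ _ fun h => ?_
  have := congrFun h ⟨0, hd⟩
  simp [e1] at this

theorem act_ratSMul (g : S.G d) (q : ℚ) (x : S.QS d) :
    S.act g (S.ratSMul q x) = S.ratSMul q (S.act g x) :=
  Prod.ext (act_ratSMul_fst g q x) (funext fun i => funext fun j => act_ratSMul_snd g q x i j)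

/-- Every nonzero vector of `ℤ_S^d` is uniquely a multiple, by an element of `ℕ_S`, of an
`S`-primitive vector. -/
noncomputable def primitiveDecomposition (S : PrimeTup) (hd : 2 ≤ d) :
    S.NS × S.primZs d ≃ {w : Fin d → S.Zs | w ≠ 0} :=
  Equiv.ofBijective (fun p => ⟨((p.1 : ℕ) : S.Zs) • (p.2 : Fin d → S.Zs), smul_ne_zero
      (Nat.cast_ne_zero.2 p.1.2.1.ne') (ne_zero_of_mem_primZs (by omega) p.2.2)⟩) <| by
    constructor
    · rintro ⟨⟨m, hm⟩, w, hw⟩ ⟨⟨m', hm'⟩, w', hw'⟩ h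
      have h' : (m : S.Zs) • w = (m' : S.Zs) • w' := congrArg Subtype.val h
      obtain rfl := eq_of_NS_smul_primZs hm hm' (by omega) hw hw' h'
      obtain rfl := smul_right_injective _ (Nat.cast_ne_zero.2 hm.1.ne' : (m : S.Zs) ≠ 0) h'
      rfl
    · rintro ⟨v, hv⟩
      obtain ⟨m, hm, w, hw, rfl⟩ := exists_NS_smul_primZs hd v hv
      exact ⟨(⟨m, hm⟩, ⟨w, hw⟩), rfl⟩

theorem orbitCount_ne_zero (hd : 2 ≤ d) (g : S.G d) {A : Set (S.QS d)} (hA : MeasurableSet A) :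
    orbitCount {w : Fin d → S.Zs | w ≠ 0} g A =
      ∑' m : S.NS, orbitCount (S.primZs d) g (S.ratSMul (m : ℕ) ⁻¹' A) := by
  rw [orbitCount_apply _ _ hA, ← (primitiveDecomposition S hd).tsum_eq, ENNReal.tsum_prod']
  refine tsum_congr fun m => ?_
  rw [orbitCount_apply _ _ (measurable_ratSMul _ hA)]
  refine tsum_congr fun w => ?_
  change A.indicator 1 (S.act g (zdiag S d (((m : ℕ) : S.Zs) • (w : Fin d → S.Zs)))) =
    A.indicator (1 : S.QS d → ENNReal) (S.ratSMul (m : ℕ) (S.act g (zdiag S d w)))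
  rw [← act_ratSMul, ratSMul_zdiag (natCast_mem S.Zs _)]
  rfl

theorem meanCount_ne_zero_eq_tsum (hd : 2 ≤ d) (μ : Measure (S.G d ⧸ S.Gamma d))
    {A : Set (S.QS d)} (hA : MeasurableSet A) :
    meanCount μ {w : Fin d → S.Zs | w ≠ 0} isSLStable_ne_zero A =
      ∑' m : S.NS, meanCount μ (S.primZs d) isSLStable_primZs (S.ratSMul (m : ℕ) ⁻¹' A) := by
  rw [meanCount_apply _ _ hA]
  simp only [meanCount_apply _ _ (measurable_ratSMul _ hA)]
  have hm : ∀ m : S.NS, Measurable fun y => latticeCount (S.primZs d) isSLStable_primZs y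
      (S.ratSMul (m : ℕ) ⁻¹' A) := fun m =>
    (Measure.measurable_coe (measurable_ratSMul _ hA)).comp (measurable_latticeCount _)
  rw [← lintegral_tsum fun m => (hm m).aemeasurable]
  refine lintegral_congr fun y => ?_
  obtain ⟨g, rfl⟩ := QuotientGroup.mk_surjective y
  exact orbitCount_ne_zero hd g hA

theorem summable_zetaS (hd : 2 ≤ d) : Summable fun m : S.NS => (1 : ℝ) / ((m : ℕ) : ℝ) ^ d :=
  (Real.summable_one_div_nat_pow.2 (by omega)).subtype S.NS

theorem ofReal_zetaS (hd : 2 ≤ d) :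
    ENNReal.ofReal (S.zetaS d) = ∑' m : S.NS, (((m : ℕ) : ENNReal) ^ d)⁻¹ := by
  rw [zetaS, ENNReal.ofReal_tsum_of_nonneg (fun m => by positivity) (summable_zetaS hd)]
  refine tsum_congr fun m => ?_
  have : (0 : ℝ) < (m : ℕ) := by exact_mod_cast m.2.1
  rw [one_div, ENNReal.ofReal_inv_of_pos (by positivity), ENNReal.ofReal_pow this.le,
    ENNReal.ofReal_natCast]

theorem zetaS_pos (hd : 2 ≤ d) : 0 < S.zetaS d :=
  (summable_zetaS hd).tsum_pos (fun m => by positivity) ⟨1, one_mem_NS⟩ (by simp)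

open Classical in
theorem meanCount_primZs_apply (hd : 2 ≤ d) {v : Measure (S.QS d)} (hv : S.IsVolS d v)
    {μ : Measure (S.G d ⧸ S.Gamma d)} (hμ : S.Admissible d μ) {A : Set (S.QS d)}
    (hA : MeasurableSet A) (hfin : v A ≠ ⊤) :
    meanCount μ (S.primZs d) isSLStable_primZs A = ENNReal.ofReal (1 / S.zetaS d) * v A := by
  set ν := meanCount μ (S.primZs d) isSLStable_primZs with hν
  have hcomp : ∀ k m : ℕ, (S.ratSMul (m : ℚ) ⁻¹' (S.ratSMul (k : ℚ) ⁻¹' A) : Set (S.QS d)) =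
      S.ratSMul ((k * m : ℕ) : ℚ) ⁻¹' A := by
    intro k m
    ext x
    simp only [Set.mem_preimage, ratSMul, Nat.cast_mul, Rat.cast_mul, mul_assoc]
  have key := mul_tsum_eq_of_tsum_mul
    (h := fun n : ℕ+ => if (n : ℕ) ∈ S.NS then ν (S.ratSMul (n : ℕ) ⁻¹' A) else 0)
    (z := fun n : ℕ+ => if (n : ℕ) ∈ S.NS then (((n : ℕ) : ENNReal) ^ d)⁻¹ else 0)
    (V := v A) (fun k m => ?_) (by simp [one_mem_NS]) ?_ hfin fun k => ?_
  · rw [← tsum_NS fun n => ((n : ENNReal) ^ d)⁻¹, ← ofReal_zetaS hd] at key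
    simp only [PNat.val_ofNat, Nat.cast_one, one_mem_NS, if_true] at key
    have h1 : (S.ratSMul (1 : ℚ) ⁻¹' A : Set (S.QS d)) = A := by
      ext x
      simp [ratSMul]
    rw [h1] at key
    rw [← key, one_div, ENNReal.ofReal_inv_of_pos (zetaS_pos hd), mul_comm, mul_assoc,
      ENNReal.mul_inv_cancel (ENNReal.ofReal_pos.2 (zetaS_pos hd)).ne' ENNReal.ofReal_ne_top, mul_one]
  · simp only [PNat.mul_coe, mul_mem_NS, Nat.cast_mul, mul_pow]
    by_cases hk : (k : ℕ) ∈ S.NS <;> by_cases hm : (m : ℕ) ∈ S.NS <;>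
      simp only [hk, hm, and_self, and_true, and_false, if_true, if_false, mul_zero, zero_mul]
    exact ENNReal.mul_inv (Or.inr (by finiteness)) (Or.inl (by finiteness))
  · rw [← tsum_NS fun n => ((n : ENNReal) ^ d)⁻¹, ← ofReal_zetaS hd]
    exact ENNReal.ofReal_ne_top
  · by_cases hk : (k : ℕ) ∈ S.NS
    · simp only [PNat.mul_coe, mul_mem_NS, hk, true_and, if_true]
      have hk0 : ((k : ℕ) : ENNReal) ^ d ≠ 0 := by simp
      rw [← hv.preimage_ratSMul_NS hk hA, mul_comm, ← mul_assoc,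
        ENNReal.inv_mul_cancel hk0 (by finiteness), one_mul,
        ← tsum_NS fun n => ν (S.ratSMul ((k * n : ℕ) : ℚ) ⁻¹' A)]
      simp only [← hcomp]
      rw [hν, ← meanCount_ne_zero_eq_tsum hd μ (measurable_ratSMul _ hA), meanCount_ne_zero hd hv hμ]
    · simp only [PNat.mul_coe, mul_mem_NS, hk, false_and, if_false, tsum_zero, mul_zero]

/-- The mean value formula for the `S`-primitive vectors, as an identity of measures. -/
theorem meanCount_primZs (hd : 2 ≤ d) {v : Measure (S.QS d)} (hv : S.IsVolS d v)
    {μ : Measure (S.G d ⧸ S.Gamma d)} (hμ : S.Admissible d μ) :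
    meanCount μ (S.primZs d) isSLStable_primZs = ENNReal.ofReal (1 / S.zetaS d) • v := by
  have : v.IsAddHaarMeasure := hv.1
  rw [← Measure.restrict_univ (μ := meanCount μ (S.primZs d) isSLStable_primZs),
    ← Measure.restrict_univ (μ := ENNReal.ofReal (1 / S.zetaS d) • v),
    ← iUnion_spanningSets v, Measure.restrict_iUnion_congr]
  refine fun n => Measure.ext fun A hA => ?_
  rw [Measure.restrict_apply hA, Measure.restrict_apply hA, meanCount_primZs_apply hd hv hμ
    (hA.inter (measurableSet_spanningSets v n))
    (measure_ne_top_of_subset Set.inter_subset_right (measure_spanningSets_lt_top v n).ne)]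
  rfl

theorem tsum_prim (φ : S.QS d → ℝ) :
    ∑' v : S.prim d, φ v = ∑' w : S.primZs d, φ (zdiag S d w) :=
  tsum_image φ (zdiag_injective (S := S) (d := d)).injOn

theorem tsum_eq_toReal_sub_toReal (g : S.G d) {f : S.QS d → ℝ} (hf : Measurable f)
    (hpos : ∫⁻ x, ENNReal.ofReal (f x) ∂orbitCount (S.primZs d) g ≠ ⊤)
    (hneg : ∫⁻ x, ENNReal.ofReal (-f x) ∂orbitCount (S.primZs d) g ≠ ⊤) :
    ∑' v : S.prim d, f (S.act g v) =
      (∫⁻ x, ENNReal.ofReal (f x) ∂orbitCount (S.primZs d) g).toReal -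
        (∫⁻ x, ENNReal.ofReal (-f x) ∂orbitCount (S.primZs d) g).toReal := by
  rw [lintegral_orbitCount _ _ hf.ennreal_ofReal] at hpos ⊢
  have hf' : Measurable fun x => ENNReal.ofReal (-f x) := hf.neg.ennreal_ofReal
  rw [lintegral_orbitCount _ _ hf'] at hneg ⊢
  rw [tsum_prim fun x => f (S.act g x),
    ENNReal.tsum_toReal_eq fun _ => ENNReal.ofReal_ne_top,
    ENNReal.tsum_toReal_eq fun _ => ENNReal.ofReal_ne_top,
    ← (ENNReal.summable_toReal hpos).tsum_sub (ENNReal.summable_toReal hneg)]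
  refine tsum_congr fun w => ?_
  rw [ENNReal.toReal_ofReal', ENNReal.toReal_ofReal', max_zero_sub_max_neg_zero_eq_self]

theorem integrable_of_bounded_of_hasCompactSupport {v : Measure (S.QS d)} (hv : S.IsVolS d v)
    {f : S.QS d → ℝ} (hf : Measurable f) (hbdd : ∃ M, ∀ x, |f x| ≤ M)
    (hcpt : HasCompactSupport f) : Integrable f v := by
  have : v.IsAddHaarMeasure := hv.1
  obtain ⟨M, hM⟩ := hbdd
  rw [← integrableOn_iff_integrable_of_support_subset (subset_tsupport f)]
  exact Measure.integrableOn_of_bounded hcpt.isCompact.measure_lt_top.ne hf.aestronglyMeasurable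
    (ae_of_all _ hM)

theorem lintegral_latticeCount_primZs (hd : 2 ≤ d) {v : Measure (S.QS d)} (hv : S.IsVolS d v)
    {μ : Measure (S.G d ⧸ S.Gamma d)} (hμ : S.Admissible d μ) {φ : S.QS d → ENNReal}
    (hφ : Measurable φ) :
    ∫⁻ y, ∫⁻ x, φ x ∂latticeCount (S.primZs d) isSLStable_primZs y ∂μ =
      ENNReal.ofReal (1 / S.zetaS d) * ∫⁻ x, φ x ∂v := by
  rw [← Measure.lintegral_bind (measurable_latticeCount _).aemeasurable hφ.aemeasurable]
  change ∫⁻ x, φ x ∂meanCount μ (S.primZs d) isSLStable_primZs = _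
  rw [meanCount_primZs hd hv hμ, lintegral_smul_measure, smul_eq_mul]

theorem measurable_lintegral_latticeCount {I : Set (Fin d → S.Zs)} (hI : IsSLStable I)
    {φ : S.QS d → ENNReal} (hφ : Measurable φ) :
    Measurable fun y => ∫⁻ x, φ x ∂latticeCount I hI y :=
  (Measure.measurable_lintegral hφ).comp (measurable_latticeCount hI)

end PrimeTup

end MeanValue

open PrimeTup in
/-- **S-arithmetic primitive mean value formula** (Proposition 1.1).
For `d ≥ 2` and `f : ℚ_S^d → ℝ` bounded, compactly supported and semicontinuous, the
`S`-primitive Siegel transform `F(gΓ_d) = ∑_{v ∈ P(ℤ_S^d)} f(g·v)` is integrable on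
`G_d/Γ_d` with respect to any admissible measure `μ`, with
`∫ F dμ = ζ_S(d)⁻¹ ∫ f dvol_S`. -/
theorem primitive_mean_value_formula
    (S : PrimeTup) (d : ℕ) (hd : 2 ≤ d)
    (volS : Measure (S.QS d)) (hvolS : S.IsVolS d volS)
    (μ : Measure (S.G d ⧸ S.Gamma d)) (hμ : S.Admissible d μ)
    (f : S.QS d → ℝ)
    (hbdd : ∃ M, ∀ x, |f x| ≤ M)
    (hcpt : HasCompactSupport f)
    (hsc : UpperSemicontinuous f ∨ LowerSemicontinuous f)
    (F : (S.G d ⧸ S.Gamma d) → ℝ)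
    (hF : ∀ g : S.G d, F (QuotientGroup.mk g) = ∑' v : S.prim d, f (S.act g v)) :
    Integrable F μ ∧ ∫ x, F x ∂μ = (1 / S.zetaS d) * ∫ x, f x ∂volS := by
  have hf : Measurable f := hsc.elim (fun h => h.measurable) fun h => h.measurable
  have hf_int : Integrable f volS := integrable_of_bounded_of_hasCompactSupport hvolS hf hbdd hcpt
  set Fp : (S.G d ⧸ S.Gamma d) → ENNReal := fun y =>
    ∫⁻ x, ENNReal.ofReal (f x) ∂latticeCount (S.primZs d) isSLStable_primZs y with hFp
  set Fn : (S.G d ⧸ S.Gamma d) → ENNReal := fun y =>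
    ∫⁻ x, ENNReal.ofReal (-f x) ∂latticeCount (S.primZs d) isSLStable_primZs y with hFn
  have hFpm : Measurable Fp := measurable_lintegral_latticeCount _ hf.ennreal_ofReal
  have hFnm : Measurable Fn := measurable_lintegral_latticeCount _ hf.neg.ennreal_ofReal
  have hFpi : ∫⁻ y, Fp y ∂μ = ENNReal.ofReal (1 / S.zetaS d) * ∫⁻ x, ENNReal.ofReal (f x) ∂volS :=
    lintegral_latticeCount_primZs hd hvolS hμ hf.ennreal_ofReal
  have hFni : ∫⁻ y, Fn y ∂μ =
      ENNReal.ofReal (1 / S.zetaS d) * ∫⁻ x, ENNReal.ofReal (-f x) ∂volS :=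
    lintegral_latticeCount_primZs hd hvolS hμ hf.neg.ennreal_ofReal
  have hFpt : ∫⁻ y, Fp y ∂μ ≠ ⊤ :=
    hFpi ▸ ENNReal.mul_ne_top ENNReal.ofReal_ne_top hf_int.lintegral_lt_top.ne
  have hFnt : ∫⁻ y, Fn y ∂μ ≠ ⊤ :=
    hFni ▸ ENNReal.mul_ne_top ENNReal.ofReal_ne_top hf_int.neg.lintegral_lt_top.ne
  have hFpae := ae_lt_top hFpm hFpt
  have hFnae := ae_lt_top hFnm hFnt
  have hFae : F =ᵐ[μ] fun y => (Fp y).toReal - (Fn y).toReal := by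
    filter_upwards [hFpae, hFnae] with y hy hy'
    obtain ⟨g, rfl⟩ := QuotientGroup.mk_surjective y
    rw [hF g]
    exact tsum_eq_toReal_sub_toReal g hf hy.ne hy'.ne
  have hFpI := integrable_toReal_of_lintegral_ne_top hFpm.aemeasurable hFpt
  have hFnI := integrable_toReal_of_lintegral_ne_top hFnm.aemeasurable hFnt
  refine ⟨(integrable_congr hFae).2 (hFpI.sub hFnI), ?_⟩
  rw [integral_congr_ae hFae, integral_sub hFpI hFnI, integral_toReal hFpm.aemeasurable hFpae,
    integral_toReal hFnm.aemeasurable hFnae, hFpi, hFni, ENNReal.toReal_mul, ENNReal.toReal_mul,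
    ENNReal.toReal_ofReal (one_div_nonneg.2 (zetaS_pos hd).le), ← mul_sub,
    integral_eq_lintegral_pos_part_sub_lintegral_neg_part hf_int]
end

section
/- Let n ∈ ℤ_S ∖ {0} and let D_n = {(v¹, v²) ∈ P(ℤ_S²) × P(ℤ_S²) : det(v¹, v²) = n}, where det(v¹, v²) is the determinant of the 2×2 matrix with columns v¹ and v². Then D_n is invariant under the diagonal action γ·(v¹, v²) = (γv¹, γv²) of SL₂(ℤ_S), and D_n is the disjoint union of exactly φ(d(n)) orbits of this action, where φ is Euler's totient function; a complete set of orbit representatives is given by the pairs ((1,0)ᵗ, (ℓ,n)ᵗ) for ℓ ∈ {0, 1, …, d(n)−1} with gcd(ℓ, d(n)) = 1. -/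
open MeasureTheory Matrix

namespace PrimeTup

/-- Remove all factors of the primes of `S` from a natural number. -/
def stripS (S : PrimeTup) (m : ℕ) : ℕ :=
  m / ∏ i, (S.p i) ^ (m.factorization (S.p i))

/-- `d(n)` for `n ∈ ℤ_S`: the unique `m ∈ ℕ_S` with `n = ± m · p₁^{k₁} ⋯ p_s^{k_s}`,
obtained by removing all factors of the primes of `S` from the numerator of `n`. -/
def dVal (S : PrimeTup) (n : ℚ) : ℕ := S.stripS n.num.natAbs

end PrimeTup

namespace PrimeTup

theorem mem_primZs_two_iff (S : PrimeTup) (w : Fin 2 → S.Zs) :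
    w ∈ S.primZs 2 ↔ IsCoprime (w 0) (w 1) := by
  constructor
  · rintro ⟨γ, rfl⟩
    have h := γ.det_coe
    rw [Matrix.det_fin_two] at h
    refine ⟨γ 1 1, -γ 0 1, ?_⟩
    simp [Matrix.mulVec, dotProduct, e1]
    linear_combination h
  · rintro ⟨a, b, h⟩
    refine ⟨⟨!![w 0, -b; w 1, a], ?_⟩, ?_⟩
    · rw [Matrix.det_fin_two_of]
      linear_combination h
    · ext i
      fin_cases i <;> simp [Matrix.mulVec, dotProduct, e1]

theorem isUnit_natCast_p (S : PrimeTup) (i : Fin S.s) : IsUnit (S.p i : S.Zs) := by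
  refine IsUnit.of_mul_eq_one ⟨(S.p i : ℚ)⁻¹, Subring.subset_closure ⟨i, rfl⟩⟩ ?_
  have : (S.p i : ℚ) ≠ 0 := by exact_mod_cast (S.hp i).ne_zero
  ext
  simp [this]

/-- Denominators in `ℤ_S` are prime to every integer prime to `S`. -/
theorem exists_coprime_mul_eq_intCast (S : PrimeTup) {m : ℕ}
    (hm : ∀ i, ¬ S.p i ∣ m) (x : S.Zs) :
    ∃ (M : ℕ) (a : ℤ), M.Coprime m ∧ (M : S.Zs) * x = a := by
  suffices h : ∀ y ∈ S.Zs, ∃ (M : ℕ) (a : ℤ), M.Coprime m ∧ (M : ℚ) * y = a by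
    obtain ⟨M, a, hM, h⟩ := h x x.2
    exact ⟨M, a, hM, Subtype.ext (by simpa using h)⟩
  intro y hy
  induction hy using Subring.closure_induction with
  | mem y hy =>
    obtain ⟨i, rfl⟩ := hy
    have : (S.p i : ℚ) ≠ 0 := by exact_mod_cast (S.hp i).ne_zero
    exact ⟨S.p i, 1, (S.hp i).coprime_iff_not_dvd.2 (hm i), by simp [this]⟩
  | zero => exact ⟨1, 0, by simp, by simp⟩
  | one => exact ⟨1, 1, by simp, by simp⟩
  | add y z _ _ ihy ihz =>
    obtain ⟨M, a, hM, ha⟩ := ihy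
    obtain ⟨N, b, hN, hb⟩ := ihz
    refine ⟨M * N, N * a + M * b, hM.mul_left hN, ?_⟩
    push_cast
    linear_combination (N : ℚ) * ha + (M : ℚ) * hb
  | neg y _ ih =>
    obtain ⟨M, a, hM, ha⟩ := ih
    refine ⟨M, -a, hM, ?_⟩
    push_cast
    linear_combination -ha
  | mul y z _ _ ihy ihz =>
    obtain ⟨M, a, hM, ha⟩ := ihy
    obtain ⟨N, b, hN, hb⟩ := ihz
    refine ⟨M * N, a * b, hM.mul_left hN, ?_⟩
    push_cast
    rw [← ha, ← hb]
    ring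

theorem natCast_dvd_intCast_iff (S : PrimeTup) {m : ℕ} (hm : ∀ i, ¬ S.p i ∣ m) (a : ℤ) :
    (m : S.Zs) ∣ (a : S.Zs) ↔ (m : ℤ) ∣ a := by
  constructor
  · rintro ⟨x, hx⟩
    obtain ⟨M, b, hM, hb⟩ := S.exists_coprime_mul_eq_intCast hm x
    have h : (M : ℤ) * a = m * b := by
      have : (M : S.Zs) * a = m * b := by rw [hx, ← hb]; ring
      exact_mod_cast this
    exact (Nat.isCoprime_iff_coprime.2 hM.symm).dvd_of_dvd_mul_left ⟨b, h⟩
  · rintro ⟨b, rfl⟩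
    exact ⟨b, by push_cast; rfl⟩

theorem exists_natCast_dvd_sub (S : PrimeTup) {m : ℕ} (hm : ∀ i, ¬ S.p i ∣ m) (hm0 : m ≠ 0)
    (x : S.Zs) : ∃ l : ℕ, l < m ∧ (m : S.Zs) ∣ x - l := by
  obtain ⟨M, b, hM, hb⟩ := S.exists_coprime_mul_eq_intCast hm x
  obtain ⟨u, v, huv⟩ := Nat.isCoprime_iff_coprime.2 hM
  have hm' : (0 : ℤ) < m := by omega
  obtain ⟨l, hl⟩ := Int.eq_ofNat_of_zero_le (Int.emod_nonneg (u * b) hm'.ne')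
  refine ⟨l, ?_, v * x + (u * b / m : ℤ), ?_⟩
  · have := Int.emod_lt_of_pos (u * b) hm'
    omega
  · have h := Int.emod_add_mul_ediv (u * b) m
    rw [hl] at h
    have h' : (l : S.Zs) + m * (u * b / m : ℤ) = u * b := by exact_mod_cast h
    have huv' : (u : S.Zs) * M + v * m = 1 := by exact_mod_cast huv
    linear_combination (-x) * huv' + (u : S.Zs) * hb - h'

theorem isCoprime_natCast_iff (S : PrimeTup) {m : ℕ} (hm : ∀ i, ¬ S.p i ∣ m) (l : ℕ) :
    IsCoprime (l : S.Zs) (m : S.Zs) ↔ l.Coprime m := by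
  refine ⟨?_, Nat.Coprime.cast⟩
  rintro ⟨a, b, h⟩
  have hg : ∀ i, ¬ S.p i ∣ l.gcd m := fun i hi => hm i (hi.trans (Nat.gcd_dvd_right l m))
  have h1 : ((l.gcd m : ℕ) : S.Zs) ∣ ((1 : ℤ) : S.Zs) := by
    rw [Int.cast_one, ← h]
    exact dvd_add (Dvd.dvd.mul_left (Nat.cast_dvd_cast (Nat.gcd_dvd_left l m)) a)
      (Dvd.dvd.mul_left (Nat.cast_dvd_cast (Nat.gcd_dvd_right l m)) b)
  have h2 := (S.natCast_dvd_intCast_iff hg 1).1 h1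
  exact Nat.dvd_one.1 (by exact_mod_cast h2)

theorem stripS_mul_prod (S : PrimeTup) (m : ℕ) :
    S.stripS m * ∏ i, S.p i ^ m.factorization (S.p i) = m := by
  refine Nat.div_mul_cancel (Finset.prod_dvd_of_isRelPrime ?_ fun i _ => Nat.ordProj_dvd m (S.p i))
  intro i _ j _ hij
  exact Nat.coprime_iff_isRelPrime.1 (Nat.Coprime.pow _ _
    ((Nat.coprime_primes (S.hp i) (S.hp j)).2 (S.inj.ne hij)))

theorem not_dvd_stripS (S : PrimeTup) {m : ℕ} (hm : m ≠ 0) (i : Fin S.s) :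
    ¬ S.p i ∣ S.stripS m := by
  intro h
  refine Nat.pow_succ_factorization_not_dvd hm (S.hp i) ?_
  conv_rhs => rw [← S.stripS_mul_prod m]
  rw [pow_succ, mul_comm]
  exact mul_dvd_mul h (Finset.dvd_prod_of_mem _ (Finset.mem_univ i))

theorem associated_natCast_dVal (S : PrimeTup) (n : S.Zs) :
    Associated n (S.dVal (n : ℚ) : S.Zs) := by
  obtain ⟨a, b, hab⟩ : IsCoprime (n : ℚ).num ((n : ℚ).den : ℤ) :=
    Int.isCoprime_iff_nat_coprime.2 (n : ℚ).reduced
  have hn : n * ((n : ℚ).den : S.Zs) = ((n : ℚ).num : S.Zs) :=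
    Subtype.ext (by simp [Rat.mul_den_eq_num])
  have hden : IsUnit ((n : ℚ).den : S.Zs) := by
    refine IsUnit.of_mul_eq_one (a * n + b) ?_
    have hab' : (a : S.Zs) * (n : ℚ).num + b * (n : ℚ).den = 1 := by exact_mod_cast hab
    linear_combination (a : S.Zs) * hn + hab'
  have hprod : IsUnit ((∏ i, S.p i ^ (n : ℚ).num.natAbs.factorization (S.p i) : ℕ) : S.Zs) := by
    push_cast
    exact IsUnit.prod_univ_iff.2 fun i => (S.isUnit_natCast_p i).pow _
  have h1 : Associated n ((n : ℚ).num : S.Zs) :=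
    hn ▸ (associated_mul_isUnit_right_iff hden).2 (Associated.refl n)
  have h2 : Associated ((n : ℚ).num : S.Zs) ((n : ℚ).num.natAbs : S.Zs) := by
    simp
  have h3 : Associated ((n : ℚ).num.natAbs : S.Zs) (S.dVal (n : ℚ) : S.Zs) := by
    conv_lhs => rw [← S.stripS_mul_prod (n : ℚ).num.natAbs]
    rw [Nat.cast_mul]
    exact (associated_mul_isUnit_left_iff hprod).2 (Associated.refl _)
  exact (h1.trans h2).trans h3

end PrimeTup

open PrimeTup in
/-- **Orbit decomposition of `D_n`** (Lemma 3.3).  For `n ∈ ℤ_S ∖ {0}`, the set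
`D_n = {(v¹,v²) ∈ P(ℤ_S²)² : det(v¹,v²) = n}` is invariant under the diagonal
`SL₂(ℤ_S)`-action and is the disjoint union of exactly `φ(d(n))` orbits, with
representatives `((1,0)ᵗ, (ℓ,n)ᵗ)` for `0 ≤ ℓ < d(n)`, `gcd(ℓ, d(n)) = 1`. -/
theorem Dn_orbit_decomposition
    (S : PrimeTup) (n : S.Zs) (hn : n ≠ 0)
    (Dn : Set ((Fin 2 → S.Zs) × (Fin 2 → S.Zs)))
    (hDn : Dn = {vw | vw.1 ∈ S.primZs 2 ∧ vw.2 ∈ S.primZs 2 ∧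
      vw.1 0 * vw.2 1 - vw.1 1 * vw.2 0 = n}) :
    (∀ γ : Matrix.SpecialLinearGroup (Fin 2) S.Zs, ∀ vw ∈ Dn,
        ((γ : Matrix (Fin 2) (Fin 2) S.Zs).mulVec vw.1,
         (γ : Matrix (Fin 2) (Fin 2) S.Zs).mulVec vw.2) ∈ Dn) ∧
    (∀ ℓ : ℕ, ℓ < S.dVal (n : ℚ) → Nat.Coprime ℓ (S.dVal (n : ℚ)) →
        (S.e1 2, (![(ℓ : S.Zs), n] : Fin 2 → S.Zs)) ∈ Dn) ∧
    (∀ vw ∈ Dn, ∃! ℓ : ℕ, (ℓ < S.dVal (n : ℚ) ∧ Nat.Coprime ℓ (S.dVal (n : ℚ))) ∧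
        ∃ γ : Matrix.SpecialLinearGroup (Fin 2) S.Zs,
          vw = ((γ : Matrix (Fin 2) (Fin 2) S.Zs).mulVec (S.e1 2),
                (γ : Matrix (Fin 2) (Fin 2) S.Zs).mulVec ![(ℓ : S.Zs), n])) ∧
    ((Finset.range (S.dVal (n : ℚ))).filter
        (fun ℓ => Nat.Coprime ℓ (S.dVal (n : ℚ)))).card = Nat.totient (S.dVal (n : ℚ)) := by
  have hn0 : (n : ℚ).num.natAbs ≠ 0 := by simpa using hn
  have hS : ∀ i, ¬ S.p i ∣ S.dVal (n : ℚ) := fun i => S.not_dvd_stripS hn0 i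
  have hnd := S.associated_natCast_dVal n
  have hD0 : S.dVal (n : ℚ) ≠ 0 := fun h => hn (by simpa [h] using hnd)
  have hcop : ∀ l : ℕ, IsCoprime (l : S.Zs) n ↔ l.Coprime (S.dVal (n : ℚ)) := fun l => by
    rw [← S.isCoprime_natCast_iff hS]
    exact ⟨fun h => h.of_isCoprime_of_dvd_right hnd.symm.dvd,
      fun h => h.of_isCoprime_of_dvd_right hnd.dvd⟩
  subst hDn
  refine ⟨?_, ?_, ?_, ?_⟩
  · rintro γ ⟨v, w⟩ ⟨⟨α, hα⟩, ⟨β, hβ⟩, h⟩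
    refine ⟨⟨γ * α, ?_⟩, ⟨γ * β, ?_⟩, ?_⟩
    · rw [Matrix.SpecialLinearGroup.coe_mul, ← Matrix.mulVec_mulVec, ← hα]
    · rw [Matrix.SpecialLinearGroup.coe_mul, ← Matrix.mulVec_mulVec, ← hβ]
    have hγ := γ.det_coe
    rw [Matrix.det_fin_two] at hγ
    simp only [Matrix.mulVec, dotProduct, Fin.sum_univ_two] at h ⊢
    linear_combination (v 0 * w 1 - v 1 * w 0) * hγ + h
  · intro l _ hl
    refine ⟨⟨1, by simp⟩, (S.mem_primZs_two_iff _).2 ((hcop l).2 hl), ?_⟩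
    simp [e1]
  · rintro ⟨v, w⟩ ⟨⟨γ, hγv⟩, hw, h⟩
    have hγ := γ.det_coe
    rw [Matrix.det_fin_two] at hγ
    have hv0 : v 0 = γ 0 0 := by simp_all [e1]
    have hv1 : v 1 = γ 1 0 := by simp_all [e1]
    simp only [hv0, hv1] at h
    obtain ⟨r, s, hrs⟩ := (S.mem_primZs_two_iff w).1 hw
    set x : S.Zs := γ 1 1 * w 0 - γ 0 1 * w 1 with hx
    obtain ⟨l, hl, hlx⟩ := S.exists_natCast_dvd_sub hS hD0 x
    obtain ⟨t, ht⟩ := hnd.dvd.trans hlx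
    have hw0 : w 0 = γ 0 0 * x + γ 0 1 * n := by
      rw [hx]
      linear_combination (-w 0) * hγ + γ 0 1 * h
    have hw1 : w 1 = γ 1 0 * x + γ 1 1 * n := by
      rw [hx]
      linear_combination (-w 1) * hγ + γ 1 1 * h
    refine ⟨l, ⟨⟨hl, (hcop l).1 ?_⟩, ⟨!![γ 0 0, γ 0 0 * t + γ 0 1; γ 1 0, γ 1 0 * t + γ 1 1], ?_⟩, ?_⟩, ?_⟩
    · refine ⟨r * γ 0 0 + s * γ 1 0,
        (r * γ 0 0 + s * γ 1 0) * t + r * γ 0 1 + s * γ 1 1, ?_⟩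
      linear_combination hrs - r * hw0 - s * hw1 - (r * γ 0 0 + s * γ 1 0) * ht
    · rw [Matrix.det_fin_two_of]
      linear_combination hγ
    · refine Prod.ext (funext fun i => ?_) (funext fun i => ?_) <;> fin_cases i <;>
        simp [Matrix.mulVec, dotProduct, Fin.sum_univ_two, e1]
      · exact hv0
      · exact hv1
      · linear_combination hw0 + γ 0 0 * ht
      · linear_combination hw1 + γ 1 0 * ht
    · rintro k ⟨⟨hk, -⟩, δ, hδ⟩
      have hδ1 := congrArg Prod.fst hδ
      have hδ2 := congrArg Prod.snd hδ
      have a0 := congrFun hδ1 0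
      have a1 := congrFun hδ1 1
      have b0 := congrFun hδ2 0
      have b1 := congrFun hδ2 1
      simp [Matrix.mulVec, dotProduct, Fin.sum_univ_two, e1] at a0 a1 b0 b1
      rw [hv0] at a0
      rw [hv1] at a1
      rw [← a0] at b0
      rw [← a1] at b1
      have hd : n ∣ ((k - l : ℤ) : S.Zs) := by
        refine ⟨t - γ 1 1 * δ 0 1 + γ 0 1 * δ 1 1, ?_⟩
        push_cast
        linear_combination ht - (k : S.Zs) * hγ - hx - γ 1 1 * b0 + γ 0 1 * b1
      have := (S.natCast_dvd_intCast_iff hS _).1 (hnd.symm.dvd.trans hd)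
      have := Int.eq_zero_of_abs_lt_dvd this (by rw [abs_lt]; omega)
      omega
  · rw [Nat.totient]
    simp only [Nat.coprime_comm]
end

section
/- Let d ≥ 2. For every nonnegative, bounded, compactly supported, semicontinuous function F : ℚ_S^d × ℚ_S^d → ℝ, the sum ∑_{k ∈ ℤ_S^×} ∫_{ℚ_S^d} F(x, k·x) dvol_S(x) is finite. -/
open MeasureTheory Matrix

/-- If `N` translates of a measurable set `B` are pairwise disjoint and contained in `A`, then
`N * μ B ≤ μ A`. -/
theorem natCast_mul_measure_le_of_disjoint_translates {G : Type*} [MeasurableSpace G] [AddGroup G]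
    [MeasurableAdd G] (μ : Measure G) [μ.IsAddRightInvariant] {A B : Set G}
    (hB : MeasurableSet B) (N : ℕ) (g : ℕ → G)
    (hsub : ∀ t < N, ∀ x ∈ B, x + g t ∈ A)
    (hdisj : ∀ t < N, ∀ t' < N, ∀ x ∈ B, ∀ y ∈ B, x + g t = y + g t' → t = t') :
    (N : ENNReal) * μ B ≤ μ A := by
  have hpre : ∀ t < N, (fun x => x + -g t) ⁻¹' B ⊆ A := by
    intro t ht x hx
    simpa using hsub t ht _ hx
  calc (N : ENNReal) * μ B
      = ∑ t ∈ Finset.range N, μ ((fun x => x + -g t) ⁻¹' B) := by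
        simp only [measure_preimage_add_right, Finset.sum_const, Finset.card_range, nsmul_eq_mul]
    _ = μ (⋃ t ∈ Finset.range N, (fun x => x + -g t) ⁻¹' B) := by
        refine (measure_biUnion_finset ?_ fun t _ => measurable_add_const _ hB).symm
        intro t ht t' ht' hne
        refine Set.disjoint_left.2 fun x hx hx' => hne ?_
        refine hdisj t (by simpa using ht) t' (by simpa using ht') _ hx _ hx' ?_
        simp
    _ ≤ μ A := by
        refine measure_mono (Set.iUnion₂_subset fun t ht => hpre t (by simpa using ht))

theorem Padic.one_lt_norm_rat_of_dvd_den {p : ℕ} [Fact p.Prime] {q : ℚ} (h : p ∣ q.den) :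
    1 < ‖(q : ℚ_[p])‖ := by
  by_contra! hle
  have hp : p.Prime := Fact.out
  have hnum : ¬ (p : ℤ) ∣ q.num := by
    intro hn
    exact Nat.not_coprime_of_dvd_of_dvd hp.one_lt (Int.natCast_dvd.1 hn) h q.reduced
  have h1 : ¬ ‖((q.num : ℤ) : ℚ_[p])‖ < 1 := by rwa [Padic.norm_intCast_lt_one_iff]
  have h2 : ‖((q.den : ℤ) : ℚ_[p])‖ < 1 := by
    rw [Padic.norm_intCast_lt_one_iff]; exact_mod_cast h
  have h3 : (q : ℚ_[p]) * ((q.den : ℤ) : ℚ_[p]) = ((q.num : ℤ) : ℚ_[p]) := by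
    exact_mod_cast congrArg (Rat.cast : ℚ → ℚ_[p]) (Rat.mul_den_eq_num q)
  apply h1
  rw [← h3, norm_mul]
  nlinarith [norm_nonneg ((q.den : ℤ) : ℚ_[p]), norm_nonneg (q : ℚ_[p])]

namespace PrimeTup

/-- The primes `p i` as a finset. -/
def primes (S : PrimeTup) : Finset ℕ := Finset.univ.image S.p

theorem den_mem_factoredNumbers (S : PrimeTup) {x : ℚ} (hx : x ∈ S.Zs) :
    x.den ∈ Nat.factoredNumbers S.primes := by
  have h_one : 1 ∈ Nat.factoredNumbers S.primes := by simp [Nat.mem_factoredNumbers]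
  refine Subring.closure_induction (p := fun x _ => x.den ∈ Nat.factoredNumbers S.primes)
    ?_ ?_ ?_ ?_ ?_ ?_ hx
  · rintro _ ⟨i, rfl⟩
    have : ((S.p i : ℚ)⁻¹).den = S.p i := by
      simp [(S.hp i).ne_zero]
    rw [this, Nat.mem_factoredNumbers]
    refine ⟨(S.hp i).ne_zero, fun q hq => ?_⟩
    rw [Nat.primeFactorsList_prime (S.hp i), List.mem_singleton] at hq
    simp [primes, hq]
  · exact h_one
  · exact h_one
  · intro x y _ _ hx hy
    exact Nat.mem_factoredNumbers_of_dvd (Nat.mul_mem_factoredNumbers hx hy) (Rat.add_den_dvd x y)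
  · intro x _ hx
    simpa using hx
  · intro x y _ _ hx hy
    exact Nat.mem_factoredNumbers_of_dvd (Nat.mul_mem_factoredNumbers hx hy) (Rat.mul_den_dvd x y)

theorem coe_unit_ne_zero (S : PrimeTup) (k : S.Zsˣ) : ((k : S.Zs) : ℚ) ≠ 0 := by
  simp

theorem num_natAbs_mem_factoredNumbers (S : PrimeTup) (k : S.Zsˣ) :
    ((k : S.Zs) : ℚ).num.natAbs ∈ Nat.factoredNumbers S.primes := by
  have h := S.den_mem_factoredNumbers ((k⁻¹ : S.Zsˣ) : S.Zs).2
  have hinv : (((k⁻¹ : S.Zsˣ) : S.Zs) : ℚ) = (((k : S.Zs) : ℚ))⁻¹ := by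
    refine eq_inv_of_mul_eq_one_left ?_
    exact_mod_cast congrArg (Subtype.val : S.Zs → ℚ) k.inv_mul
  rw [hinv, Rat.den_inv_of_ne_zero (S.coe_unit_ne_zero k)] at h
  exact h

/-- The completely multiplicative function `n ↦ 1 / √n`. -/
noncomputable def invSqrt : ℕ →* ℝ where
  toFun n := (√(n : ℝ))⁻¹
  map_one' := by simp
  map_mul' m n := by simp [mul_comm]

theorem summable_invSqrt_num_mul_den (S : PrimeTup) :
    Summable fun k : S.Zsˣ =>
      invSqrt ((k : S.Zs) : ℚ).num.natAbs * invSqrt ((k : S.Zs) : ℚ).den := by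
  have h : Summable fun m : Nat.factoredNumbers S.primes => ‖invSqrt m‖ := by
    refine (EulerProduct.summable_and_hasSum_factoredNumbers_prod_filter_prime_geometric
      (f := invSqrt) (fun {p} hp => ?_) S.primes).1
    have h1 : 1 < √(p : ℝ) := by
      rw [Real.lt_sqrt zero_le_one]
      exact_mod_cast (by simpa using hp.one_lt)
    simpa [invSqrt, abs_of_nonneg] using inv_lt_one_of_one_lt₀ h1
  have h2 := (h.of_norm.mul_of_nonneg h.of_norm (fun m => by simp [invSqrt])
    (fun m => by simp [invSqrt]))
  have h3 : Summable fun x : SignType ×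
      (Nat.factoredNumbers S.primes × Nat.factoredNumbers S.primes) =>
      (1 : ℝ) * (invSqrt x.2.1 * invSqrt x.2.2) :=
    (Summable.of_finite (f := fun _ : SignType => (1 : ℝ))).mul_of_nonneg h2
      (fun _ => zero_le_one) (fun x => by simp [invSqrt, mul_nonneg])
  let e : S.Zsˣ → SignType × (Nat.factoredNumbers S.primes × Nat.factoredNumbers S.primes) :=
    fun k => (SignType.sign ((k : S.Zs) : ℚ).num,
      ⟨_, S.num_natAbs_mem_factoredNumbers k⟩, ⟨_, S.den_mem_factoredNumbers (k : S.Zs).2⟩)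
  have he : Function.Injective e := by
    intro k l hkl
    simp only [e, Prod.mk.injEq, Subtype.mk.injEq] at hkl
    obtain ⟨hs, hn, hd⟩ := hkl
    refine Units.ext (Subtype.ext (Rat.ext ?_ hd))
    rw [← sign_mul_abs ((k : S.Zs) : ℚ).num, ← sign_mul_abs ((l : S.Zs) : ℚ).num, hs,
      Int.abs_eq_natAbs, Int.abs_eq_natAbs, hn]
  simpa [e, Function.comp_def] using h3.comp_injective he

theorem den_dvd_of_norm_mul_le_one (S : PrimeTup) {k : ℚ} (hk : k ∈ S.Zs) (m : ℤ)
    (h : ∀ i, ‖((k * m : ℚ) : S.Qp i)‖ ≤ 1) : (k.den : ℤ) ∣ m := by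
  have hden : (k * m).den = 1 := by
    by_contra hne
    obtain ⟨q, hq, hqd⟩ := Nat.exists_prime_and_dvd hne
    have hmem := S.den_mem_factoredNumbers (S.Zs.mul_mem hk (intCast_mem S.Zs m))
    have hqS : q ∈ S.primes := (Nat.mem_factoredNumbers.1 hmem).2 q
      ((Nat.mem_primeFactorsList (Rat.den_nz _)).2 ⟨hq, hqd⟩)
    obtain ⟨i, -, rfl⟩ := Finset.mem_image.1 hqS
    exact absurd (h i) (not_le.2 (Padic.one_lt_norm_rat_of_dvd_den hqd))
  have hz : ((k * m).num : ℚ) = k * m := Rat.coe_int_num_of_den_eq_one hden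
  have hnd : (k.num : ℚ) * m = k.den * (k * m).num := by
    rw [hz, ← mul_assoc, Rat.den_mul_eq_num]
  have hdvd : (k.den : ℤ) ∣ k.num * m := ⟨_, by exact_mod_cast hnd⟩
  refine IsCoprime.dvd_of_dvd_mul_left ?_ hdvd
  rw [Int.isCoprime_iff_gcd_eq_one, Int.gcd_comm]
  simpa [Int.gcd] using k.reduced

theorem continuous_ratSMul (S : PrimeTup) (d : ℕ) (q : ℚ) :
    Continuous (S.ratSMul q : S.QS d → S.QS d) := by
  unfold ratSMul
  fun_prop

/-- The points of the ball of radius `R` which `q` maps to the ball of radius `R`. -/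
def ballInter (S : PrimeTup) (d : ℕ) (R : ℝ) (q : ℚ) : Set (S.QS d) :=
  {x | ‖x‖ ≤ R ∧ ‖S.ratSMul q x‖ ≤ R}

theorem measurableSet_ballInter (S : PrimeTup) (d : ℕ) (R : ℝ) (q : ℚ) :
    MeasurableSet (S.ballInter d R q) :=
  ((isClosed_le continuous_norm continuous_const).inter
    (isClosed_le (S.continuous_ratSMul d q).norm continuous_const)).measurableSet

theorem norm_fst_apply_le (S : PrimeTup) {d : ℕ} (x : S.QS d) (j : Fin d) : |x.1 j| ≤ ‖x‖ :=
  (norm_le_pi_norm x.1 j).trans (norm_fst_le x)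

theorem norm_snd_apply_le (S : PrimeTup) {d : ℕ} (x : S.QS d) (i : Fin S.s) (j : Fin d) :
    ‖x.2 i j‖ ≤ ‖x‖ :=
  (norm_le_pi_norm (x.2 i) j).trans ((norm_le_pi_norm x.2 i).trans (norm_snd_le x))

theorem norm_le_of_apply_le (S : PrimeTup) {d : ℕ} {x : S.QS d} {r : ℝ} (hr : 0 ≤ r)
    (h1 : ∀ j, |x.1 j| ≤ r) (h2 : ∀ i j, ‖x.2 i j‖ ≤ r) : ‖x‖ ≤ r :=
  norm_prod_le_iff.2 ⟨(pi_norm_le_iff_of_nonneg hr).2 h1,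
    (pi_norm_le_iff_of_nonneg hr).2 fun i => (pi_norm_le_iff_of_nonneg hr).2 (h2 i)⟩

/-- The measure of `ballInter` is at most a constant divided by the height of `k`. -/
theorem exists_height_mul_measure_ballInter_le (S : PrimeTup) {d : ℕ} (hd : 0 < d)
    (v : Measure (S.QS d)) [v.IsAddHaarMeasure] {R : ℝ} (hR : 0 ≤ R) :
    ∃ C : ENNReal, C ≠ ⊤ ∧ ∀ k ∈ S.Zs,
      ((max k.num.natAbs k.den : ℕ) : ENNReal) * v (S.ballInter d R k) ≤ C := by
  have : BorelSpace (S.QS d) := inferInstance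
  choose c hc using fun i : Fin S.s => NormedField.exists_lt_norm (S.Qp i) (2 * R)
  let w : S.QS d := (fun _ => 2 * R + 1, fun i _ => c i)
  refine ⟨v (Metric.closedBall 0 (R + ‖w‖)),
    (isCompact_closedBall _ _).measure_lt_top.ne, fun k hk => ?_⟩
  set N := max k.num.natAbs k.den with hN
  have hden : (0 : ℝ) < k.den := by exact_mod_cast k.den_pos
  have hNpos : (0 : ℝ) < N := hden.trans_le (by exact_mod_cast le_max_right _ _)
  have hkabs : |(k : ℝ)| * k.den = k.num.natAbs := by
    have : (k : ℝ) * k.den = k.num := by exact_mod_cast Rat.mul_den_eq_num k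
    rw [Nat.cast_natAbs, Int.cast_abs, ← this, abs_mul, abs_of_pos hden]
  have hbound : ∀ x ∈ S.ballInter d R k, ∀ j, |x.1 j| * N ≤ R * k.den := by
    intro x hx j
    have h1 : |x.1 j| ≤ R := (S.norm_fst_apply_le x j).trans hx.1
    have h2 : |(k : ℝ) * x.1 j| ≤ R := (S.norm_fst_apply_le (S.ratSMul k x) j).trans hx.2
    rw [abs_mul] at h2
    rcases max_choice k.num.natAbs k.den with h | h <;> rw [hN, h]
    · rw [← hkabs]
      nlinarith
    · nlinarith
  let g : ℕ → S.QS d := fun t => (fun _ => (2 * R + 1) * t / N, fun i _ => t * c i)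
  refine natCast_mul_measure_le_of_disjoint_translates v (S.measurableSet_ballInter d R k) N g
    (fun t ht x hx => ?_) (fun t _ t' _ x hx y hy hxy => ?_)
  · rw [mem_closedBall_zero_iff]
    refine (norm_add_le _ _).trans (add_le_add hx.1 ?_)
    refine S.norm_le_of_apply_le (norm_nonneg w) (fun j => ?_) (fun i j => ?_)
    · refine le_trans ?_ (S.norm_fst_apply_le w j)
      have htN : (t : ℝ) / N ≤ 1 := by
        rw [div_le_one hNpos]
        exact_mod_cast ht.le
      have h0 : (0 : ℝ) ≤ t / N := by positivity
      change |(2 * R + 1) * t / N| ≤ |2 * R + 1|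
      rw [mul_div_assoc, abs_mul, abs_of_nonneg h0]
      exact mul_le_of_le_one_right (abs_nonneg _) htN
    · refine le_trans ?_ (S.norm_snd_apply_le w i j)
      change ‖(t : S.Qp i) * c i‖ ≤ ‖c i‖
      rw [norm_mul]
      have : ‖(t : S.Qp i)‖ ≤ 1 := by exact_mod_cast Padic.norm_int_le_one (p := S.p i) (t : ℤ)
      exact mul_le_of_le_one_left (norm_nonneg _) this
  · let j : Fin d := ⟨0, hd⟩
    have hdvd : (k.den : ℤ) ∣ (t : ℤ) - t' := by
      refine S.den_dvd_of_norm_mul_le_one hk _ fun i => ?_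
      have hi : x.2 i j + t * c i = y.2 i j + t' * c i :=
        congrFun (congrFun (congrArg Prod.snd hxy) i) j
      have hx2 : ‖(k : S.Qp i) * x.2 i j‖ ≤ R :=
        (S.norm_snd_apply_le (S.ratSMul k x) i j).trans hx.2
      have hy2 : ‖(k : S.Qp i) * y.2 i j‖ ≤ R :=
        (S.norm_snd_apply_le (S.ratSMul k y) i j).trans hy.2
      have heq : ((k * ((t : ℤ) - t' : ℤ) : ℚ) : S.Qp i) * c i
          = (k : S.Qp i) * y.2 i j - (k : S.Qp i) * x.2 i j := by
        push_cast
        linear_combination (k : S.Qp i) * hi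
      have hle := norm_sub_le ((k : S.Qp i) * y.2 i j) ((k : S.Qp i) * x.2 i j)
      rw [← heq, norm_mul] at hle
      have := hc i
      by_contra! hlt
      nlinarith
    have hlt : |((t : ℤ) - t' : ℤ)| < k.den := by
      have hj : x.1 j + (2 * R + 1) * t / N = y.1 j + (2 * R + 1) * t' / N :=
        congrFun (congrArg Prod.fst hxy) j
      have heq : (2 * R + 1) * ((t : ℝ) - t') = y.1 j * N - x.1 j * N := by
        field_simp at hj
        linear_combination hj
      have hle : (2 * R + 1) * |(t : ℝ) - t'| ≤ 2 * R * k.den := by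
        have h1 := abs_sub (y.1 j * N) (x.1 j * N)
        rw [← heq, abs_mul, abs_mul, abs_mul, abs_of_pos hNpos,
          abs_of_nonneg (by linarith : 0 ≤ 2 * R + 1)] at h1
        linarith [hbound x hx j, hbound y hy j]
      have : |(t : ℝ) - t'| < k.den := by
        by_contra! hge
        nlinarith
      exact_mod_cast this
    have := Int.eq_zero_of_abs_lt_dvd hdvd hlt
    omega

theorem inv_height_le (k : ℚ) (hk : k ≠ 0) :
    ((max k.num.natAbs k.den : ℕ) : ENNReal)⁻¹ ≤
      ENNReal.ofReal (invSqrt k.num.natAbs * invSqrt k.den) := by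
  have hd : (0 : ℝ) < k.den := by exact_mod_cast k.den_pos
  have hn : (0 : ℝ) < k.num.natAbs := by
    exact_mod_cast Int.natAbs_pos.2 (Rat.num_ne_zero.2 hk)
  have hN : (0 : ℝ) < ((max k.num.natAbs k.den : ℕ) : ℝ) :=
    hd.trans_le (by exact_mod_cast le_max_right _ _)
  rw [← ENNReal.ofReal_natCast, ← ENNReal.ofReal_inv_of_pos hN]
  refine ENNReal.ofReal_le_ofReal ?_
  change _ ≤ (√(k.num.natAbs : ℝ))⁻¹ * (√(k.den : ℝ))⁻¹
  rw [← mul_inv]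
  refine inv_anti₀ (by positivity) ?_
  rw [← Real.sqrt_mul hn.le, Real.sqrt_le_left hN.le, sq]
  push_cast
  gcongr
  · exact le_max_left _ _
  · exact le_max_right _ _

end PrimeTup

open PrimeTup in
/-- **Finiteness of the diagonal-units term** (Lemma 3.5).  For `d ≥ 2` and a nonnegative,
bounded, compactly supported, semicontinuous `F : ℚ_S^d × ℚ_S^d → ℝ`, the sum
`∑_{k ∈ ℤ_S^×} ∫ F(x, k·x) dvol_S(x)` is finite. -/
theorem units_sum_finite
    (S : PrimeTup) (d : ℕ) (hd : 2 ≤ d)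
    (volS : Measure (S.QS d)) (hvolS : S.IsVolS d volS)
    (F : S.QS d × S.QS d → ℝ)
    (hnonneg : ∀ x, 0 ≤ F x)
    (hbdd : ∃ M, ∀ x, |F x| ≤ M)
    (hcpt : HasCompactSupport F)
    (hsc : UpperSemicontinuous F ∨ LowerSemicontinuous F) :
    ∑' k : (S.Zs)ˣ,
        ∫⁻ x, ENNReal.ofReal (F (x, S.ratSMul ((k : S.Zs) : ℚ) x)) ∂volS ≠ ⊤ := by
  obtain ⟨M, hM⟩ := hbdd
  obtain ⟨R, hRpos, hR⟩ := hcpt.isCompact.isBounded.exists_pos_norm_le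
  have := hvolS.1
  obtain ⟨C, hC, hmeas⟩ :=
    S.exists_height_mul_measure_ballInter_le (by omega : 0 < d) volS hRpos.le
  have hterm : ∀ k : (S.Zs)ˣ,
      ∫⁻ x, ENNReal.ofReal (F (x, S.ratSMul ((k : S.Zs) : ℚ) x)) ∂volS ≤
        ENNReal.ofReal M * C * ENNReal.ofReal
          (invSqrt ((k : S.Zs) : ℚ).num.natAbs * invSqrt ((k : S.Zs) : ℚ).den) := by
    intro k
    set q : ℚ := ((k : S.Zs) : ℚ)
    have hpt : ∀ x, ENNReal.ofReal (F (x, S.ratSMul q x)) ≤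
        (S.ballInter d R q).indicator (fun _ => ENNReal.ofReal M) x := by
      intro x
      by_cases h : F (x, S.ratSMul q x) = 0
      · simp [h]
      · have hle := hR _ (subset_tsupport F h)
        have hx : x ∈ S.ballInter d R q := norm_prod_le_iff.1 hle
        rw [Set.indicator_of_mem hx]
        exact ENNReal.ofReal_le_ofReal ((le_abs_self _).trans (hM _))
    have hv : volS (S.ballInter d R q) ≤
        C * ENNReal.ofReal (invSqrt q.num.natAbs * invSqrt q.den) := by
      refine le_trans ?_ (mul_le_mul_right (inv_height_le q (S.coe_unit_ne_zero k)) C)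
      rw [← div_eq_mul_inv, ENNReal.le_div_iff_mul_le (Or.inl ?_) (Or.inl (by simp)), mul_comm]
      · exact hmeas q (k : S.Zs).2
      · have := q.den_pos
        exact_mod_cast (by omega : max q.num.natAbs q.den ≠ 0)
    refine (lintegral_mono hpt).trans ?_
    rw [lintegral_indicator_const (S.measurableSet_ballInter d R q), mul_assoc]
    gcongr
  refine ne_top_of_le_ne_top ?_ (ENNReal.tsum_le_tsum hterm)
  rw [ENNReal.tsum_mul_left]
  exact ENNReal.mul_ne_top (ENNReal.mul_ne_top ENNReal.ofReal_ne_top hC)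
    S.summable_invSqrt_num_mul_den.tsum_ofReal_ne_top
end
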